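/- (Strict boundary derivative inequality for the first eigenfunction.) Let s ∈ (0, r1−r0) and let y_{1,s} be a first eigenfunction of Ω(s). Assume moreover that for every continuous nonnegative boundary datum h' on the boundary of the half-domain O = {x ∈ Ω(s) : x1 > s}, the problem −Δ_p w = λ1(Ω(s)) |w|^{p−2} w in O, w = h' on ∂O, has exactly one nonnegative bounded weak solution continuous on the closure of O. Then for every x = (x1,…,xN) ∈ ∂B(s e1, r0) with x1 > s, ⟨∇y_{1,s}(x'), n(x')⟩ < ⟨∇y_{1,s}(x), n(x)⟩ < 0, where x' = (2s−x1, x2,…,xN) and n(z) = (s e1 − z)/r0 denotes the unit normal on ∂B(s e1, r0) pointing out of Ω(s). -/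

import Mathlib

open MeasureTheory RealInnerProductSpace Metric Set

noncomputable section

/-- Smooth test functions compactly supported in `U` (the class `C_c^∞(U)`). -/
def IsTestFun {N : ℕ} (U : Set (EuclideanSpace ℝ (Fin N)))
    (φ : EuclideanSpace ℝ (Fin N) → ℝ) : Prop :=
  ContDiff ℝ (⊤ : ℕ∞) φ ∧ HasCompactSupport φ ∧ tsupport φ ⊆ U

/-- `u` is a weak solution of `-Δ_p u = h` in `U`:
`∫_U |∇u|^{p-2} ⟨∇u, ∇φ⟩ = ∫_U h φ` for all test functions `φ`. -/
def IsWeakSolution (p : ℝ) {N : ℕ} (U : Set (EuclideanSpace ℝ (Fin N)))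
    (u h : EuclideanSpace ℝ (Fin N) → ℝ) : Prop :=
  ∀ φ : EuclideanSpace ℝ (Fin N) → ℝ, IsTestFun U φ →
    (∫ x in U, ‖gradient u x‖ ^ (p - 2) * ⟪gradient u x, gradient φ x⟫)
      = ∫ x in U, h x * φ x

/-- The `p`-torsional rigidity of `U`:
`E(U) = (p/(p-1)) ⬝ sup { ∫_U φ - (1/p) ∫_U |∇φ|^p : φ ∈ C_c^∞(U) }`. -/
def pTorsionalRigidity (p : ℝ) {N : ℕ} (U : Set (EuclideanSpace ℝ (Fin N))) : ℝ :=
  (p / (p - 1)) *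
    sSup { r : ℝ | ∃ φ, IsTestFun U φ ∧
      r = (∫ x in U, φ x) - (1 / p) * ∫ x in U, ‖gradient φ x‖ ^ p }

/-- The first Dirichlet eigenvalue of the `p`-Laplacian on `U`:
`λ₁(U) = inf { (∫_U |∇φ|^p)/(∫_U |φ|^p) : φ ∈ C_c^∞(U), φ ≢ 0 }`. -/
def pLambda1 (p : ℝ) {N : ℕ} (U : Set (EuclideanSpace ℝ (Fin N))) : ℝ :=
  sInf { r : ℝ | ∃ φ, IsTestFun U φ ∧ φ ≠ 0 ∧
    r = (∫ x in U, ‖gradient φ x‖ ^ p) / (∫ x in U, |φ x| ^ p) }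

/-- `f` is `C^1` on the closure of `U` (i.e. `C^1` on an open neighbourhood of it). -/
def C1OnClosure {N : ℕ} (U : Set (EuclideanSpace ℝ (Fin N)))
    (f : EuclideanSpace ℝ (Fin N) → ℝ) : Prop :=
  ∃ W, IsOpen W ∧ closure U ⊆ W ∧ ContDiffOn ℝ 1 f W

/-- `Ω` has a smooth boundary: it is the sublevel set of a smooth function whose
differential does not vanish on the boundary. -/
def HasSmoothBoundary {N : ℕ} (Ω : Set (EuclideanSpace ℝ (Fin N))) : Prop :=
  ∃ f : EuclideanSpace ℝ (Fin N) → ℝ, ContDiff ℝ (⊤ : ℕ∞) f ∧ Ω = f ⁻¹' Set.Iio 0 ∧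
    ∀ x ∈ frontier Ω, fderiv ℝ f x ≠ 0

/-- The index of the first coordinate. -/
def firstIdx (N : ℕ) (hN : 2 ≤ N) : Fin N := ⟨0, by omega⟩

/-- The first standard basis vector `e₁`. -/
def e1v {N : ℕ} (hN : 2 ≤ N) : EuclideanSpace ℝ (Fin N) :=
  EuclideanSpace.single (firstIdx N hN) 1

/-- The domain `Ω(s) = B(0,r1) \ closure B(s e₁, r0)`. -/
def annulus {N : ℕ} (hN : 2 ≤ N) (r0 r1 s : ℝ) : Set (EuclideanSpace ℝ (Fin N)) :=
  Metric.ball (0 : EuclideanSpace ℝ (Fin N)) r1 \ closure (Metric.ball (s • e1v hN) r0)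

/-- Reflection across the hyperplane `{x₁ = s}`: `x ↦ (2s - x₁, x₂, …, x_N)`. -/
def reflectH {N : ℕ} (hN : 2 ≤ N) (s : ℝ) (x : EuclideanSpace ℝ (Fin N)) :
    EuclideanSpace ℝ (Fin N) :=
  x + (2 * (s - x (firstIdx N hN))) • e1v hN

/-- The divergence of a vector field, as the trace of its Jacobian. -/
def divergence {N : ℕ} (V : EuclideanSpace ℝ (Fin N) → EuclideanSpace ℝ (Fin N))
    (x : EuclideanSpace ℝ (Fin N)) : ℝ :=
  LinearMap.trace ℝ _ (fderiv ℝ V x : EuclideanSpace ℝ (Fin N) →ₗ[ℝ] EuclideanSpace ℝ (Fin N))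

/-- The classical `p`-Laplacian `Δ_p b = div(|∇b|^{p-2} ∇b)` at a point. -/
def pLapAt (p : ℝ) {N : ℕ} (b : EuclideanSpace ℝ (Fin N) → ℝ)
    (x : EuclideanSpace ℝ (Fin N)) : ℝ :=
  divergence (fun z => ‖gradient b z‖ ^ (p - 2) • gradient b z) x

/-- The torsion function of `U`: `C^1` up to the boundary, vanishing on the boundary,
positive inside, weak solution of `-Δ_p y = 1`. -/
def IsTorsionFn (p : ℝ) {N : ℕ} (U : Set (EuclideanSpace ℝ (Fin N)))
    (y : EuclideanSpace ℝ (Fin N) → ℝ) : Prop :=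
  C1OnClosure U y ∧ (∀ x ∈ frontier U, y x = 0) ∧ (∀ x ∈ U, 0 < y x) ∧
    IsWeakSolution p U y (fun _ => 1)

/-- A first eigenfunction of the Dirichlet `p`-Laplacian on `U`: `C^1` up to the boundary,
positive inside, vanishing on the boundary, `L^p`-normalized, weak solution of
`-Δ_p u = λ₁(U) u^{p-1}`. -/
def IsFirstEigenfun (p : ℝ) {N : ℕ} (U : Set (EuclideanSpace ℝ (Fin N)))
    (y : EuclideanSpace ℝ (Fin N) → ℝ) : Prop :=
  C1OnClosure U y ∧ (∀ x ∈ U, 0 < y x) ∧ (∀ x ∈ frontier U, y x = 0) ∧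
    (∫ x in U, y x ^ p) = 1 ∧
    IsWeakSolution p U y (fun x => pLambda1 p U * y x ^ (p - 1))

/-- The matrix `DA(x) = |x|^{p-2} I + (p-2)|x|^{p-4} x xᵀ`,
the derivative of `A(x) = |x|^{p-2} x`. -/
def DA (p : ℝ) {N : ℕ} (x : EuclideanSpace ℝ (Fin N)) :
    EuclideanSpace ℝ (Fin N) →L[ℝ] EuclideanSpace ℝ (Fin N) :=
  ‖x‖ ^ (p - 2) • ContinuousLinearMap.id ℝ (EuclideanSpace ℝ (Fin N)) +
    ((p - 2) * ‖x‖ ^ (p - 4)) • (innerSL ℝ x).smulRight x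

/-- `w` is a nonnegative bounded weak solution, continuous on the closure of `Ω` and `C^1`
inside, of `-Δ_p w = F(x, w)` in `Ω` with boundary value `bdry` on `∂Ω`. -/
def SolClass (p : ℝ) {N : ℕ} (Ω : Set (EuclideanSpace ℝ (Fin N)))
    (F : EuclideanSpace ℝ (Fin N) → ℝ → ℝ)
    (bdry w : EuclideanSpace ℝ (Fin N) → ℝ) : Prop :=
  ContinuousOn w (closure Ω) ∧ ContDiffOn ℝ 1 w Ω ∧
    (∀ x ∈ closure Ω, 0 ≤ w x) ∧ (∃ M, ∀ x ∈ closure Ω, |w x| ≤ M) ∧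
    IsWeakSolution p Ω w (fun x => F x (w x)) ∧ (∀ x ∈ frontier Ω, w x = bdry x)

section Flux

variable {E : Type*} [NormedAddCommGroup E] [InnerProductSpace ℝ E]

/-- The `p`-Laplace flux `A(ξ) = |ξ|^{p-2} ξ`. -/
def pFlux (p : ℝ) (ξ : E) : E := ‖ξ‖ ^ (p - 2) • ξ

@[simp] lemma pFlux_zero (p : ℝ) : pFlux p (0 : E) = 0 := by simp [pFlux]

lemma norm_pFlux {p : ℝ} (hp : 1 < p) (ξ : E) : ‖pFlux p ξ‖ = ‖ξ‖ ^ (p - 1) := by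
  by_cases h : ξ = 0
  · simp [h, Real.zero_rpow (by linarith : p - 1 ≠ 0)]
  · have h0 : 0 < ‖ξ‖ := norm_pos_iff.2 h
    rw [pFlux, norm_smul, Real.norm_of_nonneg (by positivity), show p - 1 = (p - 2) + 1 by ring,
      Real.rpow_add_one h0.ne']

lemma inner_pFlux_self {p : ℝ} (hp : 1 < p) (ξ : E) : ⟪pFlux p ξ, ξ⟫ = ‖ξ‖ ^ p := by
  by_cases h : ξ = 0
  · simp [h, Real.zero_rpow (by linarith : p ≠ 0)]
  · have h0 : 0 < ‖ξ‖ := norm_pos_iff.2 h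
    rw [pFlux, real_inner_smul_left, real_inner_self_eq_norm_sq, ← Real.rpow_natCast,
      ← Real.rpow_add h0]
    norm_num

lemma continuous_pFlux {p : ℝ} (hp : 1 < p) : Continuous (pFlux p : E → E) := by
  rw [continuous_iff_continuousAt]
  intro ξ
  by_cases h : ξ = 0
  · subst h
    rw [ContinuousAt, pFlux_zero, tendsto_zero_iff_norm_tendsto_zero]
    simp_rw [norm_pFlux hp]
    have : ContinuousAt (fun x : E => ‖x‖ ^ (p - 1)) 0 :=
      continuous_norm.continuousAt.rpow_const (Or.inr (by linarith))
    simpa [ContinuousAt, Real.zero_rpow (by linarith : p - 1 ≠ 0)] using this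
  · have h0 : ‖ξ‖ ≠ 0 := norm_ne_zero_iff.2 h
    exact (continuous_norm.continuousAt.rpow_const (Or.inl h0)).smul continuousAt_id

lemma pFlux_smul {p : ℝ} (c : ℝ) (hc : 0 < c) (ξ : E) :
    pFlux p (c • ξ) = c ^ (p - 1) • pFlux p ξ := by
  rw [pFlux, pFlux, norm_smul, Real.norm_of_nonneg hc.le, Real.mul_rpow hc.le (norm_nonneg _),
    smul_smul, smul_smul, show p - 1 = (p - 2) + 1 by ring, Real.rpow_add_one hc.ne']
  congr 1; ring

lemma inner_pFlux_le {p : ℝ} (hp : 1 < p) (a b : E) :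
    ⟪pFlux p a, b⟫ ≤ ‖a‖ ^ (p - 1) * ‖b‖ := by
  rw [← norm_pFlux hp]; exact real_inner_le_norm _ _

/-- The `p`-Laplace flux is strictly monotone. -/
lemma inner_pFlux_sub_pos {p : ℝ} (hp : 1 < p) {a b : E} (hab : a ≠ b) :
    0 < ⟪pFlux p a - pFlux p b, a - b⟫ := by
  have hexp : ⟪pFlux p a - pFlux p b, a - b⟫ =
      ‖a‖ ^ p + ‖b‖ ^ p - ⟪pFlux p a, b⟫ - ⟪pFlux p b, a⟫ := by
    rw [inner_sub_left, inner_sub_right, inner_sub_right, inner_pFlux_self hp,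
      inner_pFlux_self hp]; ring
  have hsplit : ∀ x : E, ‖x‖ ^ p = ‖x‖ ^ (p - 1) * ‖x‖ := by
    intro x
    by_cases h : x = 0
    · simp [h, Real.zero_rpow (by linarith : p ≠ 0)]
    · rw [← Real.rpow_add_one (norm_ne_zero_iff.2 h)]; norm_num
  by_cases hn : ‖a‖ = ‖b‖
  · have ha0 : 0 < ‖a‖ := by
      rcases (norm_nonneg a).eq_or_lt with h | h
      · exfalso; apply hab
        have hb : ‖b‖ = 0 := by rw [← hn]; exact h.symm
        rw [norm_eq_zero.1 h.symm, norm_eq_zero.1 hb]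
      · exact h
    have e : ⟪pFlux p a - pFlux p b, a - b⟫ = ‖a‖ ^ (p - 2) * ‖a - b‖ ^ 2 := by
      rw [pFlux, pFlux, ← hn, ← smul_sub, real_inner_smul_left, real_inner_self_eq_norm_sq]
    rw [e]
    have := norm_pos_iff.2 (sub_ne_zero.2 hab)
    positivity
  · rw [hexp, hsplit a, hsplit b]
    have h1 := inner_pFlux_le hp a b
    have h2 := inner_pFlux_le hp b a
    have h3 : 0 < (‖a‖ ^ (p - 1) - ‖b‖ ^ (p - 1)) * (‖a‖ - ‖b‖) := by
      rcases lt_or_gt_of_ne hn with h | h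
      · have := Real.rpow_lt_rpow (norm_nonneg a) h (by linarith : 0 < p - 1)
        nlinarith
      · have := Real.rpow_lt_rpow (norm_nonneg b) h (by linarith : 0 < p - 1)
        nlinarith
    nlinarith

lemma inner_pFlux_sub_nonneg {p : ℝ} (hp : 1 < p) (a b : E) :
    0 ≤ ⟪pFlux p a - pFlux p b, a - b⟫ := by
  by_cases h : a = b
  · simp [h]
  · exact (inner_pFlux_sub_pos hp h).le

lemma pFlux_young {p : ℝ} (hp : 1 < p) (a b : E) :
    p * ⟪pFlux p b, a⟫ ≤ ‖a‖ ^ p + (p - 1) * ‖b‖ ^ p := by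
  have h1 := inner_pFlux_le hp b a
  have hq : (p / (p - 1)).HolderConjugate p :=
    (Real.HolderConjugate.conjExponent hp).symm
  have h2 := Real.young_inequality_of_nonneg (Real.rpow_nonneg (norm_nonneg b) (p - 1))
    (norm_nonneg a) hq
  rw [← Real.rpow_mul (norm_nonneg b), mul_div_cancel₀ _ (by linarith : p - 1 ≠ 0)] at h2
  have h3 : p * (‖b‖ ^ p / (p / (p - 1)) + ‖a‖ ^ p / p) = ‖a‖ ^ p + (p - 1) * ‖b‖ ^ p := by
    have : p - 1 ≠ 0 := by linarith
    field_simp; ring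
  nlinarith

/-- Near a nonzero vector the `p`-Laplace flux is Lipschitz and strongly monotone. -/
lemma pFlux_local_bounds {p : ℝ} (hp : 1 < p) {ξ : E} (hξ : ξ ≠ 0) :
    ∃ δ > 0, ∃ c > 0, ∃ C > 0, ∀ a ∈ ball ξ δ, ∀ b ∈ ball ξ δ,
      c * ‖a - b‖ ^ 2 ≤ ⟪pFlux p a - pFlux p b, a - b⟫ ∧
      ‖pFlux p a - pFlux p b‖ ≤ C * ‖a - b‖ := by
  have h0 : 0 < ‖ξ‖ := norm_pos_iff.2 hξ
  have hfun : (pFlux p : E → E) = fun x => (‖x‖ ^ 2) ^ ((p - 2) / 2) • x := by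
    funext x
    rw [pFlux, ← Real.rpow_natCast, ← Real.rpow_mul (norm_nonneg x)]
    congr 2; push_cast; ring
  have hsq : HasStrictFDerivAt (fun x : E => ‖x‖ ^ 2) (2 • innerSL ℝ ξ) ξ :=
    hasStrictFDerivAt_norm_sq ξ
  have hrp := hsq.rpow_const (p := (p - 2) / 2) (Or.inl (by positivity))
  have hd := hrp.smul (hasStrictFDerivAt_id ξ)
  set L := ((‖ξ‖ ^ 2) ^ ((p - 2) / 2) • ContinuousLinearMap.id ℝ E +
    ((((p - 2) / 2) * (‖ξ‖ ^ 2) ^ ((p - 2) / 2 - 1)) • (2 • innerSL ℝ ξ)).smulRight ξ) with hL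
  have hd' : HasStrictFDerivAt (pFlux p : E → E) L ξ := by rw [hfun]; exact hd
  set m := ‖ξ‖ ^ (p - 2) with hm
  have hmpos : 0 < m := by positivity
  set k := min 1 (p - 1) with hk
  have hkpos : 0 < k := lt_min one_pos (by linarith)
  have hLpos : ∀ h : E, k * m * ‖h‖ ^ 2 ≤ ⟪L h, h⟫ := by
    intro h
    have e1 : (‖ξ‖ ^ 2) ^ ((p - 2) / 2) = m := by
      rw [← Real.rpow_natCast, ← Real.rpow_mul h0.le, hm]; congr 1; push_cast; ring
    have e2 : (‖ξ‖ ^ 2) ^ ((p - 2) / 2 - 1) = m / ‖ξ‖ ^ 2 := by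
      rw [Real.rpow_sub_one (by positivity), e1]
    have e3 : ⟪L h, h⟫ = m * (‖h‖ ^ 2 + (p - 2) * (⟪ξ, h⟫ ^ 2 / ‖ξ‖ ^ 2)) := by
      rw [hL, e1, e2]
      simp [inner_add_left, real_inner_smul_left]
      field_simp
    rw [e3]
    have cs : ⟪ξ, h⟫ ^ 2 / ‖ξ‖ ^ 2 ≤ ‖h‖ ^ 2 := by
      rw [div_le_iff₀ (by positivity)]
      have := abs_real_inner_le_norm ξ h
      have := sq_le_sq' (by linarith [neg_abs_le ⟪ξ, h⟫]) ((le_abs_self _).trans this)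
      nlinarith
    have cs0 : 0 ≤ ⟪ξ, h⟫ ^ 2 / ‖ξ‖ ^ 2 := by positivity
    have : k * ‖h‖ ^ 2 ≤ ‖h‖ ^ 2 + (p - 2) * (⟪ξ, h⟫ ^ 2 / ‖ξ‖ ^ 2) := by
      rcases le_total 2 p with h2 | h2
      · have : k ≤ 1 := min_le_left _ _
        nlinarith [sq_nonneg ‖h‖, mul_nonneg (sub_nonneg.2 h2) cs0]
      · have : k ≤ p - 1 := min_le_right _ _
        nlinarith [sq_nonneg ‖h‖]
    nlinarith
  have hb := hd'.isLittleO.def (show (0 : ℝ) < k * m / 2 by positivity)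
  obtain ⟨δ, hδ, hball⟩ := Metric.mem_nhds_iff.1 hb
  rw [← ball_prod_same] at hball
  refine ⟨δ, hδ, k * m / 2, by positivity, ‖L‖ + k * m / 2, by positivity, ?_⟩
  intro a ha b hb'
  have hab : ‖pFlux p a - pFlux p b - L (a - b)‖ ≤ k * m / 2 * ‖a - b‖ :=
    hball (show (a, b) ∈ ball ξ δ ×ˢ ball ξ δ from ⟨ha, hb'⟩)
  set r := pFlux p a - pFlux p b - L (a - b) with hr
  have hdec : pFlux p a - pFlux p b = L (a - b) + r := by rw [hr]; abel
  constructor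
  · rw [hdec, inner_add_left]
    have h1 := hLpos (a - b)
    have h2 : |⟪r, a - b⟫| ≤ ‖r‖ * ‖a - b‖ := abs_real_inner_le_norm _ _
    have h3 := (abs_le.1 h2).1
    nlinarith [norm_nonneg (a - b)]
  · rw [hdec]
    calc ‖L (a - b) + r‖ ≤ ‖L (a - b)‖ + ‖r‖ := norm_add_le _ _
      _ ≤ ‖L‖ * ‖a - b‖ + k * m / 2 * ‖a - b‖ := add_le_add (L.le_opNorm _) hab
      _ = _ := by ring

end Flux

/-- Euclidean space of dimension `N`. -/
abbrev Euc (N : ℕ) := EuclideanSpace ℝ (Fin N)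

section Basic

variable {N : ℕ}

/-- `C^1` test functions compactly supported in `U`. -/
structure IsC1Test (U : Set (Euc N)) (φ : Euc N → ℝ) : Prop where
  contDiff : ContDiff ℝ 1 φ
  hasCompactSupport : HasCompactSupport φ
  tsupport_subset : tsupport φ ⊆ U

lemma IsC1Test.mono {U V : Set (Euc N)} {φ : Euc N → ℝ} (h : IsC1Test U φ) (hUV : U ⊆ V) :
    IsC1Test V φ :=
  ⟨h.contDiff, h.hasCompactSupport, h.tsupport_subset.trans hUV⟩

/-- The field `F` satisfies `-div F = h` weakly in `U`. -/
def WeakDivEq (U : Set (Euc N)) (F : Euc N → Euc N) (h : Euc N → ℝ) : Prop :=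
  ∀ φ, IsC1Test U φ → ∫ x, ⟪F x, gradient φ x⟫ = ∫ x, h x * φ x

/-- The field `F` satisfies `-div F ≥ h` weakly in `U`. -/
def WeakDivGe (U : Set (Euc N)) (F : Euc N → Euc N) (h : Euc N → ℝ) : Prop :=
  ∀ φ, IsC1Test U φ → (∀ x, 0 ≤ φ x) → ∫ x, h x * φ x ≤ ∫ x, ⟪F x, gradient φ x⟫

lemma WeakDivEq.mono {U V : Set (Euc N)} {F : Euc N → Euc N} {h : Euc N → ℝ}
    (H : WeakDivEq V F h) (hUV : U ⊆ V) : WeakDivEq U F h :=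
  fun φ hφ => H φ (hφ.mono hUV)

lemma WeakDivGe.mono {U V : Set (Euc N)} {F : Euc N → Euc N} {h : Euc N → ℝ}
    (H : WeakDivGe V F h) (hUV : U ⊆ V) : WeakDivGe U F h :=
  fun φ hφ => H φ (hφ.mono hUV)

lemma WeakDivEq.ge {U : Set (Euc N)} {F : Euc N → Euc N} {h : Euc N → ℝ}
    (H : WeakDivEq U F h) : WeakDivGe U F h :=
  fun φ hφ _ => (H φ hφ).ge

lemma inner_gradient (f : Euc N → ℝ) (x v : Euc N) : ⟪gradient f x, v⟫ = fderiv ℝ f x v :=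
  inner_gradient_left

lemma gradient_eq_zero_iff {f : Euc N → ℝ} {x : Euc N} :
    gradient f x = 0 ↔ fderiv ℝ f x = 0 := by
  simp [gradient]

lemma gradient_eq_iff {f g : Euc N → ℝ} {x : Euc N} :
    gradient f x = gradient g x ↔ fderiv ℝ f x = fderiv ℝ g x := by
  simp [gradient]

lemma gradient_sub {f g : Euc N → ℝ} {x : Euc N} (hf : DifferentiableAt ℝ f x)
    (hg : DifferentiableAt ℝ g x) :
    gradient (fun y => f y - g y) x = gradient f x - gradient g x := by
  simp [gradient, fderiv_fun_sub hf hg]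

lemma gradient_mul {f g : Euc N → ℝ} {x : Euc N} (hf : DifferentiableAt ℝ f x)
    (hg : DifferentiableAt ℝ g x) :
    gradient (fun y => f y * g y) x = f x • gradient g x + g x • gradient f x := by
  simp [gradient, fderiv_fun_mul hf hg]

lemma gradient_comp {f : Euc N → ℝ} {x : Euc N} {h : ℝ → ℝ} {h' : ℝ}
    (hh : HasDerivAt h h' (f x)) (hf : DifferentiableAt ℝ f x) :
    gradient (fun y => h (f y)) x = h' • gradient f x := by
  have : HasFDerivAt (fun y => h (f y)) (h' • fderiv ℝ f x) x :=
    hh.comp_hasFDerivAt x hf.hasFDerivAt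
  simp [gradient, this.fderiv]

lemma continuousOn_gradient {u : Euc N → ℝ} {U : Set (Euc N)} (hU : IsOpen U)
    (hu : ContDiffOn ℝ 1 u U) : ContinuousOn (gradient u) U :=
  (InnerProductSpace.toDual ℝ (Euc N)).symm.continuous.comp_continuousOn
    (hu.continuousOn_fderiv_of_isOpen hU le_rfl)

lemma continuous_gradient {u : Euc N → ℝ} (hu : ContDiff ℝ 1 u) : Continuous (gradient u) :=
  (InnerProductSpace.toDual ℝ (Euc N)).symm.continuous.comp (hu.continuous_fderiv one_ne_zero)

lemma differentiableAt_of_contDiffOn {u : Euc N → ℝ} {U : Set (Euc N)} (hU : IsOpen U)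
    (hu : ContDiffOn ℝ 1 u U) {x : Euc N} (hx : x ∈ U) : DifferentiableAt ℝ u x :=
  (hu.differentiableOn one_ne_zero x hx).differentiableAt (hU.mem_nhds hx)

/-- A function continuous on an open set and vanishing off a compact subset is integrable. -/
lemma integrable_of_continuousOn {F : Type*} [NormedAddCommGroup F] {f : Euc N → F}
    {U K : Set (Euc N)} (hf : ContinuousOn f U) (hK : IsCompact K)
    (hKU : K ⊆ U) (h0 : ∀ x, x ∉ K → f x = 0) : Integrable f := by
  have h1 : IntegrableOn f K := (hf.mono hKU).integrableOn_compact hK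
  refine (integrable_indicator_iff hK.measurableSet).2 h1 |>.congr ?_
  refine Filter.Eventually.of_forall fun x => ?_
  by_cases hx : x ∈ K
  · simp [hx]
  · simp [hx, h0 x hx]

lemma gradient_eq_zero_of_notMem_tsupport {φ : Euc N → ℝ} {x : Euc N} (hx : x ∉ tsupport φ) :
    gradient φ x = 0 :=
  gradient_eq_zero_iff.2 (image_eq_zero_of_notMem_tsupport
    fun h => hx (tsupport_fderiv_subset ℝ h))

lemma IsC1Test.integrable_inner {U : Set (Euc N)} {φ : Euc N → ℝ} (h : IsC1Test U φ)
    {F : Euc N → Euc N} (hF : ContinuousOn F U) :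
    Integrable fun x => ⟪F x, gradient φ x⟫ :=
  integrable_of_continuousOn (hF.inner (continuous_gradient h.contDiff).continuousOn)
    h.hasCompactSupport h.tsupport_subset
    fun x hx => by rw [gradient_eq_zero_of_notMem_tsupport hx, inner_zero_right]

lemma IsC1Test.integrable_mul {U : Set (Euc N)} {φ : Euc N → ℝ} (h : IsC1Test U φ)
    {f : Euc N → ℝ} (hf : ContinuousOn f U) : Integrable fun x => f x * φ x :=
  integrable_of_continuousOn (hf.mul h.contDiff.continuous.continuousOn)
    h.hasCompactSupport h.tsupport_subset
    fun x hx => by rw [image_eq_zero_of_notMem_tsupport hx, mul_zero]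

/-- Extension by zero of a `C^1` function vanishing off a compact subset of an open set. -/
lemma isC1Test_indicator {U K : Set (Euc N)} (hU : IsOpen U) {g : Euc N → ℝ}
    (hg : ContDiffOn ℝ 1 g U) (hK : IsCompact K) (hKU : K ⊆ U)
    (h0 : ∀ x ∈ U, x ∉ K → g x = 0) : IsC1Test U (U.indicator g) := by
  have hz : ∀ x, x ∉ K → U.indicator g x = 0 := by
    intro x hx
    by_cases hxU : x ∈ U
    · simp [hxU, h0 x hxU hx]
    · simp [hxU]
  have hts : tsupport (U.indicator g) ⊆ K :=
    closure_minimal (fun x hx => by by_contra h; exact hx (hz x h)) hK.isClosed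
  refine ⟨contDiff_iff_contDiffAt.2 fun x => ?_, HasCompactSupport.intro hK hz, hts.trans hKU⟩
  by_cases hxU : x ∈ U
  · refine (hg.contDiffAt (hU.mem_nhds hxU)).congr_of_eventuallyEq ?_
    filter_upwards [hU.mem_nhds hxU] with y hy using indicator_of_mem hy g
  · have hxK : x ∈ Kᶜ := fun h => hxU (hKU h)
    refine (contDiffAt_const (c := (0 : ℝ))).congr_of_eventuallyEq ?_
    filter_upwards [hK.isClosed.isOpen_compl.mem_nhds hxK] with y hy using hz y hy

lemma gradient_indicator {U : Set (Euc N)} (hU : IsOpen U) {g : Euc N → ℝ} {x : Euc N}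
    (hx : x ∈ U) : gradient (U.indicator g) x = gradient g x := by
  refine Filter.EventuallyEq.gradient_eq ?_
  filter_upwards [hU.mem_nhds hx] with y hy using indicator_of_mem hy g

/-- A `C^1` test function is a `C^1` limit of smooth test functions. -/
lemma IsC1Test.exists_approx {U : Set (Euc N)} (hU : IsOpen U) {φ : Euc N → ℝ}
    (h : IsC1Test U φ) :
    ∃ K ⊆ U, IsCompact K ∧ tsupport φ ⊆ K ∧ ∀ ε > 0, ∃ ψ, IsTestFun U ψ ∧ tsupport ψ ⊆ K ∧
      ∀ x, |ψ x - φ x| ≤ ε ∧ ‖gradient ψ x - gradient φ x‖ ≤ ε := by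
  have hKc : IsCompact (tsupport φ) := h.hasCompactSupport
  obtain ⟨δ, hδ, hδU⟩ := hKc.exists_cthickening_subset_open hU h.tsupport_subset
  refine ⟨cthickening δ (tsupport φ), hδU, hKc.cthickening, self_subset_cthickening _, ?_⟩
  intro ε hε
  have huc1 : UniformContinuous φ :=
    h.hasCompactSupport.uniformContinuous_of_continuous h.contDiff.continuous
  have huc2 : UniformContinuous (fderiv ℝ φ) :=
    (h.hasCompactSupport.fderiv ℝ).uniformContinuous_of_continuous
      (h.contDiff.continuous_fderiv one_ne_zero)
  obtain ⟨d1, hd1, H1⟩ := Metric.uniformContinuous_iff.1 huc1 ε hε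
  obtain ⟨d2, hd2, H2⟩ := Metric.uniformContinuous_iff.1 huc2 ε hε
  set r := min δ (min d1 d2) with hr
  have hr0 : 0 < r := lt_min hδ (lt_min hd1 hd2)
  let b : ContDiffBump (0 : Euc N) := ⟨r / 2, r, by positivity, by linarith⟩
  set ψ : Euc N → ℝ := MeasureTheory.convolution (b.normed volume) φ
    (ContinuousLinearMap.lsmul ℝ ℝ) volume
  have hloc : LocallyIntegrable φ := h.contDiff.continuous.locallyIntegrable
  have hψ1 : ContDiff ℝ (⊤ : ℕ∞) ψ :=
    b.hasCompactSupport_normed.contDiff_convolution_left _ b.contDiff_normed hloc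
  have hsupp : Function.support ψ ⊆ cthickening δ (tsupport φ) := by
    refine (support_convolution_subset _).trans ?_
    rintro _ ⟨x, hx, y, hy, rfl⟩
    rw [b.support_normed_eq, mem_ball_zero_iff] at hx
    refine mem_cthickening_of_dist_le _ y _ _ (subset_tsupport _ hy) ?_
    have : r ≤ δ := min_le_left _ _
    have hx' : ‖x‖ < r := hx
    simpa using (hx'.le.trans this)
  have hts : tsupport ψ ⊆ cthickening δ (tsupport φ) :=
    closure_minimal hsupp isClosed_cthickening
  have hcs : HasCompactSupport ψ :=
    hKc.cthickening.of_isClosed_subset (isClosed_tsupport _) hts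
  refine ⟨ψ, ⟨hψ1, hcs, hts.trans hδU⟩, hts, fun x => ⟨?_, ?_⟩⟩
  · rw [← Real.dist_eq]
    refine b.dist_normed_convolution_le h.contDiff.continuous.aestronglyMeasurable fun y hy => ?_
    refine (H1 ?_).le
    exact lt_of_lt_of_le hy ((min_le_right _ _).trans (min_le_left _ _))
  · have hloc' : LocallyIntegrable (b.normed volume) (volume : Measure (Euc N)) :=
      (b.continuous_normed).locallyIntegrable
    have hd := h.hasCompactSupport.hasFDerivAt_convolution_right
      (ContinuousLinearMap.lsmul ℝ ℝ) hloc' h.contDiff x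
    have hL : (ContinuousLinearMap.lsmul ℝ ℝ : ℝ →L[ℝ] ℝ →L[ℝ] ℝ).precompR (Euc N) =
        ContinuousLinearMap.lsmul ℝ ℝ := by
      ext; simp [ContinuousLinearMap.precompR_apply]
    have hgr : ‖gradient ψ x - gradient φ x‖ = ‖fderiv ℝ ψ x - fderiv ℝ φ x‖ := by
      simp only [gradient, ← map_sub, LinearIsometryEquiv.norm_map]
    rw [hgr, hd.fderiv, hL, ← dist_eq_norm]
    refine b.dist_normed_convolution_le
      (h.contDiff.continuous_fderiv one_ne_zero).aestronglyMeasurable fun y hy => (H2 ?_).le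
    exact lt_of_lt_of_le hy ((min_le_right _ _).trans (min_le_right _ _))

/-- Weak solutions may be tested with `C^1` functions. -/
lemma IsWeakSolution.weakDivEq {p : ℝ} (hp : 1 < p) {U : Set (Euc N)} (hU : IsOpen U)
    {u h : Euc N → ℝ} (hu : ContDiffOn ℝ 1 u U) (hh : ContinuousOn h U)
    (H : IsWeakSolution p U u h) : WeakDivEq U (fun x => pFlux p (gradient u x)) h := by
  intro φ hφ
  set F : Euc N → Euc N := fun x => pFlux p (gradient u x) with hF
  have hFc : ContinuousOn F U := (continuous_pFlux hp).comp_continuousOn (continuousOn_gradient hU hu)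
  obtain ⟨K, hKU, hKc, hφK, happ⟩ := hφ.exists_approx hU
  have hFi : IntegrableOn (fun x => ‖F x‖) K := (hFc.mono hKU).norm.integrableOn_compact hKc
  have hhi : IntegrableOn (fun x => ‖h x‖) K := (hh.mono hKU).norm.integrableOn_compact hKc
  set CF := ∫ x in K, ‖F x‖
  set Ch := ∫ x in K, ‖h x‖
  have hCF : 0 ≤ CF := integral_nonneg fun _ => norm_nonneg _
  have hCh : 0 ≤ Ch := integral_nonneg fun _ => norm_nonneg _
  suffices hs : ∀ ε > 0, |(∫ x, ⟪F x, gradient φ x⟫) - ∫ x, h x * φ x| ≤ ε * (CF + Ch) by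
    by_contra hne
    have hpos : 0 < |(∫ x, ⟪F x, gradient φ x⟫) - ∫ x, h x * φ x| :=
      abs_pos.2 (sub_ne_zero.2 hne)
    have := hs (|(∫ x, ⟪F x, gradient φ x⟫) - ∫ x, h x * φ x| / (2 * (CF + Ch + 1)))
      (by positivity)
    rw [div_mul_eq_mul_div, le_div_iff₀ (by positivity)] at this
    nlinarith
  intro ε hε
  obtain ⟨ψ, hψ, hψK, hψa⟩ := happ ε hε
  have hψ' : IsC1Test U ψ := ⟨hψ.1.of_le (by exact_mod_cast le_top), hψ.2.1, hψ.2.2⟩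
  have e1 : (∫ x, ⟪F x, gradient ψ x⟫) = ∫ x, h x * ψ x := by
    have := H ψ hψ
    rw [setIntegral_eq_integral_of_forall_compl_eq_zero,
      setIntegral_eq_integral_of_forall_compl_eq_zero] at this
    · rw [← this]
      refine integral_congr_ae (Filter.Eventually.of_forall fun x => ?_)
      simp [F, pFlux]
    · intro x hx
      rw [image_eq_zero_of_notMem_tsupport (fun hh => hx (hψ.2.2 hh)), mul_zero]
    · intro x hx
      rw [gradient_eq_zero_of_notMem_tsupport (fun hh => hx (hψ.2.2 hh)), inner_zero_right,
        mul_zero]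
  have d1 : |(∫ x, ⟪F x, gradient φ x⟫) - ∫ x, ⟪F x, gradient ψ x⟫| ≤ ε * CF := by
    rw [← integral_sub (hφ.integrable_inner hFc) (hψ'.integrable_inner hFc),
      ← Real.norm_eq_abs, ← integral_const_mul, ← integral_indicator hKc.measurableSet]
    refine norm_integral_le_of_norm_le
      ((integrable_indicator_iff hKc.measurableSet).2 (hFi.const_mul ε)) ?_
    refine Filter.Eventually.of_forall fun x => ?_
    by_cases hx : x ∈ K
    · rw [indicator_of_mem hx, ← inner_sub_right]
      refine (norm_inner_le_norm _ _).trans ?_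
      rw [mul_comm, norm_sub_rev]
      exact mul_le_mul_of_nonneg_right (hψa x).2 (norm_nonneg _)
    · rw [indicator_of_notMem hx, gradient_eq_zero_of_notMem_tsupport (fun h => hx (hφK h)),
        gradient_eq_zero_of_notMem_tsupport (fun h => hx (hψK h))]
      simp
  have d2 : |(∫ x, h x * φ x) - ∫ x, h x * ψ x| ≤ ε * Ch := by
    rw [← integral_sub (hφ.integrable_mul hh) (hψ'.integrable_mul hh),
      ← Real.norm_eq_abs, ← integral_const_mul, ← integral_indicator hKc.measurableSet]
    refine norm_integral_le_of_norm_le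
      ((integrable_indicator_iff hKc.measurableSet).2 (hhi.const_mul ε)) ?_
    refine Filter.Eventually.of_forall fun x => ?_
    by_cases hx : x ∈ K
    · rw [indicator_of_mem hx, ← mul_sub, norm_mul, mul_comm, norm_sub_rev]
      exact mul_le_mul_of_nonneg_right (hψa x).1 (norm_nonneg _)
    · rw [indicator_of_notMem hx, image_eq_zero_of_notMem_tsupport (fun h => hx (hφK h)),
        image_eq_zero_of_notMem_tsupport (fun h => hx (hψK h))]
      simp
  rw [e1] at d1
  rw [abs_sub_comm] at d2
  have := abs_add_le ((∫ x, ⟪F x, gradient φ x⟫) - ∫ x, h x * ψ x)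
    ((∫ x, h x * ψ x) - ∫ x, h x * φ x)
  rw [sub_add_sub_cancel] at this
  linarith

end Basic

section Comparison

variable {N : ℕ}

lemma hasDerivAt_posPart_sq (t : ℝ) :
    HasDerivAt (fun t : ℝ => max t 0 ^ 2) (2 * max t 0) t := by
  rcases lt_trichotomy t 0 with h | h | h
  · rw [max_eq_right h.le, mul_zero]
    refine (hasDerivAt_const t (0 : ℝ)).congr_of_eventuallyEq ?_
    filter_upwards [Iio_mem_nhds h] with y hy
    rw [max_eq_right (le_of_lt hy)]; norm_num
  · subst h
    rw [hasDerivAt_iff_isLittleO]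
    simp only [max_self, ne_eq, OfNat.ofNat_ne_zero, not_false_eq_true, zero_pow, sub_zero,
      mul_zero, smul_zero]
    refine Asymptotics.IsBigO.trans_isLittleO (g := fun x : ℝ => x ^ 2) ?_ ?_
    · refine Asymptotics.IsBigO.of_bound 1 (Filter.Eventually.of_forall fun x => ?_)
      rw [one_mul, norm_pow, norm_pow]
      refine pow_le_pow_left₀ (norm_nonneg _) ?_ 2
      rw [Real.norm_eq_abs, Real.norm_eq_abs, abs_of_nonneg (le_max_right _ _)]
      exact max_le (le_abs_self x) (abs_nonneg x)
    · simpa using Asymptotics.isLittleO_pow_id (𝕜 := ℝ) (n := 2) (by norm_num)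
  · rw [max_eq_left h.le]
    refine ((hasDerivAt_pow 2 t).congr_of_eventuallyEq ?_).congr_deriv (by norm_num)
    filter_upwards [Ioi_mem_nhds h] with y hy
    rw [max_eq_left (le_of_lt hy)]

lemma contDiff_posPart_sq : ContDiff ℝ 1 fun t : ℝ => max t 0 ^ 2 := by
  refine contDiff_one_iff_deriv.2 ⟨fun t => (hasDerivAt_posPart_sq t).differentiableAt, ?_⟩
  rw [show deriv (fun t : ℝ => max t 0 ^ 2) = fun t => 2 * max t 0 from
    funext fun t => (hasDerivAt_posPart_sq t).deriv]
  fun_prop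

/-- A function continuous on an open set and vanishing off a compact subset is continuous. -/
lemma continuous_of_continuousOn {F : Type*} [NormedAddCommGroup F] {f : Euc N → F}
    {U K : Set (Euc N)} (hU : IsOpen U) (hf : ContinuousOn f U) (hK : IsCompact K)
    (hKU : K ⊆ U) (h0 : ∀ x, x ∉ K → f x = 0) : Continuous f := by
  refine continuous_iff_continuousAt.2 fun x => ?_
  by_cases hxU : x ∈ U
  · exact hf.continuousAt (hU.mem_nhds hxU)
  · have hxK : x ∈ Kᶜ := fun h => hxU (hKU h)
    refine (continuousAt_const (y := (0 : F))).congr ?_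
    filter_upwards [hK.isClosed.isOpen_compl.mem_nhds hxK] with y hy using (h0 y hy).symm

lemma eq_zero_of_integral_nonpos {f : Euc N → ℝ}
    {U K : Set (Euc N)} (hU : IsOpen U) (hf : ContinuousOn f U) (hK : IsCompact K)
    (hKU : K ⊆ U) (h0 : ∀ x, x ∉ K → f x = 0) (hnn : ∀ x, 0 ≤ f x) (hint : ∫ x, f x ≤ 0)
    (x : Euc N) : f x = 0 := by
  by_contra hne
  have := (continuous_of_continuousOn hU hf hK hKU h0).integral_pos_of_hasCompactSupport_nonneg_nonzero
    (μ := volume) (HasCompactSupport.intro hK h0) hnn hne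
  linarith

/-- Superlevel sets at positive height of a function that is nonpositive on the frontier. -/
lemma superlevel_compact {G : Set (Euc N)} (hGo : IsOpen G) (hGb : Bornology.IsBounded G)
    {f : Euc N → ℝ} (hf : ContinuousOn f (closure G)) (hfr : ∀ x ∈ frontier G, f x ≤ 0)
    {η : ℝ} (hη : 0 < η) :
    IsCompact {x ∈ closure G | η ≤ f x} ∧ {x ∈ closure G | η ≤ f x} ⊆ G := by
  constructor
  · have hc : IsCompact (closure G) := hGb.isCompact_closure
    refine hc.of_isClosed_subset ?_ (sep_subset _ _)
    exact hf.preimage_isClosed_of_isClosed isClosed_closure isClosed_Ici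
  · rintro x ⟨hx, hxf⟩
    by_contra hxG
    have : x ∈ frontier G := by rw [hGo.frontier_eq]; exact ⟨hx, hxG⟩
    linarith [hfr x this]

/-- Weak comparison principle for the `p`-Laplacian. -/
lemma comparison {p : ℝ} (hp : 1 < p) {G : Set (Euc N)} (hGo : IsOpen G)
    (hGb : Bornology.IsBounded G) (hGu : ∃ z, z ∉ G) {b q : Euc N → ℝ}
    (hb : ContDiffOn ℝ 1 b G) (hq : ContDiffOn ℝ 1 q G) (hbc : ContinuousOn b (closure G))
    (hqc : ContinuousOn q (closure G))
    (H : ∀ φ, IsC1Test G φ → (∀ x, 0 ≤ φ x) →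
      ∫ x, ⟪pFlux p (gradient b x), gradient φ x⟫ ≤ ∫ x, ⟪pFlux p (gradient q x), gradient φ x⟫)
    (hbd : ∀ x ∈ frontier G, b x ≤ q x) {x : Euc N} (hx : x ∈ G) : b x ≤ q x := by
  by_contra! hlt
  set η := (b x - q x) / 2 with hη
  have hη0 : 0 < η := by rw [hη]; linarith
  set f : Euc N → ℝ := fun y => b y - q y with hf
  obtain ⟨hK, hKG⟩ := superlevel_compact hGo hGb (hbc.sub hqc)
    (fun y hy => sub_nonpos.2 (hbd y hy)) hη0
  set K := {y ∈ closure G | η ≤ b y - q y} with hKdef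
  set g : Euc N → ℝ := fun y => max (b y - q y - η) 0 ^ 2 with hg
  have hgC : ContDiffOn ℝ 1 g G :=
    contDiff_posPart_sq.comp_contDiffOn ((hb.sub hq).sub contDiffOn_const)
  have hg0 : ∀ y ∈ G, y ∉ K → g y = 0 := by
    intro y hy hyK
    have : ¬ η ≤ b y - q y := fun h => hyK ⟨subset_closure hy, h⟩
    rw [hg]; simp only; rw [max_eq_right (by linarith)]; norm_num
  have hT := isC1Test_indicator hGo hgC hK hKG hg0
  set φ := G.indicator g with hφ
  have hφnn : ∀ y, 0 ≤ φ y := fun y => indicator_nonneg (fun _ _ => sq_nonneg _) y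
  have hcb : ContinuousOn (fun y => pFlux p (gradient b y)) G :=
    (continuous_pFlux hp).comp_continuousOn (continuousOn_gradient hGo hb)
  have hcq : ContinuousOn (fun y => pFlux p (gradient q y)) G :=
    (continuous_pFlux hp).comp_continuousOn (continuousOn_gradient hGo hq)
  have hgrad : ∀ y ∈ G, gradient φ y =
      (2 * max (b y - q y - η) 0) • (gradient b y - gradient q y) := by
    intro y hy
    have db := differentiableAt_of_contDiffOn hGo hb hy
    have dq := differentiableAt_of_contDiffOn hGo hq hy
    rw [hφ, gradient_indicator hGo hy, hg,
      gradient_comp (f := fun y => b y - q y - η) (hasDerivAt_posPart_sq _)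
        ((db.sub dq).sub_const η)]
    rw [← gradient_sub db dq]
    congr 1
    exact gradient_eq_iff.2 (fderiv_sub_const (f := fun y => b y - q y) η)
  have hφK : tsupport φ ⊆ K := by
    refine closure_minimal (fun y hy => ?_) hK.isClosed
    by_contra h
    by_cases hyG : y ∈ G
    · exact hy (by rw [hφ, indicator_of_mem hyG, hg0 y hyG h])
    · exact hy (by rw [hφ, indicator_of_notMem hyG])
  have hgrad0 : ∀ y, y ∉ K → gradient φ y = 0 := fun y hy =>
    gradient_eq_zero_of_notMem_tsupport fun h => hy (hφK h)
  have hint : ∫ y, ⟪pFlux p (gradient b y) - pFlux p (gradient q y), gradient φ y⟫ ≤ 0 := by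
    simp_rw [inner_sub_left]
    rw [integral_sub (hT.integrable_inner hcb) (hT.integrable_inner hcq)]
    linarith [H φ hT hφnn]
  have hzero := eq_zero_of_integral_nonpos hGo
    ((hcb.sub hcq).inner (continuous_gradient hT.contDiff).continuousOn) hK hKG
    (fun y hy => by simp only [Pi.sub_apply]; rw [hgrad0 y hy, inner_zero_right])
    (fun y => by
      by_cases hy : y ∈ G
      · simp only [Pi.sub_apply]
        rw [hgrad y hy, inner_smul_right]
        exact mul_nonneg (by positivity) (inner_pFlux_sub_nonneg hp _ _)
      · simp only [Pi.sub_apply]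
        rw [hgrad0 y fun h => hy (hKG h), inner_zero_right]) hint
  have hgz : ∀ y, gradient φ y = 0 := by
    intro y
    by_cases hy : y ∈ G
    · have h1 := hzero y
      simp only [Pi.sub_apply] at h1
      rw [hgrad y hy, inner_smul_right] at h1
      rw [hgrad y hy]
      rcases mul_eq_zero.1 h1 with h | h
      · rw [h, zero_smul]
      · by_cases he : gradient b y = gradient q y
        · rw [he, sub_self, smul_zero]
        · exact absurd h (inner_pFlux_sub_pos hp he).ne'
    · exact hgrad0 y fun h => hy (hKG h)
  obtain ⟨z, hz⟩ := hGu
  have hconst := is_const_of_fderiv_eq_zero (hT.contDiff.differentiable one_ne_zero)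
    (fun y => gradient_eq_zero_iff.1 (hgz y)) x z
  rw [hφ, indicator_of_notMem hz, indicator_of_mem hx, hg] at hconst
  simp only at hconst
  rw [max_eq_left (by linarith), sq_eq_zero_iff] at hconst
  linarith

/-- Integration by parts against the position field. -/
lemma integral_inner_sub_gradient {ψ : Euc N → ℝ} (hψ : ContDiff ℝ 1 ψ)
    (hc : HasCompactSupport ψ) (a : Euc N) :
    ∫ x, ⟪x - a, gradient ψ x⟫ = -(N * ∫ x, ψ x) := by
  have hcd : Continuous (fderiv ℝ ψ) := hψ.continuous_fderiv one_ne_zero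
  have hfc : HasCompactSupport (fderiv ℝ ψ) := hc.fderiv ℝ
  have hcomp : ∀ i : Fin N, ∫ x : Euc N, (x i - a i) * fderiv ℝ ψ x (EuclideanSpace.single i 1) =
      -∫ x, ψ x := by
    intro i
    have hd : ∀ x : Euc N, HasFDerivAt (fun x : Euc N => x i - a i)
        (EuclideanSpace.proj i : Euc N →L[ℝ] ℝ) x := fun x =>
      ((EuclideanSpace.proj i : Euc N →L[ℝ] ℝ).hasFDerivAt).sub_const _
    have h1 : ∀ x : Euc N, fderiv ℝ (fun x : Euc N => x i - a i) x
        (EuclideanSpace.single i 1) = 1 := by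
      intro x; rw [(hd x).fderiv]; simp
    have hci : Continuous fun x : Euc N => x i - a i := by fun_prop
    have := integral_mul_fderiv_eq_neg_fderiv_mul_of_integrable (μ := (volume : Measure (Euc N)))
      (f := fun x : Euc N => x i - a i) (g := ψ) (v := EuclideanSpace.single i 1) ?_ ?_ ?_
      (fun x _ => (hd x).differentiableAt) (fun x _ => hψ.differentiable one_ne_zero x)
    · simpa [h1] using this
    · simp only [h1, one_mul]
      exact hψ.continuous.integrable_of_hasCompactSupport hc
    · refine (hci.mul (hcd.clm_apply continuous_const)).integrable_of_hasCompactSupport ?_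
      refine HasCompactSupport.intro hfc fun x hx => ?_
      simp [image_eq_zero_of_notMem_tsupport hx]
    · exact (hci.mul hψ.continuous).integrable_of_hasCompactSupport hc.mul_left
  have hsum : ∀ x : Euc N, ⟪x - a, gradient ψ x⟫ =
      ∑ i, (x i - a i) * fderiv ℝ ψ x (EuclideanSpace.single i 1) := by
    intro x
    rw [real_inner_comm, inner_gradient]
    have : x - a = ∑ i, (x i - a i) • EuclideanSpace.single i (1 : ℝ) := by
      ext j
      simp [Finset.sum_apply, Pi.single_apply]
    conv_lhs => rw [this]
    simp [map_sum]
  simp_rw [hsum]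
  rw [integral_finsetSum]
  · simp [hcomp]
  · intro i _
    refine ((by fun_prop : Continuous fun x : Euc N => x i - a i).mul
      (hcd.clm_apply continuous_const)).integrable_of_hasCompactSupport ?_
    refine HasCompactSupport.intro hfc fun x hx => ?_
    simp [image_eq_zero_of_notMem_tsupport hx]

lemma hasFDerivAt_norm_sub_rpow {a x : Euc N} (hx : x ≠ a) (e : ℝ) :
    HasFDerivAt (fun y : Euc N => ‖y - a‖ ^ e)
      ((e * ‖x - a‖ ^ (e - 2)) • innerSL ℝ (x - a)) x := by
  have h0 : 0 < ‖x - a‖ := norm_pos_iff.2 (sub_ne_zero.2 hx)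
  have h1 : HasFDerivAt (fun y : Euc N => ‖y - a‖ ^ 2) (2 • innerSL ℝ (x - a)) x := by
    have := ((hasStrictFDerivAt_norm_sq (x - a)).hasFDerivAt).comp x ((hasFDerivAt_id x).sub_const a)
    rwa [ContinuousLinearMap.comp_id] at this
  have h2 := h1.rpow_const (p := e / 2) (Or.inl (by positivity))
  have e0 : ∀ (y : Euc N) (f : ℝ), (‖y - a‖ ^ 2) ^ (f / 2) = ‖y - a‖ ^ f := by
    intro y f
    rw [← Real.rpow_natCast, ← Real.rpow_mul (norm_nonneg _)]
    congr 1; push_cast; ring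
  rw [show (fun y : Euc N => ‖y - a‖ ^ e) = fun y => (‖y - a‖ ^ 2) ^ (e / 2) from
    funext fun y => (e0 y e).symm]
  refine h2.congr_fderiv ?_
  rw [show e / 2 - 1 = (e - 2) / 2 by ring, e0]
  ext v
  simp
  ring

lemma contDiffOn_norm_sub_rpow (a : Euc N) (e : ℝ) :
    ContDiffOn ℝ 1 (fun y : Euc N => ‖y - a‖ ^ e) {a}ᶜ := by
  intro x hx
  refine ContDiffAt.contDiffWithinAt ?_
  have h0 : ‖x - a‖ ≠ 0 := norm_ne_zero_iff.2 (sub_ne_zero.2 hx)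
  exact ((contDiffAt_id.sub contDiffAt_const).norm ℝ (sub_ne_zero.2 hx)).rpow_const_of_ne h0

lemma gradient_of_hasFDerivAt {f : Euc N → ℝ} {x v : Euc N}
    (h : HasFDerivAt f (innerSL ℝ v) x) : gradient f x = v :=
  (hasGradientAt_iff_hasFDerivAt.2 h).gradient

lemma gradient_norm_sub_rpow {a x : Euc N} (hx : x ≠ a) (e : ℝ) :
    gradient (fun y : Euc N => ‖y - a‖ ^ e) x = (e * ‖x - a‖ ^ (e - 2)) • (x - a) :=
  gradient_of_hasFDerivAt (by simpa using hasFDerivAt_norm_sub_rpow hx e)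

/-- A linear lower bound along a segment bounds the directional derivative from below. -/
lemma le_inner_gradient {q : Euc N → ℝ} {z v : Euc N} (hq : DifferentiableAt ℝ q z) {κ δ : ℝ}
    (hδ : 0 < δ) (h : ∀ t, 0 < t → t < δ → q z + κ * t ≤ q (z + t • v)) :
    κ ≤ ⟪gradient q z, v⟫ := by
  have hl : HasDerivAt (fun t : ℝ => z + t • v) v 0 := by
    simpa using ((hasDerivAt_id (0 : ℝ)).smul_const v).const_add z
  have hq' : HasFDerivAt q (fderiv ℝ q z) ((fun t : ℝ => z + t • v) 0) := by
    simpa using hq.hasFDerivAt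
  have hd := hq'.comp_hasDerivAt (0 : ℝ) hl
  rw [inner_gradient]
  have ht := hd.tendsto_slope_zero_right
  refine ge_of_tendsto ht ?_
  filter_upwards [Ioo_mem_nhdsGT hδ] with t ht
  have := h t ht.1 ht.2
  simp only [Function.comp, zero_add, zero_smul, add_zero, smul_eq_mul]
  rw [inv_mul_eq_div, le_div_iff₀ ht.1]
  linarith

end Comparison

section Hopf

variable {N : ℕ}

lemma pFlux_neg {p : ℝ} (ξ : Euc N) : pFlux p (-ξ) = -pFlux p ξ := by
  simp [pFlux]

/-- Flux of a radial gradient with negative slope. -/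
lemma pFlux_neg_smul_rpow {p : ℝ} {c : ℝ} (hc : 0 < c) (e : ℝ) {ξ : Euc N} (hξ : ξ ≠ 0) :
    pFlux p ((-(c * ‖ξ‖ ^ e)) • ξ) = (-(c ^ (p - 1) * ‖ξ‖ ^ (e * (p - 1) + (p - 2)))) • ξ := by
  have h0 : 0 < ‖ξ‖ := norm_pos_iff.2 hξ
  rw [neg_smul, pFlux_neg, pFlux_smul _ (by positivity), pFlux, smul_smul, neg_smul,
    Real.mul_rpow hc.le (by positivity), ← Real.rpow_mul h0.le, mul_assoc, ← Real.rpow_add h0]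

/-- The field `-|x-a|^{-(N+p)} (x-a)` is a strict weak subsolution field away from `a`. -/
lemma integral_radial_field {p : ℝ} {G : Set (Euc N)} {a : Euc N} (ha : a ∉ G)
    (hG : IsOpen G) {φ : Euc N → ℝ} (hφ : IsC1Test G φ) :
    ∫ x, ⟪‖x - a‖ ^ (-(N + p)) • (x - a), gradient φ x⟫ =
      p * ∫ x, ‖x - a‖ ^ (-(N + p)) * φ x := by
  set h : Euc N → ℝ := fun x => ‖x - a‖ ^ (-(N + p)) with hh
  have hGa : G ⊆ {a}ᶜ := fun x hx hxa => ha (by rw [mem_singleton_iff] at hxa; rwa [← hxa])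
  have hhC : ContDiffOn ℝ 1 h G := (contDiffOn_norm_sub_rpow a _).mono hGa
  have hψ := isC1Test_indicator hG (hhC.mul hφ.contDiff.contDiffOn) hφ.hasCompactSupport
    hφ.tsupport_subset (fun x _ hx => by
      rw [image_eq_zero_of_notMem_tsupport hx, mul_zero])
  have hψeq : (G.indicator fun x => h x * φ x) = fun x => h x * φ x := by
    funext x
    by_cases hx : x ∈ G
    · rw [indicator_of_mem hx]
    · rw [indicator_of_notMem hx, image_eq_zero_of_notMem_tsupport
        fun hh => hx (hφ.tsupport_subset hh), mul_zero]
  rw [hψeq] at hψ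
  have hibp := integral_inner_sub_gradient hψ.contDiff hψ.hasCompactSupport a
  have hpt : ∀ x, ⟪x - a, gradient (fun y => h y * φ y) x⟫ =
      ⟪h x • (x - a), gradient φ x⟫ - (N + p) * (h x * φ x) := by
    intro x
    by_cases hx : x ∈ G
    · have hxa : x ≠ a := hGa hx
      have h0 : 0 < ‖x - a‖ := norm_pos_iff.2 (sub_ne_zero.2 hxa)
      rw [gradient_mul (differentiableAt_of_contDiffOn hG hhC hx)
        (hφ.contDiff.differentiable one_ne_zero x), hh, gradient_norm_sub_rpow hxa]
      rw [inner_add_right, inner_smul_right, inner_smul_right, inner_smul_right,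
        real_inner_self_eq_norm_sq, real_inner_smul_left]
      have : ‖x - a‖ ^ (-(N + p) - 2) * ‖x - a‖ ^ 2 = ‖x - a‖ ^ (-(N + p)) := by
        rw [← Real.rpow_natCast, ← Real.rpow_add h0]; congr 1; push_cast; ring
      linear_combination (-(φ x * (N + p))) * this
    · have hx' : x ∉ tsupport φ := fun h => hx (hφ.tsupport_subset h)
      have hx'' : x ∉ tsupport fun y => h y * φ y := fun h => hx (hψ.tsupport_subset h)
      rw [gradient_eq_zero_of_notMem_tsupport hx', gradient_eq_zero_of_notMem_tsupport hx'',
        image_eq_zero_of_notMem_tsupport hx']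
      simp
  have hcx : ContinuousOn (fun x => h x • (x - a)) G :=
    hhC.continuousOn.smul (by fun_prop)
  simp_rw [hpt] at hibp
  rw [integral_sub (hφ.integrable_inner hcx)
    ((hφ.integrable_mul hhC.continuousOn).const_mul _), integral_const_mul] at hibp
  linear_combination hibp

lemma frontier_shell_subset (a : Euc N) {r R : ℝ} :
    frontier (ball a R \ closedBall a r) ⊆
      (sphere a R \ ball a r) ∪ (sphere a r ∩ closedBall a R) := by
  intro x hx
  have ho : IsOpen (ball a R \ closedBall a r) := isOpen_ball.sdiff isClosed_closedBall
  rw [ho.frontier_eq] at hx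
  obtain ⟨hxc, hxn⟩ := hx
  have h1 : x ∈ closedBall a R :=
    (closure_mono sdiff_subset).trans closure_ball_subset_closedBall hxc
  have h2 : x ∈ (ball a r)ᶜ := by
    refine closure_minimal ?_ isOpen_ball.isClosed_compl hxc
    exact fun y hy hyr => hy.2 (ball_subset_closedBall hyr)
  rw [mem_closedBall] at h1
  rw [mem_compl_iff, mem_ball, not_lt] at h2
  by_cases h3 : dist x a < R
  · right
    refine ⟨?_, mem_closedBall.2 h1⟩
    by_contra hne
    have : r < dist x a := lt_of_le_of_ne h2 (fun h => hne (mem_sphere.2 h.symm))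
    exact hxn ⟨h3, fun h => absurd (mem_closedBall.1 h) (not_le.2 this)⟩
  · left
    exact ⟨mem_sphere.2 (le_antisymm h1 (not_lt.1 h3)), fun h => absurd (mem_ball.1 h) (not_lt.2 h2)⟩

lemma one_add_mul_le_rpow_neg {k t : ℝ} (hk : 0 < k) (ht : t < 1) :
    1 + k * t ≤ (1 - t) ^ (-k) := by
  have h0 : 0 < 1 - t := by linarith
  rw [Real.rpow_def_of_pos h0]
  have h1 := Real.log_le_sub_one_of_pos h0
  have h2 := Real.add_one_le_exp (Real.log (1 - t) * -k)
  nlinarith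

/-- Hopf boundary point lemma for positive weak supersolutions of the `p`-Laplacian. -/
lemma hopf {p : ℝ} (hp : 1 < p) (hN : 0 < N) {a z : Euc N} {R : ℝ} (hR : 0 < R)
    (hz : ‖z - a‖ = R) {W : Set (Euc N)} (hW : IsOpen W) (hWs : closedBall a R ⊆ W)
    {q : Euc N → ℝ} (hq : ContDiffOn ℝ 1 q W) (hpos : ∀ x ∈ ball a R, 0 < q x)
    (hnn : ∀ x ∈ closedBall a R, 0 ≤ q x) (hqz : q z = 0)
    (H : WeakDivGe (ball a R) (fun x => pFlux p (gradient q x)) (fun _ => 0)) :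
    0 < ⟪gradient q z, a - z⟫ := by
  have hp1 : 0 < p - 1 := by linarith
  have hNr : (0 : ℝ) < N := by exact_mod_cast hN
  set k : ℝ := N / (p - 1) with hk
  have hk0 : 0 < k := by positivity
  -- positive minimum on the inner sphere
  have hsub : closedBall a (R / 2) ⊆ ball a R := closedBall_subset_ball (by linarith)
  obtain ⟨m, hm0, hm⟩ : ∃ m > 0, ∀ x ∈ closedBall a (R / 2), m ≤ q x := by
    obtain ⟨x0, hx0, hmin⟩ := (isCompact_closedBall a (R / 2)).exists_isMinOn
      ⟨a, mem_closedBall_self (by linarith)⟩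
      ((hq.continuousOn).mono (hsub.trans (ball_subset_closedBall.trans hWs)))
    exact ⟨q x0, hpos x0 (hsub hx0), fun x hx => hmin hx⟩
  have hD : 0 < (R / 2) ^ (-k) - R ^ (-k) :=
    sub_pos.2 (Real.rpow_lt_rpow_of_neg (by linarith) (by linarith) (by linarith))
  set c := m / ((R / 2) ^ (-k) - R ^ (-k)) with hc
  have hc0 : 0 < c := by positivity
  set b : Euc N → ℝ := fun x => c * (‖x - a‖ ^ (-k) - R ^ (-k)) with hb
  set G := ball a R \ closedBall a (R / 2) with hG
  have hGo : IsOpen G := isOpen_ball.sdiff isClosed_closedBall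
  have haG : a ∉ G := fun h => h.2 (mem_closedBall_self (by linarith))
  have hGcl : closure G ⊆ closedBall a R \ ball a (R / 2) := by
    refine closure_minimal ?_ (isClosed_closedBall.sdiff isOpen_ball)
    exact sdiff_subset_sdiff ball_subset_closedBall ball_subset_closedBall
  have hne : closedBall a R \ ball a (R / 2) ⊆ {a}ᶜ := by
    intro x hx hxa
    rw [mem_singleton_iff] at hxa
    exact hx.2 (by rw [hxa]; exact mem_ball_self (by linarith))
  have hbC : ContDiffOn ℝ 1 b {a}ᶜ :=
    contDiffOn_const.mul ((contDiffOn_norm_sub_rpow a _).sub contDiffOn_const)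
  have hGa : G ⊆ {a}ᶜ := subset_closure.trans (hGcl.trans hne)
  have hgb : ∀ x ∈ G, pFlux p (gradient b x) =
      (-(c * k) ^ (p - 1)) • (‖x - a‖ ^ (-(N + p)) • (x - a)) := by
    intro x hx
    have hxa : x ≠ a := hGa hx
    have hgr : gradient b x = (-(c * k * ‖x - a‖ ^ (-k - 2))) • (x - a) := by
      refine gradient_of_hasFDerivAt ?_
      refine (((hasFDerivAt_norm_sub_rpow hxa (-k)).sub_const _).const_mul c).congr_fderiv ?_
      ext v; simp; ring
    rw [hgr, pFlux_neg_smul_rpow (by positivity) _ (sub_ne_zero.2 hxa), smul_smul, neg_mul]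
    congr 4
    rw [hk]; field_simp; ring
  have hcp : ∀ x ∈ G, b x ≤ q x := fun x hx => by
    refine comparison hp hGo (isBounded_ball.subset sdiff_subset) ⟨a, haG⟩
      (hbC.mono hGa) (hq.mono (sdiff_subset.trans (ball_subset_closedBall.trans hWs)))
      ((hbC.continuousOn).mono (hGcl.trans hne))
      (hq.continuousOn.mono (hGcl.trans (sdiff_subset.trans hWs))) ?_ ?_ hx
    · intro φ hφ hφ0
      have h1 : ∫ x, ⟪pFlux p (gradient b x), gradient φ x⟫ ≤ 0 := by
        have : ∀ x, ⟪pFlux p (gradient b x), gradient φ x⟫ =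
            (-(c * k) ^ (p - 1)) * ⟪‖x - a‖ ^ (-(N + p)) • (x - a), gradient φ x⟫ := by
          intro x
          by_cases hx : x ∈ G
          · rw [hgb x hx, real_inner_smul_left]
          · rw [gradient_eq_zero_of_notMem_tsupport fun h => hx (hφ.tsupport_subset h)]; simp
        simp_rw [this]
        rw [integral_const_mul, integral_radial_field haG hGo hφ]
        have h2 : 0 ≤ ∫ x, ‖x - a‖ ^ (-(N + p)) * φ x :=
          integral_nonneg fun x => mul_nonneg (by positivity) (hφ0 x)
        have h3 : 0 ≤ (c * k) ^ (p - 1) := by positivity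
        have h4 := mul_nonneg h3 (mul_nonneg (by linarith : (0 : ℝ) ≤ p) h2)
        linarith
      have h2 := H φ (hφ.mono sdiff_subset) hφ0
      simp only [zero_mul, integral_zero] at h2
      linarith
    · intro x hx
      rcases frontier_shell_subset a hx with h | h
      · have hxR : ‖x - a‖ = R := by rw [← dist_eq_norm]; exact h.1
        simp only [hb, hxR, sub_self, mul_zero]
        exact hnn x (sphere_subset_closedBall h.1)
      · have hxR : ‖x - a‖ = R / 2 := by rw [← dist_eq_norm]; exact h.1
        simp only [hb, hxR]
        rw [hc, div_mul_cancel₀ _ hD.ne']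
        exact hm x (sphere_subset_closedBall h.1)
  have hzW : z ∈ W := hWs (by rw [mem_closedBall, dist_eq_norm, hz])
  have hfin := le_inner_gradient (differentiableAt_of_contDiffOn hW hq hzW)
    (v := a - z) (κ := c * R ^ (-k) * k) (δ := 1 / 2) (by norm_num) ?_
  · exact lt_of_lt_of_le (by positivity) hfin
  · intro t ht0 ht1
    have hn : ‖z + t • (a - z) - a‖ = (1 - t) * R := by
      rw [show z + t • (a - z) - a = (1 - t) • (z - a) by module, norm_smul, hz,
        Real.norm_of_nonneg (by linarith)]
    have hxG : z + t • (a - z) ∈ G := by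
      refine ⟨?_, ?_⟩
      · rw [mem_ball, dist_eq_norm, hn]; nlinarith
      · rw [mem_closedBall, dist_eq_norm, hn]; nlinarith
    refine le_trans ?_ (hcp _ hxG)
    simp only [hb, hn, hqz]
    rw [Real.mul_rpow (by linarith) hR.le]
    have h1 := one_add_mul_le_rpow_neg hk0 (show t < 1 by linarith)
    have h2 : 0 < R ^ (-k) := by positivity
    have h3 := mul_le_mul_of_nonneg_left h1 (mul_pos hc0 h2).le
    linarith

/-- Hopf-type boundary point lemma for strict weak supersolutions at a touching minimum. -/
lemma hopf_strict {p : ℝ} (hp : 1 < p) (hN : 0 < N) {a z : Euc N} {R κ M : ℝ} (hR : 0 < R)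
    (hκ : 0 < κ) (hz : ‖z - a‖ = R) {W : Set (Euc N)} (hW : IsOpen W)
    (hWs : closedBall a R ⊆ W) {q : Euc N → ℝ} (hq : ContDiffOn ℝ 1 q W)
    (hM : ∀ x ∈ closedBall a R, M ≤ q x) (hqz : q z = M)
    (H : WeakDivGe (ball a R) (fun x => pFlux p (gradient q x)) (fun _ => κ)) :
    0 < ⟪gradient q z, a - z⟫ := by
  have hp1 : 0 < p - 1 := by linarith
  have hNr : (0 : ℝ) < N := by exact_mod_cast hN
  set k : ℝ := p / (p - 1) with hk
  have hk1 : 1 < k := by rw [hk, lt_div_iff₀ hp1]; linarith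
  set C : ℝ := κ / N with hC
  have hC0 : 0 < C := by positivity
  set c : ℝ := C ^ (p - 1)⁻¹ / k with hc
  have hc0 : 0 < c := by positivity
  have hck : (c * k) ^ (p - 1) = C := by
    rw [hc, div_mul_cancel₀ _ (by linarith), Real.rpow_inv_rpow hC0.le hp1.ne']
  set b : Euc N → ℝ := fun x => M + c * (R ^ k - ‖x - a‖ ^ k) with hb
  have hbC : ContDiff ℝ 1 b := by
    have : ContDiff ℝ 1 fun x : Euc N => ‖x - a‖ ^ k :=
      (contDiff_norm_rpow hk1).comp (contDiff_id.sub contDiff_const)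
    exact contDiff_const.add (contDiff_const.mul (contDiff_const.sub this))
  have hgb : ∀ x, pFlux p (gradient b x) = (-C) • (x - a) := by
    intro x
    by_cases hxa : x = a
    · have h1 : HasFDerivAt (fun x : Euc N => ‖x - a‖ ^ k) (0 : Euc N →L[ℝ] ℝ) x := by
        have := (hasFDerivAt_norm_rpow (x - a) hk1).comp x ((hasFDerivAt_id x).sub_const a)
        refine this.congr_fderiv ?_
        rw [hxa]; simp
      have h2 : HasFDerivAt b (innerSL ℝ (0 : Euc N)) x := by
        refine (((h1.const_sub (R ^ k)).const_mul c).const_add M).congr_fderiv ?_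
        simp
      rw [gradient_of_hasFDerivAt h2, hxa]; simp
    · have hgr : gradient b x = (-(c * k * ‖x - a‖ ^ (k - 2))) • (x - a) := by
        refine gradient_of_hasFDerivAt ?_
        refine ((((hasFDerivAt_norm_sub_rpow hxa k).const_sub (R ^ k)).const_mul c).const_add
          M).congr_fderiv ?_
        ext v; simp; ring
      rw [hgr, pFlux_neg_smul_rpow (by positivity) _ (sub_ne_zero.2 hxa), hck,
        show (k - 2) * (p - 1) + (p - 2) = 0 by rw [hk]; field_simp; ring, Real.rpow_zero, mul_one]
  obtain ⟨w, hw⟩ : ∃ w : Euc N, w ∉ ball a R := by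
    refine ⟨z, fun h => ?_⟩
    rw [mem_ball, dist_eq_norm, hz] at h
    exact lt_irrefl _ h
  have hcl : closure (ball a R) ⊆ closedBall a R := closure_ball_subset_closedBall
  have hcp : ∀ x ∈ ball a R, b x ≤ q x := fun x hx => by
    refine comparison hp isOpen_ball isBounded_ball ⟨w, hw⟩ hbC.contDiffOn
      (hq.mono (ball_subset_closedBall.trans hWs)) hbC.continuous.continuousOn
      (hq.continuousOn.mono (hcl.trans hWs)) ?_ ?_ hx
    · intro φ hφ hφ0
      refine le_trans (le_of_eq ?_) (H φ hφ hφ0)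
      simp_rw [hgb, real_inner_smul_left]
      rw [integral_const_mul, integral_inner_sub_gradient hφ.contDiff hφ.hasCompactSupport,
        integral_const_mul, hC]
      field_simp
    · intro x hx
      have hxR : ‖x - a‖ = R := by
        rw [← dist_eq_norm]; exact frontier_ball_subset_sphere hx
      simp only [hb, hxR, sub_self, mul_zero, add_zero]
      exact hM x (by rw [mem_closedBall, dist_eq_norm, hxR])
  have hzW : z ∈ W := hWs (by rw [mem_closedBall, dist_eq_norm, hz])
  have hfin := le_inner_gradient (differentiableAt_of_contDiffOn hW hq hzW)
    (v := a - z) (κ := c * R ^ k) (δ := 1 / 2) (by norm_num) ?_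
  · exact lt_of_lt_of_le (by positivity) hfin
  · intro t ht0 ht1
    have hn : ‖z + t • (a - z) - a‖ = (1 - t) * R := by
      rw [show z + t • (a - z) - a = (1 - t) • (z - a) by module, norm_smul, hz,
        Real.norm_of_nonneg (by linarith)]
    have hxG : z + t • (a - z) ∈ ball a R := by
      rw [mem_ball, dist_eq_norm, hn]; nlinarith
    refine le_trans ?_ (hcp _ hxG)
    simp only [hb, hn, hqz]
    rw [Real.mul_rpow (by linarith) hR.le]
    have h1 : (1 - t) ^ k ≤ 1 - t := by
      conv_rhs => rw [← Real.rpow_one (1 - t)]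
      exact Real.rpow_le_rpow_of_exponent_ge (by linarith) (by linarith) hk1.le
    have h2 : 0 < R ^ k := by positivity
    have h3 := mul_le_mul_of_nonneg_left h1 (mul_pos hc0 h2).le
    linarith

end Hopf

section Picone

variable {N : ℕ}

/-- A `C^1` regularization of the positive part, linear beyond `ε`. -/
def smoothPos (ε t : ℝ) : ℝ := (max t 0 ^ 2 - max (t - ε) 0 ^ 2) / (2 * ε)

/-- The derivative of `smoothPos`. -/
def smoothPosDeriv (ε t : ℝ) : ℝ := (max t 0 - max (t - ε) 0) / ε

lemma hasDerivAt_smoothPos {ε : ℝ} (hε : 0 < ε) (t : ℝ) :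
    HasDerivAt (smoothPos ε) (smoothPosDeriv ε t) t := by
  have h1 := hasDerivAt_posPart_sq t
  have h2 := (hasDerivAt_posPart_sq (t - ε)).comp t ((hasDerivAt_id t).sub_const ε)
  refine ((h1.sub h2).div_const (2 * ε)).congr_deriv ?_
  rw [smoothPosDeriv]
  field_simp

lemma contDiff_smoothPos (ε : ℝ) : ContDiff ℝ 1 (smoothPos ε) :=
  (contDiff_posPart_sq.sub (contDiff_posPart_sq.comp (contDiff_id.sub contDiff_const))).div_const _

lemma smoothPos_of_nonpos {ε t : ℝ} (hε : 0 < ε) (ht : t ≤ 0) : smoothPos ε t = 0 := by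
  rw [smoothPos, max_eq_right ht, max_eq_right (by linarith)]; simp

lemma smoothPosDeriv_of_nonpos {ε t : ℝ} (hε : 0 < ε) (ht : t ≤ 0) : smoothPosDeriv ε t = 0 := by
  rw [smoothPosDeriv, max_eq_right ht, max_eq_right (by linarith)]; simp

lemma smoothPosDeriv_of_ge {ε t : ℝ} (hε : 0 < ε) (ht : ε ≤ t) : smoothPosDeriv ε t = 1 := by
  rw [smoothPosDeriv, max_eq_left (by linarith), max_eq_left (by linarith)]; field_simp; ring

lemma smoothPosDeriv_nonneg {ε : ℝ} (hε : 0 < ε) (t : ℝ) : 0 ≤ smoothPosDeriv ε t := by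
  rw [smoothPosDeriv]
  refine div_nonneg (sub_nonneg.2 (max_le_max ?_ le_rfl)) hε.le
  linarith

lemma smoothPos_bounds {ε t : ℝ} (hε : 0 < ε) (ht : 0 ≤ t) :
    smoothPos ε t ≤ t ∧ 0 ≤ smoothPosDeriv ε t * t - smoothPos ε t ∧
      smoothPosDeriv ε t * t - smoothPos ε t ≤ ε := by
  rw [smoothPos, smoothPosDeriv, max_eq_left ht]
  rcases le_total t ε with h | h
  · rw [max_eq_right (by linarith)]
    refine ⟨?_, ?_, ?_⟩
    · rw [div_le_iff₀ (by positivity)]; nlinarith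
    · have : (t - 0) / ε * t - (t ^ 2 - 0 ^ 2) / (2 * ε) = t ^ 2 / (2 * ε) := by field_simp; ring
      rw [this]; positivity
    · have : (t - 0) / ε * t - (t ^ 2 - 0 ^ 2) / (2 * ε) = t ^ 2 / (2 * ε) := by field_simp; ring
      rw [this, div_le_iff₀ (by positivity)]; nlinarith
  · rw [max_eq_left (by linarith)]
    have e1 : (t ^ 2 - (t - ε) ^ 2) / (2 * ε) = t - ε / 2 := by field_simp; ring
    have e2 : (t - (t - ε)) / ε = 1 := by field_simp; ring
    rw [e1, e2]
    refine ⟨?_, ?_, ?_⟩ <;> linarith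

/-- Testing the flux of `f` against `h(T) f^{1-p}`. -/
lemma inner_pFlux_gradient_mul_rpow {p : ℝ} (hp : 1 < p) {f T : Euc N → ℝ} {x : Euc N}
    (hf0 : 0 < f x) (hf : DifferentiableAt ℝ f x) (hT : DifferentiableAt ℝ T x)
    {h : ℝ → ℝ} {h' : ℝ} (hh : HasDerivAt h h' (T x)) :
    ⟪pFlux p (gradient f x), gradient (fun y => h (T y) * f y ^ (1 - p)) x⟫ =
      h' * ⟪pFlux p ((f x)⁻¹ • gradient f x), gradient T x⟫ -
        (p - 1) * h (T x) * ‖(f x)⁻¹ • gradient f x‖ ^ p := by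
  set α := (f x)⁻¹ • gradient f x with hα
  have hfα : gradient f x = f x • α := by rw [hα, smul_inv_smul₀ hf0.ne']
  have d1 : HasDerivAt (fun s : ℝ => s ^ (1 - p)) ((1 - p) * f x ^ (1 - p - 1)) (f x) :=
    Real.hasDerivAt_rpow_const (Or.inl hf0.ne')
  have hdT : DifferentiableAt ℝ (fun y => h (T y)) x :=
    hh.differentiableAt.comp x hT
  have hdf : DifferentiableAt ℝ (fun y => f y ^ (1 - p)) x :=
    d1.differentiableAt.comp x hf
  rw [gradient_mul hdT hdf, gradient_comp d1 hf, gradient_comp hh hT, inner_add_right,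
    inner_smul_right, inner_smul_right, inner_smul_right, inner_smul_right]
  rw [hfα, pFlux_smul _ hf0, real_inner_smul_left, real_inner_smul_left, inner_smul_right,
    inner_pFlux_self hp]
  have e1 : f x ^ (1 - p) * f x ^ (p - 1) = 1 := by
    rw [← Real.rpow_add hf0]; norm_num
  have e2 : f x ^ (1 - p - 1) * (f x ^ (p - 1) * f x) = 1 := by
    rw [← Real.rpow_add_one hf0.ne', ← Real.rpow_add hf0]; norm_num
  linear_combination (h' * ⟪pFlux p α, gradient T x⟫) * e1 +
    ((1 - p) * h (T x) * ‖α‖ ^ p) * e2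

/-- The algebraic heart of the Picone-type comparison. -/
lemma picone_algebra {p : ℝ} (hp : 1 < p) {U W : ℝ} (hUW : W ≤ U) (α β : Euc N) :
    p * W * ⟪pFlux p α - pFlux p β, α - β⟫ ≤
      p * ⟪pFlux p α - pFlux p β, U • α - W • β⟫ -
        (U - W) * ((p - 1) * (‖α‖ ^ p - ‖β‖ ^ p)) := by
  have hy := pFlux_young hp α β
  have h := mul_nonneg (sub_nonneg.2 hUW) (sub_nonneg.2 hy)
  simp only [inner_sub_left, inner_sub_right, inner_smul_right, inner_pFlux_self hp]
  nlinarith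

/-- Dominated convergence for the defect of the shifted comparison function. -/
lemma tendsto_integral_one_sub_rpow {p : ℝ} (hp : 1 < p) {G : Set (Euc N)} (hGo : IsOpen G)
    (hGb : Bornology.IsBounded G) {v : Euc N → ℝ} (hv : ContinuousOn v G)
    (vpos : ∀ x ∈ G, 0 < v x) :
    Filter.Tendsto (fun η : ℝ => ∫ x in G, (1 - (v x / (v x + η)) ^ (p - 1)))
      (nhdsWithin 0 (Ioi 0)) (nhds 0) := by
  have hp1 : 0 < p - 1 := by linarith
  have hfin : volume G < ⊤ := hGb.measure_lt_top
  suffices key : Filter.Tendsto (fun η : ℝ => ∫ x in G, (1 - (v x / (v x + η)) ^ (p - 1)))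
      (nhdsWithin 0 (Ioi 0)) (nhds (∫ _ in G, (0 : ℝ))) by simpa using key
  refine tendsto_integral_filter_of_dominated_convergence (fun _ => 1) ?_ ?_ ?_ ?_
  · filter_upwards [self_mem_nhdsWithin] with η (hη : 0 < η)
    refine ContinuousOn.aestronglyMeasurable ?_ hGo.measurableSet
    refine continuousOn_const.sub (ContinuousOn.rpow_const ?_ fun x _ => Or.inr hp1.le)
    exact hv.div (hv.add continuousOn_const) fun x hx => by linarith [vpos x hx]
  · filter_upwards [self_mem_nhdsWithin] with η (hη : 0 < η)
    refine (ae_restrict_iff' hGo.measurableSet).2 (Filter.Eventually.of_forall fun x hx => ?_)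
    have h0 := vpos x hx
    have h1 : v x / (v x + η) ≤ 1 := (div_le_one (by linarith)).2 (by linarith)
    have h2 := Real.rpow_le_one (by positivity : 0 ≤ v x / (v x + η)) h1 hp1.le
    have h3 : 0 ≤ (v x / (v x + η)) ^ (p - 1) := by positivity
    rw [Real.norm_eq_abs, abs_le]; constructor <;> linarith
  · exact integrableOn_const hfin.ne
  · refine (ae_restrict_iff' hGo.measurableSet).2 (Filter.Eventually.of_forall fun x hx => ?_)
    have h0 := vpos x hx
    have : ContinuousAt (fun η : ℝ => 1 - (v x / (v x + η)) ^ (p - 1)) 0 := by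
      refine continuousAt_const.sub (ContinuousAt.rpow_const ?_ (Or.inr hp1.le))
      exact continuousAt_const.div (continuousAt_const.add continuousAt_id) (by simp; exact h0.ne')
    have h2 := this.tendsto
    simp only [add_zero, div_self h0.ne', Real.one_rpow, sub_self] at h2
    exact h2.mono_left nhdsWithin_le_nhds

/-- The two-solution Picone test: a quantitative lower bound for the defect integral. -/
lemma picone_integral {p : ℝ} (hp : 1 < p) {G : Set (Euc N)} (hGo : IsOpen G)
    (hGb : Bornology.IsBounded G) {u v : Euc N → ℝ} (hu : ContDiffOn ℝ 1 u G)
    (hv : ContDiffOn ℝ 1 v G) (huc : ContinuousOn u (closure G)) (hvc : ContinuousOn v (closure G))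
    (upos : ∀ x ∈ G, 0 < u x) (vpos : ∀ x ∈ G, 0 < v x) (hbd : ∀ x ∈ frontier G, u x ≤ v x)
    {lam : ℝ} (hlam : 0 ≤ lam)
    (Hu : WeakDivEq G (fun x => pFlux p (gradient u x)) (fun x => lam * u x ^ (p - 1)))
    (Hv : WeakDivEq G (fun x => pFlux p (gradient v x)) (fun x => lam * v x ^ (p - 1)))
    {M : ℝ} (hM : ∀ x ∈ G, u x ≤ M) {η : ℝ} (hη : 0 < η) {B : Set (Euc N)}
    (hB : MeasurableSet B) (hBG : B ⊆ G) {d τ : ℝ} (hτ : 0 < τ)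
    (hBT : ∀ x ∈ B, τ ≤ u x ^ p - (v x + η) ^ p)
    (hBd : ∀ x ∈ B, d ≤ p * (v x + η) ^ p *
      ⟪pFlux p ((u x)⁻¹ • gradient u x) - pFlux p ((v x + η)⁻¹ • gradient v x),
        (u x)⁻¹ • gradient u x - (v x + η)⁻¹ • gradient v x⟫) :
    d * volume.real B ≤ lam * M ^ p * ∫ x in G, (1 - (v x / (v x + η)) ^ (p - 1)) := by
  have hp1 : 0 < p - 1 := by linarith
  have hp0 : 0 < p := by linarith
  set V : Euc N → ℝ := fun x => v x + η with hV
  have Vpos : ∀ x ∈ G, 0 < V x := fun x hx => by have := vpos x hx; simp only [hV]; linarith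
  have hVC : ContDiffOn ℝ 1 V G := hv.add contDiffOn_const
  have hgV : ∀ x, gradient V x = gradient v x := fun x =>
    gradient_eq_iff.2 (fderiv_add_const (f := v) η)
  set T : Euc N → ℝ := fun x => u x ^ p - V x ^ p with hT
  have hTC : ContDiffOn ℝ 1 T G :=
    (hu.rpow_const_of_ne fun x hx => (upos x hx).ne').sub
      (hVC.rpow_const_of_ne fun x hx => (Vpos x hx).ne')
  obtain ⟨hKc, hKG⟩ := superlevel_compact hGo hGb (huc.sub hvc)
    (fun y hy => sub_nonpos.2 (hbd y hy)) hη
  set K := {x ∈ closure G | η ≤ (u - v) x} with hK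
  have hKT : ∀ x ∈ G, x ∉ K → T x ≤ 0 := by
    intro x hx hxK
    have h1 : ¬ η ≤ u x - v x := fun h => hxK ⟨subset_closure hx, h⟩
    have h2 : u x ≤ V x := by simp only [hV]; linarith
    have := Real.rpow_le_rpow (upos x hx).le h2 hp0.le
    simp only [hT]; linarith
  set α : Euc N → Euc N := fun x => (u x)⁻¹ • gradient u x with hα
  set β : Euc N → Euc N := fun x => (V x)⁻¹ • gradient v x with hβ
  have hgu := continuousOn_gradient hGo hu
  have hgv := continuousOn_gradient hGo hv
  have hαc : ContinuousOn α G :=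
    (hu.continuousOn.inv₀ fun x hx => (upos x hx).ne').smul hgu
  have hβc : ContinuousOn β G :=
    (hVC.continuousOn.inv₀ fun x hx => (Vpos x hx).ne').smul hgv
  set Y : Euc N → ℝ := fun x => (p - 1) * (‖α x‖ ^ p - ‖β x‖ ^ p) with hY
  have hYc : ContinuousOn Y G := continuousOn_const.mul
    ((hαc.norm.rpow_const fun x _ => Or.inr hp0.le).sub
      (hβc.norm.rpow_const fun x _ => Or.inr hp0.le))
  obtain ⟨C, hC⟩ := hKc.exists_bound_of_continuousOn (hYc.mono hKG)
  have hC' : ∀ x ∈ K, |Y x| ≤ |C| := fun x hx => (hC x hx).trans (le_abs_self C)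
  refine le_of_forall_pos_le_add fun δ hδ => ?_
  set ε := min τ (δ / (|C| * volume.real K + 1)) with hε
  have hε0 : 0 < ε := lt_min hτ (by positivity)
  have hετ : ε ≤ τ := min_le_left _ _
  have hεδ : ε * |C| * volume.real K ≤ δ := by
    have h1 : ε ≤ δ / (|C| * volume.real K + 1) := min_le_right _ _
    rw [le_div_iff₀ (by positivity)] at h1
    nlinarith
  -- test functions
  set ψ : Euc N → ℝ := fun x => smoothPos ε (T x) with hψ
  have hψC : ContDiffOn ℝ 1 ψ G := (contDiff_smoothPos ε).comp_contDiffOn hTC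
  have hψ0 : ∀ x ∈ G, x ∉ K → ψ x = 0 := fun x hx hxK =>
    smoothPos_of_nonpos hε0 (hKT x hx hxK)
  set g1 : Euc N → ℝ := fun x => smoothPos ε (T x) * u x ^ (1 - p) with hg1
  set g2 : Euc N → ℝ := fun x => smoothPos ε (T x) * V x ^ (1 - p) with hg2
  have hφ1 := isC1Test_indicator hGo
    (hψC.mul (hu.rpow_const_of_ne (p := 1 - p) fun x hx => (upos x hx).ne')) hKc hKG
    (fun x hx hxK => by rw [hψ0 x hx hxK, zero_mul])
  have hφ2 := isC1Test_indicator hGo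
    (hψC.mul (hVC.rpow_const_of_ne (p := 1 - p) fun x hx => (Vpos x hx).ne')) hKc hKG
    (fun x hx hxK => by rw [hψ0 x hx hxK, zero_mul])
  change IsC1Test G (G.indicator g1) at hφ1
  change IsC1Test G (G.indicator g2) at hφ2
  have hFu : ContinuousOn (fun y => pFlux p (gradient u y)) G :=
    (continuous_pFlux hp).comp_continuousOn hgu
  have hFv : ContinuousOn (fun y => pFlux p (gradient v y)) G :=
    (continuous_pFlux hp).comp_continuousOn hgv
  have e1 := Hu _ hφ1
  have e2 := Hv _ hφ2
  set I : Euc N → ℝ := fun x => ⟪pFlux p (gradient u x), gradient (G.indicator g1) x⟫ -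
    ⟪pFlux p (gradient v x), gradient (G.indicator g2) x⟫ with hI
  have hIint : Integrable I := (hφ1.integrable_inner hFu).sub (hφ2.integrable_inner hFv)
  have hIeq : ∫ x, I x = ∫ x, (lam * u x ^ (p - 1) * G.indicator g1 x -
      lam * v x ^ (p - 1) * G.indicator g2 x) := by
    rw [integral_sub (hφ1.integrable_inner hFu) (hφ2.integrable_inner hFv), e1, e2,
      integral_sub]
    · exact hφ1.integrable_mul (continuousOn_const.mul
        (hu.continuousOn.rpow_const fun x _ => Or.inr hp1.le))
    · exact hφ2.integrable_mul (continuousOn_const.mul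
        (hv.continuousOn.rpow_const fun x _ => Or.inr hp1.le))
  -- pointwise form of the integrand
  have hIG : ∀ x ∈ G, I x = smoothPosDeriv ε (T x) *
      (p * ⟪pFlux p (α x) - pFlux p (β x), (u x ^ p) • α x - (V x ^ p) • β x⟫) - ψ x * Y x := by
    intro x hx
    have du := differentiableAt_of_contDiffOn hGo hu hx
    have dV := differentiableAt_of_contDiffOn hGo hVC hx
    have dT := differentiableAt_of_contDiffOn hGo hTC hx
    have hu0 := upos x hx
    have hV0 := Vpos x hx
    have hgT : gradient T x = p • ((u x ^ p) • α x - (V x ^ p) • β x) := by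
      have a1 : HasDerivAt (fun s : ℝ => s ^ p) (p * u x ^ (p - 1)) (u x) :=
        Real.hasDerivAt_rpow_const (Or.inl hu0.ne')
      have a2 : HasDerivAt (fun s : ℝ => s ^ p) (p * V x ^ (p - 1)) (V x) :=
        Real.hasDerivAt_rpow_const (Or.inl hV0.ne')
      have c1 : DifferentiableAt ℝ (fun y => u y ^ p) x := a1.differentiableAt.comp x du
      have c2 : DifferentiableAt ℝ (fun y => V y ^ p) x := a2.differentiableAt.comp x dV
      rw [hT, gradient_sub c1 c2]
      have b1 : gradient (fun y => u y ^ p) x = (p * u x ^ (p - 1)) • gradient u x :=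
        gradient_comp a1 du
      have b2 : gradient (fun y => V y ^ p) x = (p * V x ^ (p - 1)) • gradient V x :=
        gradient_comp a2 dV
      rw [b1, b2, hgV, smul_sub]
      simp only [hα, hβ, smul_smul]
      rw [Real.rpow_sub_one hu0.ne', Real.rpow_sub_one hV0.ne']
      congr 2
    have i1 := inner_pFlux_gradient_mul_rpow hp hu0 du dT (hasDerivAt_smoothPos hε0 (T x))
    have i2 := inner_pFlux_gradient_mul_rpow hp hV0 dV dT (hasDerivAt_smoothPos hε0 (T x))
    simp only [hI]
    rw [gradient_indicator hGo hx, gradient_indicator hGo hx, hg1, hg2, i1]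
    rw [hgV] at i2
    rw [i2, hgT]
    simp only [inner_smul_right, inner_sub_left, hY, hψ, hα, hβ]
    ring
  have hI0 : ∀ x, x ∉ K → I x = 0 := by
    intro x hxK
    by_cases hx : x ∈ G
    · rw [hIG x hx, hψ0 x hx hxK, smoothPosDeriv_of_nonpos hε0 (hKT x hx hxK)]; ring
    · simp only [hI]
      rw [gradient_eq_zero_of_notMem_tsupport fun h => hx (hφ1.tsupport_subset h),
        gradient_eq_zero_of_notMem_tsupport fun h => hx (hφ2.tsupport_subset h)]
      simp
  have hIlow : ∀ x ∈ G, 0 ≤ T x → smoothPosDeriv ε (T x) * (p * V x ^ p *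
      ⟪pFlux p (α x) - pFlux p (β x), α x - β x⟫) - ε * |Y x| ≤ I x := by
    intro x hx hTx
    rw [hIG x hx]
    have a1 := picone_algebra hp (sub_nonneg.1 hTx) (α x) (β x)
    obtain ⟨-, b1, b2⟩ := smoothPos_bounds hε0 hTx
    have b0 := smoothPosDeriv_nonneg hε0 (T x)
    have a2 := mul_le_mul_of_nonneg_left a1 b0
    have a3 : -(ε * |Y x|) ≤ (smoothPosDeriv ε (T x) * T x - ψ x) * Y x := by
      have c1 := neg_abs_le (Y x)
      have c2 : (smoothPosDeriv ε (T x) * T x - ψ x) * -|Y x| ≤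
        (smoothPosDeriv ε (T x) * T x - ψ x) * Y x := mul_le_mul_of_nonneg_left c1 b1
      have c3 := mul_le_mul_of_nonneg_right b2 (abs_nonneg (Y x))
      linarith
    have a4 : (u x ^ p - V x ^ p) * ((p - 1) * (‖α x‖ ^ p - ‖β x‖ ^ p)) = T x * Y x := rfl
    rw [a4] at a2
    linarith
  have hmono : ∀ x ∈ G, 0 ≤ p * V x ^ p * ⟪pFlux p (α x) - pFlux p (β x), α x - β x⟫ :=
    fun x hx => mul_nonneg (mul_nonneg hp0.le (Real.rpow_nonneg (Vpos x hx).le _))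
      (inner_pFlux_sub_nonneg hp _ _)
  have hTK : ∀ x ∈ G, 0 < T x → x ∈ K := fun x hx hTx => by
    by_contra h; linarith [hKT x hx h]
  have hBfin : volume B < ⊤ := (hGb.subset hBG).measure_lt_top
  have hLint : Integrable fun x => B.indicator (fun _ => d) x -
      K.indicator (fun _ => ε * |C|) x :=
    ((integrable_indicator_iff hB).2 (integrableOn_const hBfin.ne)).sub
      ((integrable_indicator_iff hKc.measurableSet).2 (integrableOn_const hKc.measure_lt_top.ne))
  have hlow : d * volume.real B - ε * |C| * volume.real K ≤ ∫ x, I x := by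
    have : ∫ x, (B.indicator (fun _ => d) x - K.indicator (fun _ => ε * |C|) x) =
        d * volume.real B - ε * |C| * volume.real K := by
      rw [integral_sub ((integrable_indicator_iff hB).2 (integrableOn_const hBfin.ne))
        ((integrable_indicator_iff hKc.measurableSet).2
          (integrableOn_const hKc.measure_lt_top.ne)), integral_indicator hB,
        integral_indicator hKc.measurableSet, setIntegral_const, setIntegral_const]
      simp [mul_comm]
    rw [← this]
    refine integral_mono hLint hIint fun x => ?_
    simp only
    by_cases hxB : x ∈ B
    · have hxG := hBG hxB
      have hTx := hBT x hxB
      have hxK := hTK x hxG (hτ.trans_le hTx)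
      have h1 := hIlow x hxG (hτ.le.trans hTx)
      rw [smoothPosDeriv_of_ge hε0 (hετ.trans hTx), one_mul] at h1
      rw [indicator_of_mem hxB, indicator_of_mem hxK]
      have h2 := mul_le_mul_of_nonneg_left (hC' x hxK) hε0.le
      have h3 := hBd x hxB
      linarith
    · rw [indicator_of_notMem hxB]
      by_cases hxK : x ∈ K
      · have hxG := hKG hxK
        rw [indicator_of_mem hxK]
        by_cases hTx : 0 ≤ T x
        · have h1 := hIlow x hxG hTx
          have h2 := mul_le_mul_of_nonneg_left (hC' x hxK) hε0.le
          have h3 := mul_nonneg (smoothPosDeriv_nonneg hε0 (T x)) (hmono x hxG)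
          linarith
        · have hTx' : T x ≤ 0 := (not_le.1 hTx).le
          have hψx : ψ x = 0 := smoothPos_of_nonpos hε0 hTx'
          rw [hIG x hxG, smoothPosDeriv_of_nonpos hε0 hTx', hψx]
          have : 0 ≤ ε * |C| := by positivity
          linarith
      · rw [indicator_of_notMem hxK, hI0 x hxK]; simp
  have hup : ∫ x, I x ≤ lam * M ^ p * ∫ x in G, (1 - (v x / V x) ^ (p - 1)) := by
    rw [hIeq, ← integral_const_mul, ← integral_indicator hGo.measurableSet]
    have hi1 := hφ1.integrable_mul (f := fun x => lam * u x ^ (p - 1)) (continuousOn_const.mul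
        (hu.continuousOn.rpow_const fun x _ => Or.inr hp1.le))
    have hi2 := hφ2.integrable_mul (f := fun x => lam * v x ^ (p - 1)) (continuousOn_const.mul
        (hv.continuousOn.rpow_const fun x _ => Or.inr hp1.le))
    have hq01 : ∀ x ∈ G, 0 ≤ (v x / V x) ^ (p - 1) ∧ (v x / V x) ^ (p - 1) ≤ 1 := by
      intro x hx
      have h0 : 0 ≤ v x / V x := div_nonneg (vpos x hx).le (Vpos x hx).le
      have h1 : v x / V x ≤ 1 := (div_le_one (Vpos x hx)).2 (by simp only [hV]; linarith)
      exact ⟨Real.rpow_nonneg h0 _, Real.rpow_le_one h0 h1 hp1.le⟩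
    refine integral_mono (hi1.sub hi2) ?_ fun x => ?_
    · refine (integrable_indicator_iff hGo.measurableSet).2 (Integrable.const_mul ?_ _)
      refine ⟨?_, .restrict_of_bounded (C := 1) hGb.measure_lt_top ?_⟩
      · have hcont : ContinuousOn (fun x => 1 - (v x / V x) ^ (p - 1)) G :=
          continuousOn_const.sub (ContinuousOn.rpow_const
            (hv.continuousOn.div hVC.continuousOn fun x hx => (Vpos x hx).ne')
            fun x _ => Or.inr hp1.le)
        exact hcont.aestronglyMeasurable hGo.measurableSet
      · refine (ae_restrict_iff' hGo.measurableSet).2 (Filter.Eventually.of_forall fun x hx => ?_)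
        obtain ⟨h0, h1⟩ := hq01 x hx
        rw [Real.norm_eq_abs, abs_le]; constructor <;> linarith
    · simp only
      by_cases hx : x ∈ G
      · rw [indicator_of_mem hx, indicator_of_mem hx, indicator_of_mem hx, hg1, hg2]
        simp only
        have hu0 := upos x hx
        have hV0 := Vpos x hx
        have e1 : u x ^ (p - 1) * u x ^ (1 - p) = 1 := by rw [← Real.rpow_add hu0]; norm_num
        have e2 : v x ^ (p - 1) * V x ^ (1 - p) = (v x / V x) ^ (p - 1) := by
          rw [Real.div_rpow (vpos x hx).le hV0.le, show 1 - p = -(p - 1) by ring,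
            Real.rpow_neg hV0.le]; rfl
        have e3 : lam * u x ^ (p - 1) * (smoothPos ε (T x) * u x ^ (1 - p)) -
            lam * v x ^ (p - 1) * (smoothPos ε (T x) * V x ^ (1 - p)) =
            lam * smoothPos ε (T x) * (1 - (v x / V x) ^ (p - 1)) := by
          linear_combination (lam * smoothPos ε (T x)) * (e1 - e2)
        rw [e3]
        refine mul_le_mul_of_nonneg_right ?_ (sub_nonneg.2 (hq01 x hx).2)
        refine mul_le_mul_of_nonneg_left ?_ hlam
        have hMx : u x ^ p ≤ M ^ p := Real.rpow_le_rpow hu0.le (hM x hx) hp0.le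
        by_cases hTx : 0 ≤ T x
        · refine (smoothPos_bounds hε0 hTx).1.trans ?_
          have : 0 ≤ V x ^ p := Real.rpow_nonneg hV0.le _
          simp only [hT]; linarith
        · rw [smoothPos_of_nonpos hε0 (not_le.1 hTx).le]
          exact (Real.rpow_nonneg hu0.le _).trans hMx
      · rw [indicator_of_notMem hx, indicator_of_notMem hx, indicator_of_notMem hx]; simp
  linarith

/-- Where a positive eigenfunction exceeds another one that dominates it on the frontier, the
logarithmic gradients agree. -/
lemma picone_rigidity {p : ℝ} (hp : 1 < p) {G : Set (Euc N)} (hGo : IsOpen G)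
    (hGb : Bornology.IsBounded G) {u v : Euc N → ℝ} (hu : ContDiffOn ℝ 1 u G)
    (hv : ContDiffOn ℝ 1 v G) (huc : ContinuousOn u (closure G)) (hvc : ContinuousOn v (closure G))
    (upos : ∀ x ∈ G, 0 < u x) (vpos : ∀ x ∈ G, 0 < v x) (hbd : ∀ x ∈ frontier G, u x ≤ v x)
    {lam : ℝ} (hlam : 0 ≤ lam)
    (Hu : WeakDivEq G (fun x => pFlux p (gradient u x)) (fun x => lam * u x ^ (p - 1)))
    (Hv : WeakDivEq G (fun x => pFlux p (gradient v x)) (fun x => lam * v x ^ (p - 1)))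
    {x₀ : Euc N} (hx₀ : x₀ ∈ G) (hlt : v x₀ < u x₀) :
    (u x₀)⁻¹ • gradient u x₀ = (v x₀)⁻¹ • gradient v x₀ := by
  by_contra hne
  have hp0 : 0 < p := by linarith
  obtain ⟨M, hM⟩ := (hGb.isCompact_closure).exists_bound_of_continuousOn huc
  have hM' : ∀ x ∈ G, u x ≤ M := fun x hx =>
    (le_abs_self _).trans (hM x (subset_closure hx))
  have hv0 := vpos x₀ hx₀
  have hu0 := upos x₀ hx₀
  have cu : ContinuousAt (fun z : Euc N × ℝ => u z.1) (x₀, 0) :=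
    ContinuousAt.comp (f := Prod.fst) (hu.continuousOn.continuousAt (hGo.mem_nhds hx₀)) continuousAt_fst
  have cv : ContinuousAt (fun z : Euc N × ℝ => v z.1) (x₀, 0) :=
    ContinuousAt.comp (f := Prod.fst) (hv.continuousOn.continuousAt (hGo.mem_nhds hx₀)) continuousAt_fst
  have cV : ContinuousAt (fun z : Euc N × ℝ => v z.1 + z.2) (x₀, 0) := cv.add continuousAt_snd
  have cgu : ContinuousAt (fun z : Euc N × ℝ => gradient u z.1) (x₀, 0) :=
    ContinuousAt.comp (f := Prod.fst) ((continuousOn_gradient hGo hu).continuousAt (hGo.mem_nhds hx₀))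
      continuousAt_fst
  have cgv : ContinuousAt (fun z : Euc N × ℝ => gradient v z.1) (x₀, 0) :=
    ContinuousAt.comp (f := Prod.fst) ((continuousOn_gradient hGo hv).continuousAt (hGo.mem_nhds hx₀))
      continuousAt_fst
  have cα : ContinuousAt (fun z : Euc N × ℝ => (u z.1)⁻¹ • gradient u z.1) (x₀, 0) :=
    (cu.inv₀ hu0.ne').smul cgu
  have cβ : ContinuousAt (fun z : Euc N × ℝ => (v z.1 + z.2)⁻¹ • gradient v z.1) (x₀, 0) :=
    (cV.inv₀ (by simpa using hv0.ne')).smul cgv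
  set D : Euc N × ℝ → ℝ := fun z => p * (v z.1 + z.2) ^ p *
    ⟪pFlux p ((u z.1)⁻¹ • gradient u z.1) - pFlux p ((v z.1 + z.2)⁻¹ • gradient v z.1),
      (u z.1)⁻¹ • gradient u z.1 - (v z.1 + z.2)⁻¹ • gradient v z.1⟫ with hD
  have cD : ContinuousAt D (x₀, 0) := by
    refine (continuousAt_const.mul (cV.rpow_const (Or.inr hp0.le))).mul ?_
    refine Filter.Tendsto.inner (ContinuousAt.sub ?_ ?_) (cα.sub cβ)
    · exact ContinuousAt.comp (f := fun z : Euc N × ℝ => (u z.1)⁻¹ • gradient u z.1)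
        (continuous_pFlux hp).continuousAt cα
    · exact ContinuousAt.comp (f := fun z : Euc N × ℝ => (v z.1 + z.2)⁻¹ • gradient v z.1)
        (continuous_pFlux hp).continuousAt cβ
  have cT : ContinuousAt (fun z : Euc N × ℝ => u z.1 ^ p - (v z.1 + z.2) ^ p) (x₀, 0) :=
    (cu.rpow_const (Or.inr hp0.le)).sub (cV.rpow_const (Or.inr hp0.le))
  have hD0 : 0 < D (x₀, 0) := by
    simp only [hD, add_zero]
    exact mul_pos (mul_pos hp0 (Real.rpow_pos_of_pos hv0 _)) (inner_pFlux_sub_pos hp hne)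
  have hT0 : 0 < u x₀ ^ p - (v x₀ + 0) ^ p := by
    rw [add_zero]; exact sub_pos.2 (Real.rpow_lt_rpow hv0.le hlt hp0)
  set d := D (x₀, 0) / 2 with hd
  set τ := (u x₀ ^ p - (v x₀ + 0) ^ p) / 2 with hτ
  have hev := (cD.eventually (lt_mem_nhds (show d < D (x₀, 0) by rw [hd]; linarith))).and
    (cT.eventually (lt_mem_nhds (show τ < u x₀ ^ p - (v x₀ + 0) ^ p by rw [hτ]; linarith)))
  obtain ⟨r1, hr1, hb1⟩ := Metric.mem_nhds_iff.1 hev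
  obtain ⟨r2, hr2, hb2⟩ := Metric.mem_nhds_iff.1 (hGo.mem_nhds hx₀)
  rw [← ball_prod_same] at hb1
  set B := ball x₀ (min r1 r2) with hB
  have hr : 0 < min r1 r2 := lt_min hr1 hr2
  have hBpos : 0 < volume.real B :=
    ENNReal.toReal_pos (measure_ball_pos volume x₀ hr).ne' measure_ball_lt_top.ne
  have hlim := (tendsto_integral_one_sub_rpow hp hGo hGb hv.continuousOn vpos).const_mul
    (lam * M ^ p)
  rw [mul_zero] at hlim
  have hle : d * volume.real B ≤ 0 := by
    refine ge_of_tendsto hlim ?_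
    filter_upwards [Ioo_mem_nhdsGT hr1] with η hη
    have hmem : ∀ x ∈ B, (x, η) ∈ ball x₀ r1 ×ˢ ball (0 : ℝ) r1 := fun x hx =>
      ⟨ball_subset_ball (min_le_left _ _) hx, by
        rw [mem_ball_zero_iff, Real.norm_of_nonneg hη.1.le]; exact hη.2⟩
    exact picone_integral hp hGo hGb hu hv huc hvc upos vpos hbd hlam Hu Hv hM' hη.1
      measurableSet_ball ((ball_subset_ball (min_le_right _ _)).trans hb2) (half_pos hT0)
      (fun x hx => (hb1 (hmem x hx)).2.le) (fun x hx => (hb1 (hmem x hx)).1.le)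
  have : 0 < d * volume.real B := mul_pos (half_pos hD0) hBpos
  linarith

end Picone

section Reflection
variable {N : ℕ}

lemma pFlux_map {E : Type*} [NormedAddCommGroup E] [InnerProductSpace ℝ E] (p : ℝ)
    (L : E ≃ₗᵢ[ℝ] E) (ξ : E) : pFlux p (L ξ) = L (pFlux p ξ) := by
  simp [pFlux]

lemma gradient_comp_isometry {u : Euc N → ℝ} (L : Euc N ≃ₗᵢ[ℝ] Euc N) (b : Euc N) {x : Euc N}
    (hu : DifferentiableAt ℝ u (L x + b)) :
    gradient (fun y => u (L y + b)) x = L.symm (gradient u (L x + b)) := by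
  have h1 : HasFDerivAt (fun y => L y + b)
      (L.toContinuousLinearEquiv : Euc N →L[ℝ] Euc N) x :=
    ((L.toContinuousLinearEquiv : Euc N →L[ℝ] Euc N).hasFDerivAt).add_const b
  refine gradient_of_hasFDerivAt ?_
  have h2 : HasFDerivAt (fun y => u (L y + b)) _ x := hu.hasFDerivAt.comp x h1
  have h3 : (innerSL ℝ (L.symm (gradient u (L x + b))) : Euc N →L[ℝ] ℝ) =
      (fderiv ℝ u (L x + b)).comp (L.toContinuousLinearEquiv : Euc N →L[ℝ] Euc N) := ?_
  · rw [h3]; exact h2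
  refine ContinuousLinearMap.ext fun w => ?_
  have : ⟪L.symm (gradient u (L x + b)), w⟫ = ⟪gradient u (L x + b), L w⟫ := by
    rw [← L.inner_map_map, L.apply_symm_apply]
  simpa [inner_gradient] using this

lemma measurePreserving_isometry (L : Euc N ≃ₗᵢ[ℝ] Euc N) (b : Euc N) :
    MeasurePreserving (fun x : Euc N => L x + b) volume volume :=
  (measurePreserving_add_right volume b).comp L.measurePreserving

lemma WeakDivEq.comp_isometry {p : ℝ} {U : Set (Euc N)} (hU : IsOpen U) {u h : Euc N → ℝ}
    (hu : ContDiffOn ℝ 1 u U) (H : WeakDivEq U (fun x => pFlux p (gradient u x)) h)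
    (L : Euc N ≃ₗᵢ[ℝ] Euc N) (b : Euc N) :
    WeakDivEq ((fun x => L x + b) ⁻¹' U)
      (fun x => pFlux p (gradient (fun y => u (L y + b)) x)) (fun x => h (L x + b)) := by
  intro φ hφ
  set e : Euc N ≃ₜ Euc N := L.toHomeomorph.trans (Homeomorph.addRight b) with he
  have hex : ∀ x, e x = L x + b := fun x => rfl
  have hesx : ∀ x, e.symm x = L.symm (x + -b) := fun x => rfl
  set ψ : Euc N → ℝ := fun y => φ (e.symm y) with hψ
  have hψ1 : ContDiff ℝ 1 ψ := by
    have : ContDiff ℝ 1 fun y : Euc N => L.symm (y + -b) :=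
      L.symm.contDiff.comp (contDiff_id.add contDiff_const)
    exact hφ.contDiff.comp this
  have hts : tsupport ψ = e.symm ⁻¹' tsupport φ := tsupport_comp_eq_preimage φ e.symm
  have hψt : IsC1Test U ψ := by
    refine ⟨hψ1, hφ.hasCompactSupport.comp_homeomorph e.symm, ?_⟩
    rw [hts]
    intro y hy
    have := hφ.tsupport_subset hy
    have h2 : e (e.symm y) ∈ U := this
    rwa [e.apply_symm_apply] at h2
  have hφψ : φ = fun x => ψ (L x + b) := by
    funext x
    simp only [hψ, ← hex, e.symm_apply_apply]
  have hgφ : ∀ x, gradient φ x = L.symm (gradient ψ (L x + b)) := fun x => by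
    conv_lhs => rw [hφψ]
    exact gradient_comp_isometry L b ((hψ1.differentiable one_ne_zero) _)
  have hmp := measurePreserving_isometry L b
  have hme : MeasurableEmbedding fun x => L x + b := e.measurableEmbedding
  have e1 : ∀ x, ⟪pFlux p (gradient (fun y => u (L y + b)) x), gradient φ x⟫ =
      ⟪pFlux p (gradient u (L x + b)), gradient ψ (L x + b)⟫ := by
    intro x
    by_cases hx : L x + b ∈ U
    · rw [gradient_comp_isometry L b (differentiableAt_of_contDiffOn hU hu hx), hgφ,
        pFlux_map, L.symm.inner_map_map]
    · have : gradient ψ (L x + b) = 0 :=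
        gradient_eq_zero_of_notMem_tsupport fun h => hx (hψt.tsupport_subset h)
      rw [hgφ, this]; simp
  simp only [e1]
  have e2 : ∀ x, h (L x + b) * φ x = h (L x + b) * ψ (L x + b) := fun x => by
    conv_lhs => rw [hφψ]
  simp only [e2]
  rw [hmp.integral_comp hme (fun y => ⟪pFlux p (gradient u y), gradient ψ y⟫),
    hmp.integral_comp hme (fun y => h y * ψ y)]
  exact H ψ hψt

/-- The linear reflection across the hyperplane orthogonal to `ν`. -/
def linRefl (ν : Euc N) : Euc N ≃ₗᵢ[ℝ] Euc N := (Submodule.span ℝ {ν})ᗮ.reflection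

/-- The reflection across the hyperplane `⟪ν, x⟫ = c`. -/
def affRefl (ν : Euc N) (c : ℝ) (x : Euc N) : Euc N := linRefl ν x + (2 * c) • ν

lemma linRefl_apply {ν : Euc N} (hν : ‖ν‖ = 1) (x : Euc N) :
    linRefl ν x = x - (2 * ⟪ν, x⟫) • ν := by
  rw [linRefl, Submodule.reflection_orthogonal_apply, Submodule.reflection_singleton_apply]
  simp [hν, two_mul, add_smul, two_smul]

lemma linRefl_symm (ν : Euc N) : (linRefl ν).symm = linRefl ν :=
  Submodule.reflection_symm

lemma affRefl_apply {ν : Euc N} (hν : ‖ν‖ = 1) (c : ℝ) (x : Euc N) :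
    affRefl ν c x = x - (2 * (⟪ν, x⟫ - c)) • ν := by
  rw [affRefl, linRefl_apply hν]; module

lemma affRefl_of_eq {ν : Euc N} (hν : ‖ν‖ = 1) {c : ℝ} {x : Euc N} (hx : ⟪ν, x⟫ = c) :
    affRefl ν c x = x := by
  rw [affRefl_apply hν, hx]; simp

lemma norm_affRefl_sub_sq {ν : Euc N} (hν : ‖ν‖ = 1) (c : ℝ) (x a : Euc N) :
    ‖affRefl ν c x - a‖ ^ 2 = ‖x - a‖ ^ 2 + 4 * (⟪ν, x⟫ - c) * (⟪ν, a⟫ - c) := by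
  have h1 : affRefl ν c x - a = (x - a) - (2 * (⟪ν, x⟫ - c)) • ν := by
    rw [affRefl_apply hν]; abel
  rw [h1, norm_sub_sq_real, norm_smul, hν, inner_smul_right, real_inner_comm ν (x - a),
    inner_sub_right, mul_one, Real.norm_eq_abs, sq_abs]
  ring

lemma continuous_affRefl (ν : Euc N) (c : ℝ) : Continuous (affRefl ν c) :=
  (linRefl ν).continuous.add continuous_const

lemma contDiff_affRefl (ν : Euc N) (c : ℝ) : ContDiff ℝ 1 (affRefl ν c) :=
  (linRefl ν).contDiff.add contDiff_const

lemma gradient_comp_affRefl {u : Euc N → ℝ} (ν : Euc N) (c : ℝ) {x : Euc N}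
    (hu : DifferentiableAt ℝ u (affRefl ν c x)) :
    gradient (fun y => u (affRefl ν c y)) x = linRefl ν (gradient u (affRefl ν c x)) := by
  have := gradient_comp_isometry (linRefl ν) ((2 * c) • ν) hu
  rwa [linRefl_symm] at this

end Reflection

section Annulus
variable {N : ℕ}

/-- The open eccentric annulus between the spheres of radius `r0` about `a` and of radius `r1`
about the origin. -/
def eAnn (r0 r1 : ℝ) (a : Euc N) : Set (Euc N) := ball 0 r1 \ closedBall a r0

/-- The closed eccentric annulus. -/
def eAnnC (r0 r1 : ℝ) (a : Euc N) : Set (Euc N) := closedBall 0 r1 \ ball a r0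

lemma isOpen_eAnn (r0 r1 : ℝ) (a : Euc N) : IsOpen (eAnn r0 r1 a) :=
  isOpen_ball.sdiff isClosed_closedBall

lemma mem_eAnn {r0 r1 : ℝ} {a x : Euc N} : x ∈ eAnn r0 r1 a ↔ ‖x‖ < r1 ∧ r0 < ‖x - a‖ := by
  simp [eAnn, dist_eq_norm]

lemma mem_eAnnC {r0 r1 : ℝ} {a x : Euc N} : x ∈ eAnnC r0 r1 a ↔ ‖x‖ ≤ r1 ∧ r0 ≤ ‖x - a‖ := by
  simp [eAnnC, dist_eq_norm]

lemma isClosed_eAnnC (r0 r1 : ℝ) (a : Euc N) : IsClosed (eAnnC r0 r1 a) :=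
  isClosed_closedBall.sdiff isOpen_ball

lemma eAnn_subset (r0 r1 : ℝ) (a : Euc N) : eAnn r0 r1 a ⊆ eAnnC r0 r1 a :=
  sdiff_subset_sdiff ball_subset_closedBall ball_subset_closedBall

lemma eAnnC_subset_closure {r0 r1 : ℝ} (hr0 : 0 < r0) {a : Euc N} (h : ‖a‖ + r0 < r1) :
    eAnnC r0 r1 a ⊆ closure (eAnn r0 r1 a) := by
  have hr1 : r1 ≠ 0 := by have := norm_nonneg a; linarith
  intro x hx
  rw [mem_eAnnC] at hx
  rcases hx.1.lt_or_eq with h1 | h1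
  · have : x ∈ ball (0 : Euc N) r1 ∩ closure (closedBall a r0)ᶜ := by
      refine ⟨by simpa using h1, ?_⟩
      rw [closure_compl, interior_closedBall _ hr0.ne']
      simpa [dist_eq_norm] using hx.2
    exact isOpen_ball.inter_closure this
  · have : x ∈ (closedBall a r0)ᶜ ∩ closure (ball (0 : Euc N) r1) := by
      refine ⟨?_, ?_⟩
      · have := norm_sub_norm_le x a
        simp only [mem_compl_iff, mem_closedBall, dist_eq_norm, not_le]
        linarith
      · rw [closure_ball _ hr1]; simpa using hx.1
    have := isClosed_closedBall.isOpen_compl.inter_closure this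
    rwa [inter_comm] at this

/-- A positive Dirichlet eigenfunction of the `p`-Laplacian on an eccentric annulus which is `C^1`
up to the boundary. -/
structure IsEigen (p lam r0 r1 : ℝ) (a : Euc N) (W : Set (Euc N)) (u : Euc N → ℝ) : Prop where
  one_lt : 1 < p
  lam_nonneg : 0 ≤ lam
  r0_pos : 0 < r0
  lt : ‖a‖ + r0 < r1
  isOpen : IsOpen W
  subset : eAnnC r0 r1 a ⊆ W
  contDiffOn : ContDiffOn ℝ 1 u W
  pos : ∀ x ∈ eAnn r0 r1 a, 0 < u x
  zero_outer : ∀ x, ‖x‖ = r1 → u x = 0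
  zero_inner : ∀ x, ‖x - a‖ = r0 → u x = 0
  eq : WeakDivEq (eAnn r0 r1 a) (fun x => pFlux p (gradient u x)) (fun x => lam * u x ^ (p - 1))

namespace IsEigen

variable {p lam r0 r1 : ℝ} {a : Euc N} {W : Set (Euc N)} {u : Euc N → ℝ}

lemma nonneg (H : IsEigen p lam r0 r1 a W u) {x : Euc N} (hx : x ∈ eAnnC r0 r1 a) : 0 ≤ u x := by
  rw [mem_eAnnC] at hx
  rcases hx.1.lt_or_eq with h1 | h1
  · rcases hx.2.lt_or_eq with h2 | h2
    · exact (H.pos x (mem_eAnn.2 ⟨h1, h2⟩)).le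
    · exact (H.zero_inner x h2.symm).ge
  · exact (H.zero_outer x h1).ge

lemma exists_orthogonal (hN : 2 ≤ N) (ν b : Euc N) : ∃ d : Euc N, d ≠ 0 ∧ ⟪ν, d⟫ = 0 ∧ 0 ≤ ⟪d, b⟫ := by
  have h1 : (Submodule.span ℝ {ν})ᗮ ≠ ⊥ := by
    intro h
    have h2 := Submodule.finrank_add_finrank_orthogonal (Submodule.span ℝ {ν})
    have h3 := finrank_span_le_card (R := ℝ) ({ν} : Set (Euc N))
    rw [h, finrank_bot, finrank_euclideanSpace_fin] at h2
    simp at h3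
    omega
  obtain ⟨d, hd, hd0⟩ := Submodule.exists_mem_ne_zero_of_ne_bot h1
  rw [Submodule.mem_orthogonal_singleton_iff_inner_right] at hd
  rcases le_total 0 ⟪d, b⟫ with h | h
  · exact ⟨d, hd0, hd, h⟩
  · exact ⟨-d, neg_ne_zero.2 hd0, by simp [hd], by simpa using h⟩

lemma affRefl_mem {ν : Euc N} (hν : ‖ν‖ = 1) {c : ℝ} (hc : 0 ≤ c) (hca : c ≤ ⟪ν, a⟫)
    {x : Euc N} (hx : x ∈ eAnnC r0 r1 a) (hxc : c ≤ ⟪ν, x⟫) : affRefl ν c x ∈ eAnnC r0 r1 a := by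
  rw [mem_eAnnC] at hx ⊢
  have e0 := norm_affRefl_sub_sq hν c x 0
  have e1 := norm_affRefl_sub_sq hν c x a
  simp only [sub_zero, inner_zero_right, zero_sub] at e0
  constructor
  · refine (pow_le_pow_iff_left₀ (norm_nonneg _) (norm_nonneg _) two_ne_zero).1 ?_ |>.trans hx.1
    nlinarith
  · refine hx.2.trans ((pow_le_pow_iff_left₀ (norm_nonneg _) (norm_nonneg _) two_ne_zero).1 ?_)
    nlinarith [mul_nonneg (sub_nonneg.2 hxc) (sub_nonneg.2 hca)]

lemma affRefl_mem' {ν : Euc N} (hν : ‖ν‖ = 1) {c : ℝ} (hc : 0 < c) (hca : c ≤ ⟪ν, a⟫)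
    {x : Euc N} (hx : ‖x‖ ≤ r1) (hxa : r0 < ‖x - a‖) (hxc : c < ⟪ν, x⟫) :
    affRefl ν c x ∈ eAnn r0 r1 a := by
  rw [mem_eAnn]
  have e0 := norm_affRefl_sub_sq hν c x 0
  have e1 := norm_affRefl_sub_sq hν c x a
  simp only [sub_zero, inner_zero_right, zero_sub] at e0
  constructor
  · refine ((pow_lt_pow_iff_left₀ (norm_nonneg _) (norm_nonneg _) two_ne_zero).1 ?_).trans_le hx
    nlinarith [mul_pos (sub_pos.2 hxc) hc]
  · refine hxa.trans_le ((pow_le_pow_iff_left₀ (norm_nonneg _) (norm_nonneg _) two_ne_zero).1 ?_)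
    nlinarith [mul_nonneg (sub_nonneg.2 hxc.le) (sub_nonneg.2 hca)]

lemma continuousOn (H : IsEigen p lam r0 r1 a W u) : ContinuousOn u W := H.contDiffOn.continuousOn

/-- Reflection comparison: the eigenfunction is larger on the side of the origin. -/
lemma le_affRefl (H : IsEigen p lam r0 r1 a W u) (hN : 2 ≤ N) {ν : Euc N} (hν : ‖ν‖ = 1) {c : ℝ}
    (hc : 0 < c) (hca : c ≤ ⟪ν, a⟫) {x : Euc N} (hx : x ∈ eAnnC r0 r1 a) (hxc : c ≤ ⟪ν, x⟫) :
    u x ≤ u (affRefl ν c x) := by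
  have hσx := affRefl_mem hν hc.le hca hx hxc
  by_contra! hlt
  set σ := affRefl ν c with hσ
  set v : Euc N → ℝ := fun y => u (σ y) with hv
  set Ω := eAnn r0 r1 a with hΩ
  set G : Set (Euc N) := Ω ∩ {y | c < ⟪ν, y⟫} with hG
  have hGo : IsOpen G := (isOpen_eAnn r0 r1 a).inter
    (isOpen_lt continuous_const (continuous_const.inner continuous_id))
  have hGb : Bornology.IsBounded G := isBounded_ball.subset fun y hy => hy.1.1
  have hGcl : closure G ⊆ eAnnC r0 r1 a ∩ {y | c ≤ ⟪ν, y⟫} := by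
    refine closure_minimal (fun y hy => ⟨eAnn_subset _ _ _ hy.1, (mem_ofPred.1 hy.2).le⟩) ?_
    exact (isClosed_eAnnC r0 r1 a).inter
      (isClosed_le continuous_const (continuous_const.inner continuous_id))
  have hGW : closure G ⊆ W := fun y hy => H.subset (hGcl hy).1
  have hσG : ∀ y ∈ G, σ y ∈ Ω := fun y hy =>
    affRefl_mem' hν hc hca (mem_eAnn.1 hy.1).1.le (mem_eAnn.1 hy.1).2 hy.2
  have hσGcl : ∀ y ∈ closure G, σ y ∈ eAnnC r0 r1 a := fun y hy =>
    affRefl_mem hν hc.le hca (hGcl hy).1 (hGcl hy).2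
  have hvc : ContinuousOn v (closure G) := H.continuousOn.comp
    (continuous_affRefl ν c).continuousOn fun y hy => H.subset (hσGcl y hy)
  have hv1 : ContDiffOn ℝ 1 v G := H.contDiffOn.comp
    (contDiff_affRefl ν c).contDiffOn fun y hy => H.subset (hσGcl y (subset_closure hy))
  have hu1 : ContDiffOn ℝ 1 u G := H.contDiffOn.mono (subset_closure.trans hGW)
  have hbd : ∀ y ∈ frontier G, u y ≤ v y := by
    intro y hy
    have hyc := hGcl hy.1
    have hyG : y ∉ G := by rw [hGo.frontier_eq] at hy; exact hy.2
    have hv0 : 0 ≤ v y := H.nonneg (hσGcl y hy.1)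
    obtain ⟨h1, h2⟩ := mem_eAnnC.1 hyc.1
    rcases h1.lt_or_eq with h1 | h1
    · rcases h2.lt_or_eq with h2 | h2
      · have : ⟪ν, y⟫ = c := by
          refine le_antisymm ?_ hyc.2
          by_contra! h3
          exact hyG ⟨mem_eAnn.2 ⟨h1, h2⟩, h3⟩
        simp only [hv, hσ]
        rw [affRefl_of_eq hν this]
      · rw [H.zero_inner y h2.symm]; exact hv0
    · rw [H.zero_outer y h1]; exact hv0
  have upos : ∀ y ∈ G, 0 < u y := fun y hy => H.pos y hy.1
  have vpos : ∀ y ∈ G, 0 < v y := fun y hy => H.pos _ (hσG y hy)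
  have Hu := H.eq.mono (inter_subset_left : G ⊆ Ω)
  have Hv : WeakDivEq G (fun y => pFlux p (gradient v y)) (fun y => lam * v y ^ (p - 1)) :=
    (H.eq.comp_isometry (isOpen_eAnn r0 r1 a)
      (H.contDiffOn.mono ((eAnn_subset r0 r1 a).trans H.subset)) (linRefl ν) ((2 * c) • ν)).mono hσG
  have hrig := fun y hy h => picone_rigidity H.one_lt hGo hGb hu1 hv1 (H.continuousOn.mono hGW) hvc
    upos vpos hbd H.lam_nonneg Hu Hv (x₀ := y) hy h
  have hxG : x ∈ G := by
    obtain ⟨h1, h2⟩ := mem_eAnnC.1 hx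
    have hσx0 := H.nonneg hσx
    rcases h1.lt_or_eq with h1 | h1
    · rcases h2.lt_or_eq with h2 | h2
      · refine ⟨mem_eAnn.2 ⟨h1, h2⟩, ?_⟩
        refine lt_of_le_of_ne hxc fun h3 => ?_
        rw [hσ, affRefl_of_eq hν h3.symm] at hlt
        exact lt_irrefl _ hlt
      · rw [H.zero_inner x h2.symm] at hlt; exact absurd hlt hσx0.not_gt
    · rw [H.zero_outer x h1] at hlt; exact absurd hlt hσx0.not_gt
  -- follow a ray inside `G` up to the outer sphere
  obtain ⟨d, hd0, hdν, hda⟩ := exists_orthogonal hN ν (x - a)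
  set γ : ℝ → Euc N := fun t => x + t • d with hγ
  have hγc : Continuous γ := by fun_prop
  have hγ0 : γ 0 = x := by simp [hγ]
  have hxr : ‖x‖ < r1 := (mem_eAnn.1 hxG.1).1
  obtain ⟨T, hT0, hT⟩ : ∃ T, 0 ≤ T ∧ ‖γ T‖ = r1 := by
    have hpos : 0 < ‖d‖ := norm_pos_iff.2 hd0
    set b := (r1 + ‖x‖) / ‖d‖ with hb
    have hb0 : 0 ≤ b := div_nonneg (by linarith [norm_nonneg x]) hpos.le
    have h1 : r1 ≤ ‖γ b‖ := by
      have h2 : ‖b • d‖ = r1 + ‖x‖ := by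
        rw [norm_smul, Real.norm_of_nonneg hb0, hb, div_mul_cancel₀ _ hpos.ne']
      have h3 : ‖b • d‖ ≤ ‖γ b‖ + ‖x‖ := by
        have : b • d = γ b - x := by simp [hγ]
        rw [this]; exact norm_sub_le _ _
      linarith
    have := intermediate_value_Icc hb0 (f := fun t => ‖γ t‖) hγc.norm.continuousOn
    obtain ⟨T, hT, hTe⟩ := this ⟨by simpa only [hγ0] using hxr.le, h1⟩
    exact ⟨T, hT.1, hTe⟩
  have hTpos : 0 < T := lt_of_le_of_ne hT0 fun h => by
    rw [← h, hγ0] at hT; exact hxr.ne hT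
  have hνγ : ∀ t, ⟪ν, γ t⟫ = ⟪ν, x⟫ := fun t => by
    simp [hγ, inner_add_right, inner_smul_right, hdν]
  have haγ : ∀ t, 0 ≤ t → r0 < ‖γ t - a‖ := fun t ht => by
    have h1 : ‖γ t - a‖ ^ 2 = ‖x - a‖ ^ 2 + 2 * (t * ⟪d, x - a⟫) + ‖t • d‖ ^ 2 := by
      rw [show γ t - a = (x - a) + t • d by simp only [hγ]; abel, norm_add_sq_real,
        inner_smul_right, real_inner_comm]
    refine (mem_eAnn.1 hxG.1).2.trans_le
      ((pow_le_pow_iff_left₀ (norm_nonneg _) (norm_nonneg _) two_ne_zero).1 ?_)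
    have := mul_nonneg ht hda
    nlinarith [sq_nonneg ‖t • d‖]
  have hγG : ∀ t, 0 ≤ t → t < T → γ t ∈ G := by
    intro t ht htT
    refine ⟨mem_eAnn.2 ⟨?_, haγ t ht⟩, by
      simp only [mem_ofPred_eq]; rw [hνγ]; exact hxG.2⟩
    have h1 : γ t = (1 - t / T) • x + (t / T) • γ T := by
      simp only [hγ, smul_add, smul_smul, div_mul_cancel₀ t hTpos.ne']
      module
    have h2 : t / T < 1 := (div_lt_one hTpos).2 htT
    have h3 : 0 ≤ t / T := div_nonneg ht hT0
    rw [h1]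
    refine (norm_add_le _ _).trans_lt ?_
    rw [norm_smul, norm_smul, Real.norm_of_nonneg h3, Real.norm_of_nonneg (by linarith), hT]
    nlinarith
  have hγcl : ∀ t ∈ Icc 0 T, γ t ∈ closure G := by
    intro t ht
    rcases ht.2.lt_or_eq with h | h
    · exact subset_closure (hγG t ht.1 h)
    · have h1 : t ∈ closure (Ico 0 T) := by
        rw [closure_Ico hTpos.ne]; exact ht
      have h2 := image_closure_subset_closure_image hγc (mem_image_of_mem γ h1)
      refine closure_mono ?_ h2
      rintro _ ⟨τ, hτ, rfl⟩
      exact hγG τ hτ.1 hτ.2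
  have hvx : 0 < v x := vpos x hxG
  set k := u x / v x with hk
  have hk1 : 1 < k := (one_lt_div hvx).2 hlt
  set S : Set ℝ := {t | u (γ t) = k * v (γ t)} with hS
  have hSc : IsClosed (S ∩ Icc 0 T) := by
    have h1 : ContinuousOn (fun t => u (γ t) - k * v (γ t)) (Icc 0 T) := by
      refine ContinuousOn.sub ?_ (continuousOn_const.mul ?_)
      · exact (H.continuousOn.mono hGW).comp hγc.continuousOn hγcl
      · exact hvc.comp hγc.continuousOn hγcl
    have := h1.preimage_isClosed_of_isClosed isClosed_Icc (isClosed_singleton (x := (0 : ℝ)))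
    convert this using 1
    ext t
    simp only [hS, mem_inter_iff, mem_ofPred_eq, mem_preimage, mem_singleton_iff, sub_eq_zero]
    exact and_comm
  have hSI : Icc 0 T ⊆ S := by
    refine hSc.Icc_subset_of_forall_exists_gt ?_ ?_
    · simp only [hS, mem_ofPred_eq, hγ0, hk]; field_simp
    rintro t ⟨htS, ht0, htT⟩ y hy
    have htG := hγG t ht0 htT
    have hvt := vpos _ htG
    have hut : v (γ t) < u (γ t) := by
      rw [show u (γ t) = k * v (γ t) from htS]; nlinarith
    have hopen : IsOpen {z | z ∈ G ∧ v z < u z} :=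
      (hv1.continuousOn.prodMk hu1.continuousOn).isOpen_inter_preimage hGo
        (isOpen_lt continuous_fst continuous_snd)
    obtain ⟨δ, hδ, hδs⟩ : ∃ δ > 0, ∀ τ, |τ - t| < δ → γ τ ∈ G ∧ v (γ τ) < u (γ τ) := by
      have := (hopen.preimage hγc).mem_nhds (show t ∈ γ ⁻¹' _ from ⟨htG, hut⟩)
      obtain ⟨δ, hδ, h⟩ := Metric.mem_nhds_iff.1 this
      exact ⟨δ, hδ, fun τ hτ => h (by rwa [mem_ball, Real.dist_eq])⟩
    set t' := min y (t + δ / 2) with ht'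
    have htt' : t < t' := lt_min hy (by linarith)
    have ht'δ : t' ≤ t + δ / 2 := min_le_right _ _
    have hder : ∀ τ ∈ Icc t t', HasDerivAt (fun τ => u (γ τ) / v (γ τ)) 0 τ := by
      intro τ hτ
      obtain ⟨hτG, hτu⟩ := hδs τ (by rw [abs_lt]; constructor <;> linarith [hτ.1, hτ.2])
      have hγd : HasDerivAt γ d τ := by
        simpa [hγ] using ((hasDerivAt_id τ).smul_const d).const_add x
      have d1 := (differentiableAt_of_contDiffOn hGo hu1 hτG).hasFDerivAt.comp_hasDerivAt τ hγd
      have d2 := (differentiableAt_of_contDiffOn hGo hv1 hτG).hasFDerivAt.comp_hasDerivAt τ hγd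
      have hvτ := vpos _ hτG
      have huτ := upos _ hτG
      have hd := d1.div d2 hvτ.ne'
      have hr := congrArg (fun z => ⟪z, d⟫) (hrig _ hτG hτu)
      simp only [real_inner_smul_left, inner_gradient] at hr
      field_simp at hr
      have e0 : fderiv ℝ u (γ τ) d * (v ∘ γ) τ - (u ∘ γ) τ * fderiv ℝ v (γ τ) d = 0 := by
        simp only [Function.comp]
        linarith
      rw [e0, zero_div] at hd
      exact hd
    have hconst := constant_of_has_deriv_right_zero (a := t) (b := t')
      (fun τ hτ => (hder τ hτ).continuousAt.continuousWithinAt)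
      (fun τ hτ => (hder τ ⟨hτ.1, hτ.2.le⟩).hasDerivWithinAt) t' ⟨htt'.le, le_rfl⟩
    refine ⟨t', ?_, htt', min_le_left _ _⟩
    obtain ⟨h1, -⟩ := hδs t' (by rw [abs_lt]; constructor <;> linarith)
    have h2 := vpos _ h1
    simp only [hS, mem_ofPred_eq] at htS ⊢
    rw [htS, mul_div_cancel_right₀ _ hvt.ne', div_eq_iff h2.ne'] at hconst
    exact hconst
  have hTS : u (γ T) = k * v (γ T) := hSI ⟨hT0, le_rfl⟩
  rw [H.zero_outer _ hT] at hTS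
  have : 0 < v (γ T) := H.pos _ (affRefl_mem' hν hc hca hT.le (haγ T hT0)
    (by rw [hνγ]; exact hxG.2))
  nlinarith

end IsEigen
end Annulus

section Radial
variable {N : ℕ}

/-- A function vanishing at `0` and nonnegative on the right has nonnegative derivative. -/
lemma HasDerivAt.nonneg_of_right {f : ℝ → ℝ} {f' δ : ℝ} (hf : HasDerivAt f f' 0) (h0 : f 0 = 0)
    (hδ : 0 < δ) (h : ∀ t, 0 < t → t < δ → 0 ≤ f t) : 0 ≤ f' := by
  have h1 := hf.tendsto_slope_zero_right
  refine ge_of_tendsto h1 ?_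
  filter_upwards [Ioo_mem_nhdsGT hδ] with t ht
  rw [zero_add, h0, sub_zero, smul_eq_mul]
  exact mul_nonneg (inv_nonneg.2 ht.1.le) (h t ht.1 ht.2)

lemma hasDerivAt_along {u : Euc N → ℝ} {x d : Euc N} (hu : DifferentiableAt ℝ u x) :
    HasDerivAt (fun t : ℝ => u (x + t • d)) ⟪gradient u x, d⟫ 0 := by
  have hγ : HasDerivAt (fun t : ℝ => x + t • d) d 0 := by
    simpa using ((hasDerivAt_id (0 : ℝ)).smul_const d).const_add x
  have hu' : HasFDerivAt u (fderiv ℝ u x) (x + (0 : ℝ) • d) := by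
    rw [zero_smul, add_zero]; exact hu.hasFDerivAt
  rw [inner_gradient]
  exact hu'.comp_hasDerivAt 0 hγ

namespace IsEigen

variable {p lam r0 r1 : ℝ} {a : Euc N} {W : Set (Euc N)} {u : Euc N → ℝ}

lemma differentiableAt (H : IsEigen p lam r0 r1 a W u) {x : Euc N} (hx : x ∈ eAnnC r0 r1 a) :
    DifferentiableAt ℝ u x := differentiableAt_of_contDiffOn H.isOpen H.contDiffOn (H.subset hx)

/-- On spheres about the center of the hole, the eigenfunction decreases in the direction of the
center. -/
lemma le_of_norm_eq (H : IsEigen p lam r0 r1 a W u) (hN : 2 ≤ N) {x y : Euc N}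
    (hx : x ∈ eAnnC r0 r1 a) (hxy : ‖x - a‖ = ‖y - a‖) (hpos : 0 < ⟪x - y, a⟫) : u x ≤ u y := by
  have hne : x - y ≠ 0 := fun h => by rw [h, inner_zero_left] at hpos; exact lt_irrefl _ hpos
  have hn : 0 < ‖x - y‖ := norm_pos_iff.2 hne
  set ν := ‖x - y‖⁻¹ • (x - y) with hν
  have hν1 : ‖ν‖ = 1 := by rw [hν, norm_smul, norm_inv, norm_norm, inv_mul_cancel₀ hn.ne']
  have h1 : ⟪x - y, x - a⟫ = ‖x - y‖ ^ 2 / 2 := by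
    have h2 : ‖y - a‖ ^ 2 = ‖x - a‖ ^ 2 - 2 * ⟪x - a, x - y⟫ + ‖x - y‖ ^ 2 := by
      rw [← norm_sub_sq_real]; congr 2; abel
    rw [← hxy] at h2
    rw [real_inner_comm]; linarith
  have h2 : ⟪ν, x⟫ - ⟪ν, a⟫ = ‖x - y‖ / 2 := by
    rw [← inner_sub_right, hν, real_inner_smul_left, h1]; field_simp
  have hc : 0 < ⟪ν, a⟫ := by
    rw [hν, real_inner_smul_left]; exact mul_pos (inv_pos.2 hn) hpos
  have := H.le_affRefl hN hν1 hc le_rfl hx (by linarith)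
  have h3 : affRefl ν ⟪ν, a⟫ x = y := by
    rw [affRefl_apply hν1, h2, hν, smul_smul]
    have : 2 * (‖x - y‖ / 2) * ‖x - y‖⁻¹ = 1 := by field_simp
    rw [this]; simp
  rwa [h3] at this

lemma mem_eAnnC_of_dist {x : Euc N} (h1 : r0 ≤ ‖x - a‖)
    (h2 : ‖x - a‖ ≤ r1 - ‖a‖) : x ∈ eAnnC r0 r1 a := by
  rw [mem_eAnnC]
  refine ⟨?_, h1⟩
  have : ‖x‖ ≤ ‖x - a‖ + ‖a‖ := by simpa using norm_add_le (x - a) a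
  linarith

lemma mem_eAnn_of_dist {x : Euc N} (h1 : r0 < ‖x - a‖)
    (h2 : ‖x - a‖ < r1 - ‖a‖) : x ∈ eAnn r0 r1 a := by
  rw [mem_eAnn]
  refine ⟨?_, h1⟩
  have : ‖x‖ ≤ ‖x - a‖ + ‖a‖ := by simpa using norm_add_le (x - a) a
  linarith

lemma norm_ray {x a : Euc N} {t : ℝ} (ht : 0 ≤ t) :
    ‖x + t • (x - a) - a‖ = (1 + t) * ‖x - a‖ := by
  rw [show x + t • (x - a) - a = (1 + t) • (x - a) by module, norm_smul,
    Real.norm_of_nonneg (by linarith)]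

lemma inner_gradient_le (H : IsEigen p lam r0 r1 a W u) (hN : 2 ≤ N) {x y : Euc N}
    (hx : ‖x - a‖ = r0) (hy : ‖y - a‖ = r0) (hpos : 0 < ⟪x - y, a⟫) :
    ⟪gradient u x, x - a⟫ ≤ ⟪gradient u y, y - a⟫ := by
  have hgap : r0 < r1 - ‖a‖ := by linarith [H.lt]
  have hr0 := H.r0_pos
  have hxm := mem_eAnnC_of_dist hx.ge (hx.le.trans hgap.le)
  have hym := mem_eAnnC_of_dist hy.ge (hy.le.trans hgap.le)
  have hd := (hasDerivAt_along (d := y - a) (H.differentiableAt hym)).sub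
    (hasDerivAt_along (d := x - a) (H.differentiableAt hxm))
  have h0 : 0 < (r1 - ‖a‖ - r0) / r0 := div_pos (by linarith) hr0
  refine sub_nonneg.1 (hd.nonneg_of_right ?_ h0 fun t ht htδ => ?_)
  · simp [H.zero_inner x hx, H.zero_inner y hy]
  · rw [lt_div_iff₀ hr0] at htδ
    refine sub_nonneg.2 (H.le_of_norm_eq hN ?_ ?_ ?_)
    · refine mem_eAnnC_of_dist ?_ ?_ <;> rw [norm_ray ht.le, hx] <;> nlinarith
    · rw [norm_ray ht.le, norm_ray ht.le, hx, hy]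
    · rw [show x + t • (x - a) - (y + t • (y - a)) = (1 + t) • (x - y) by module,
        real_inner_smul_left]
      exact mul_pos (by linarith) hpos

lemma weakDivGe_zero (H : IsEigen p lam r0 r1 a W u) :
    WeakDivGe (eAnn r0 r1 a) (fun x => pFlux p (gradient u x)) (fun _ => 0) := by
  intro φ hφ hφ0
  rw [H.eq φ hφ]
  simp only [zero_mul, integral_zero]
  refine integral_nonneg fun x => ?_
  by_cases hx : x ∈ eAnn r0 r1 a
  · exact mul_nonneg (mul_nonneg H.lam_nonneg (Real.rpow_nonneg (H.pos x hx).le _)) (hφ0 x)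
  · have : φ x = 0 := image_eq_zero_of_notMem_tsupport fun h => hx (hφ.tsupport_subset h)
    simp [this]

/-- Hopf's lemma on the inner sphere. -/
lemma inner_gradient_pos (H : IsEigen p lam r0 r1 a W u) (hN : 2 ≤ N) {x : Euc N}
    (hx : ‖x - a‖ = r0) : 0 < ⟪gradient u x, x - a⟫ := by
  have hgap : 0 < r1 - ‖a‖ - r0 := by linarith [H.lt]
  have hr0 := H.r0_pos
  set R := (r1 - ‖a‖ - r0) / 2 with hR
  have hR0 : 0 < R := by positivity
  set b := x + (R / r0) • (x - a) with hb
  have hxb : ‖x - b‖ = R := by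
    rw [hb, show x - (x + (R / r0) • (x - a)) = -((R / r0) • (x - a)) by abel, norm_neg, norm_smul,
      hx, Real.norm_of_nonneg (by positivity)]
    field_simp
  have hba : ‖b - a‖ = r0 + R := by
    rw [hb, norm_ray (by positivity), hx]; field_simp
  have hlow : ∀ y, r0 + R - ‖y - b‖ ≤ ‖y - a‖ := fun y => by
    have := norm_sub_le (y - a) (y - b)
    rw [show y - a - (y - b) = b - a by abel, hba] at this; linarith
  have hup : ∀ y, ‖y - a‖ ≤ r0 + R + ‖y - b‖ := fun y => by
    have := norm_add_le (y - b) (b - a)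
    rw [show y - b + (b - a) = y - a by abel, hba] at this; linarith
  have hball : ball b R ⊆ eAnn r0 r1 a := fun y hy => by
    rw [mem_ball, dist_eq_norm] at hy
    exact mem_eAnn_of_dist (by linarith [hlow y]) (by linarith [hup y])
  have hcball : closedBall b R ⊆ eAnnC r0 r1 a := fun y hy => by
    rw [mem_closedBall, dist_eq_norm] at hy
    exact mem_eAnnC_of_dist (by linarith [hlow y]) (by linarith [hup y])
  have := hopf (a := b) H.one_lt (by omega) hR0 hxb H.isOpen (hcball.trans H.subset) H.contDiffOn
    (fun y hy => H.pos y (hball hy)) (fun y hy => H.nonneg (hcball hy)) (H.zero_inner x hx)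
    (H.weakDivGe_zero.mono hball)
  rw [hb, show x + (R / r0) • (x - a) - x = (R / r0) • (x - a) by abel, inner_smul_right] at this
  exact pos_of_mul_pos_right this (by positivity)

end IsEigen
end Radial

section LogLemma
variable {N : ℕ}

lemma integral_segments_le {g : Euc N → ℝ} {z x y : Euc N} {r δ : ℝ}
    (hg : ContinuousOn g (closedBall z r)) (hg0 : ∀ ξ ∈ closedBall z r, 0 ≤ g ξ)
    (hx : closedBall x δ ⊆ closedBall z r) (hy : closedBall y δ ⊆ closedBall z r) :
    ∫ ξ in closedBall (0 : Euc N) δ, ∫ t in Icc (0 : ℝ) 1, g (y + ξ + t • (x - y)) ≤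
      ∫ ξ in closedBall z r, g ξ := by
  have hmem : ∀ ξ ∈ closedBall (0 : Euc N) δ, ∀ t ∈ Icc (0 : ℝ) 1,
      y + ξ + t • (x - y) ∈ closedBall z r := by
    intro ξ hξ t ht
    have h1 : x + ξ ∈ closedBall z r := hx (by simpa [dist_eq_norm] using hξ)
    have h2 : y + ξ ∈ closedBall z r := hy (by simpa [dist_eq_norm] using hξ)
    have := (convex_closedBall z r) h2 h1 (sub_nonneg.2 ht.2) ht.1 (by ring)
    convert this using 1
    module
  have hcont : ContinuousOn (Function.uncurry fun ξ t => g (y + ξ + t • (x - y)))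
      (closedBall (0 : Euc N) δ ×ˢ Icc (0 : ℝ) 1) := by
    refine hg.comp (f := fun q : Euc N × ℝ => y + q.1 + q.2 • (x - y)) (by fun_prop) ?_
    rintro ⟨ξ, t⟩ ⟨hξ, ht⟩
    exact hmem ξ hξ t ht
  have hint := hcont.integrableOn_compact (μ := volume)
    ((isCompact_closedBall (0 : Euc N) δ).prod isCompact_Icc)
  rw [IntegrableOn, Measure.volume_eq_prod, ← Measure.prod_restrict] at hint
  rw [integral_integral_swap hint]
  have hgi := hg.integrableOn_compact (μ := volume) (isCompact_closedBall z r)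
  have hinner : ∀ t ∈ Icc (0 : ℝ) 1, ∫ ξ in closedBall (0 : Euc N) δ, g (y + ξ + t • (x - y)) ≤
      ∫ ξ in closedBall z r, g ξ := by
    intro t ht
    set b := y + t • (x - y) with hb
    have h1 : ∫ ξ in closedBall (0 : Euc N) δ, g (y + ξ + t • (x - y)) =
        ∫ ξ in closedBall b δ, g ξ := by
      have hmp := measurePreserving_add_right (volume : Measure (Euc N)) b
      have h2 := hmp.setIntegral_preimage_emb (measurableEmbedding_addRight b) g (closedBall b δ)
      rw [← h2]
      have : (fun ξ => ξ + b) ⁻¹' closedBall b δ = closedBall 0 δ := by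
        ext ξ; simp [dist_eq_norm]
      rw [this]
      refine setIntegral_congr_fun isClosed_closedBall.measurableSet fun ξ _ => ?_
      simp only [hb]; congr 1; abel
    rw [h1]
    refine setIntegral_mono_set hgi ?_ ?_
    · exact (ae_restrict_iff' isClosed_closedBall.measurableSet).2 (.of_forall hg0)
    · refine LE.le.eventuallyLE fun ξ hξ => ?_
      have := hmem (ξ - b) (by simpa [dist_eq_norm] using hξ) t ht
      rwa [hb, show y + (ξ - (y + t • (x - y))) + t • (x - y) = ξ by abel] at this
  calc ∫ t in Icc (0 : ℝ) 1, ∫ ξ in closedBall (0 : Euc N) δ, g (y + ξ + t • (x - y))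
      ≤ ∫ t in Icc (0 : ℝ) 1, ∫ ξ in closedBall z r, g ξ := by
        refine setIntegral_mono_on hint.integral_prod_right (integrableOn_const (by simp))
          measurableSet_Icc hinner
    _ = ∫ ξ in closedBall z r, g ξ := by simp

lemma sub_le_integral_segment {h g : Euc N → ℝ} {B : Set (Euc N)} (hB : IsOpen B)
    (hh : ContDiffOn ℝ 1 h B) (hg : ContinuousOn g B) (hgh : ∀ ξ ∈ B, ‖gradient h ξ‖ ≤ g ξ)
    {x y D : Euc N} (hxy : x = y + D) (hs : ∀ t ∈ Icc (0 : ℝ) 1, y + t • D ∈ B) :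
    h x - h y ≤ ‖D‖ * ∫ t in Icc (0 : ℝ) 1, g (y + t • D) := by
  have hd : ∀ t ∈ uIcc (0 : ℝ) 1,
      HasDerivAt (fun t => h (y + t • D)) ⟪gradient h (y + t • D), D⟫ t := by
    intro t ht
    rw [uIcc_of_le zero_le_one] at ht
    have hγ : HasDerivAt (fun t : ℝ => y + t • D) D t := by
      simpa using ((hasDerivAt_id t).smul_const D).const_add y
    rw [inner_gradient]
    exact (differentiableAt_of_contDiffOn hB hh (hs t ht)).hasFDerivAt.comp_hasDerivAt t hγ
  have hγc : Continuous fun t : ℝ => y + t • D := by fun_prop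
  have hc1 : ContinuousOn (fun t : ℝ => ⟪gradient h (y + t • D), D⟫) (Icc 0 1) :=
    ((continuousOn_gradient hB hh).comp hγc.continuousOn hs).inner continuousOn_const
  have hc2 : ContinuousOn (fun t : ℝ => g (y + t • D)) (Icc 0 1) :=
    hg.comp hγc.continuousOn hs
  have h1 := intervalIntegral.integral_eq_sub_of_hasDerivAt hd
    (by rw [← uIcc_of_le zero_le_one] at hc1; exact hc1.intervalIntegrable)
  simp only [one_smul, zero_smul, add_zero] at h1
  rw [hxy, ← h1, intervalIntegral.integral_of_le zero_le_one, ← integral_Icc_eq_integral_Ioc,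
    ← integral_const_mul]
  refine setIntegral_mono_on (hc1.integrableOn_compact isCompact_Icc)
    ((continuousOn_const.mul hc2).integrableOn_compact isCompact_Icc) measurableSet_Icc
    fun t ht => ?_
  refine (real_inner_le_norm _ _).trans ?_
  rw [mul_comm]
  exact mul_le_mul_of_nonneg_left (hgh _ (hs t ht)) (norm_nonneg _)

/-- Logarithmic energy estimate for nonnegative supersolutions. -/
lemma log_energy_le {z : Euc N} {r R : ℝ} (hr : 0 < r) (hrR : r < R) {c C : ℝ} (hc : 0 < c)
    {w : Euc N → ℝ} {F : Euc N → Euc N} (hw : ContDiffOn ℝ 1 w (ball z R))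
    (hF : ContinuousOn F (ball z R)) (hw0 : ∀ x ∈ ball z R, 0 ≤ w x)
    (hlow : ∀ x ∈ ball z R, c * ‖gradient w x‖ ^ 2 ≤ ⟪F x, gradient w x⟫)
    (hup : ∀ x ∈ ball z R, ‖F x‖ ≤ C * ‖gradient w x‖)
    (H : WeakDivGe (ball z R) F (fun _ => 0)) :
    ∃ K, ∀ ε > 0, ∫ x in closedBall z r, (‖gradient w x‖ / (w x + ε)) ^ 2 ≤ K := by
  obtain ⟨η, hη⟩ : ∃ η : ContDiffBump z, η.rIn = r ∧ η.rOut = (r + R) / 2 :=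
    ⟨⟨r, (r + R) / 2, hr, by linarith⟩, rfl, rfl⟩
  have hηc : ContDiff ℝ 1 η := η.contDiff
  have hηK : IsCompact (closedBall z η.rOut) := isCompact_closedBall _ _
  have hKB : closedBall z η.rOut ⊆ ball z R := closedBall_subset_ball (by rw [hη.2]; linarith)
  have hη0 : ∀ x, x ∉ closedBall z η.rOut → η x = 0 := fun x hx =>
    η.zero_of_le_dist (not_le.1 hx).le
  set K' := (2 * C ^ 2 / c) * ∫ x, ‖gradient η x‖ ^ 2 with hK'
  have hηt : IsC1Test (ball z R) η := by
    refine ⟨hηc, η.hasCompactSupport, ?_⟩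
    rw [η.tsupport_eq]; exact hKB
  have hgη : Integrable fun x => ‖gradient η x‖ ^ 2 := by
    refine integrable_of_continuousOn (U := univ) (K := tsupport η) ?_ hηt.hasCompactSupport
      (subset_univ _) fun x hx => ?_
    · exact ((continuous_gradient hηc).norm.pow 2).continuousOn
    · rw [gradient_eq_zero_of_notMem_tsupport hx]; simp
  refine ⟨2 / c * K', fun ε hε => ?_⟩
  have hwε : ∀ x ∈ ball z R, 0 < w x + ε := fun x hx => by linarith [hw0 x hx]
  set q : Euc N → ℝ := fun x => (η x) ^ 2 * (w x + ε)⁻¹ with hq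
  have hqC : ContDiffOn ℝ 1 q (ball z R) :=
    (hηc.pow 2).contDiffOn.mul ((hw.add contDiffOn_const).inv fun x hx => (hwε x hx).ne')
  have hφ := isC1Test_indicator isOpen_ball hqC hηK hKB
    (fun x _ hx => by simp only [hq]; rw [hη0 x hx]; simp)
  have hφ0 : ∀ x, 0 ≤ (ball z R).indicator q x := fun x =>
    indicator_nonneg (fun x hx => mul_nonneg (sq_nonneg _) (inv_nonneg.2 (hwε x hx).le)) x
  have h1 := H _ hφ hφ0
  simp only [zero_mul, integral_zero] at h1
  set g : Euc N → ℝ := fun x => ‖gradient w x‖ / (w x + ε) with hg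
  have hgc : ContinuousOn g (ball z R) := (continuousOn_gradient isOpen_ball hw).norm.div
    (hw.continuousOn.add continuousOn_const) fun x hx => (hwε x hx).ne'
  have hpt : ∀ x, ⟪F x, gradient ((ball z R).indicator q) x⟫ ≤
      (2 * C ^ 2 / c) * ‖gradient η x‖ ^ 2 - c / 2 * (closedBall z r).indicator (fun x => g x ^ 2) x := by
    intro x
    have hrB : closedBall z r ⊆ ball z R := closedBall_subset_ball hrR
    have hcc : 0 ≤ 2 * C ^ 2 / c := by positivity
    by_cases hx : x ∈ ball z R
    · have dw := differentiableAt_of_contDiffOn isOpen_ball hw hx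
      have dη := hηc.differentiable one_ne_zero x
      have hW := hwε x hx
      have g1 : gradient (fun y => η y ^ 2) x = (2 * η x) • gradient η x := by
        have : HasDerivAt (fun s : ℝ => s ^ 2) (2 * η x) (η x) := by
          simpa using hasDerivAt_pow 2 (η x)
        exact gradient_comp this dη
      have a2 : HasDerivAt (fun s : ℝ => (s + ε)⁻¹) (-1 / (w x + ε) ^ 2) (w x) :=
        ((hasDerivAt_id (w x)).add_const ε).inv hW.ne'
      have g2 : gradient (fun y => (w y + ε)⁻¹) x = (-1 / (w x + ε) ^ 2) • gradient w x :=
        gradient_comp a2 dw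
      have c1 : DifferentiableAt ℝ (fun y => η y ^ 2) x := dη.pow 2
      have c2 : DifferentiableAt ℝ (fun y => (w y + ε)⁻¹) x := a2.differentiableAt.comp x dw
      rw [gradient_indicator isOpen_ball hx, hq, gradient_mul c1 c2, g1, g2]
      simp only [inner_add_right, inner_smul_right]
      have hgx : g x * (w x + ε) = ‖gradient w x‖ := div_mul_cancel₀ _ hW.ne'
      have i1 := hlow x hx
      have i2 : ⟪F x, gradient η x⟫ ≤ C * ‖gradient w x‖ * ‖gradient η x‖ :=
        (real_inner_le_norm _ _).trans (mul_le_mul_of_nonneg_right (hup x hx) (norm_nonneg _))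
      rw [← hgx] at i1 i2
      have hη1 : 0 ≤ η x := η.nonneg
      have j1 : η x ^ 2 * (-1 / (w x + ε) ^ 2 * ⟪F x, gradient w x⟫) ≤ -(c * η x ^ 2 * g x ^ 2) := by
        have : c * g x ^ 2 ≤ ⟪F x, gradient w x⟫ / (w x + ε) ^ 2 := by
          rw [le_div_iff₀ (by positivity)]; linarith
        have := mul_le_mul_of_nonneg_left this (sq_nonneg (η x))
        calc η x ^ 2 * (-1 / (w x + ε) ^ 2 * ⟪F x, gradient w x⟫)
            = -(η x ^ 2 * (⟪F x, gradient w x⟫ / (w x + ε) ^ 2)) := by ring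
          _ ≤ _ := by linarith
      have j2 : (w x + ε)⁻¹ * (2 * η x * ⟪F x, gradient η x⟫) ≤
          2 * η x * (C * g x * ‖gradient η x‖) := by
        have : ⟪F x, gradient η x⟫ / (w x + ε) ≤ C * g x * ‖gradient η x‖ := by
          rw [div_le_iff₀ hW]; linarith
        have := mul_le_mul_of_nonneg_left this (show 0 ≤ 2 * η x by linarith)
        calc (w x + ε)⁻¹ * (2 * η x * ⟪F x, gradient η x⟫)
            = 2 * η x * (⟪F x, gradient η x⟫ / (w x + ε)) := by ring
          _ ≤ _ := this
      have j3 : 2 * η x * (C * g x * ‖gradient η x‖) ≤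
          c / 2 * (η x ^ 2 * g x ^ 2) + 2 * C ^ 2 / c * ‖gradient η x‖ ^ 2 := by
        have : 0 ≤ (c * (η x * g x) - 2 * C * ‖gradient η x‖) ^ 2 / (2 * c) := by positivity
        have e : (c * (η x * g x) - 2 * C * ‖gradient η x‖) ^ 2 / (2 * c) =
          c / 2 * (η x ^ 2 * g x ^ 2) + 2 * C ^ 2 / c * ‖gradient η x‖ ^ 2 -
          2 * η x * (C * g x * ‖gradient η x‖) := by field_simp; ring
        linarith
      have j4 : (closedBall z r).indicator (fun x => g x ^ 2) x ≤ η x ^ 2 * g x ^ 2 := by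
        by_cases hxr : x ∈ closedBall z r
        · rw [indicator_of_mem hxr, η.one_of_mem_closedBall (by rw [hη.1]; exact hxr)]; simp
        · rw [indicator_of_notMem hxr]; positivity
      nlinarith
    · rw [gradient_eq_zero_of_notMem_tsupport fun h => hx (hφ.tsupport_subset h),
        indicator_of_notMem fun h => hx (hrB h)]
      simp only [inner_zero_right, mul_zero, sub_zero]
      positivity
  have hgi : IntegrableOn (fun x => g x ^ 2) (closedBall z r) :=
    ((hgc.mono (closedBall_subset_ball hrR)).pow 2).integrableOn_compact (isCompact_closedBall _ _)
  have hgi' : Integrable ((closedBall z r).indicator fun x => g x ^ 2) :=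
    (integrable_indicator_iff isClosed_closedBall.measurableSet).2 hgi
  have h2 : ∫ x, ⟪F x, gradient ((ball z R).indicator q) x⟫ ≤
      ∫ x, ((2 * C ^ 2 / c) * ‖gradient η x‖ ^ 2 -
        c / 2 * (closedBall z r).indicator (fun x => g x ^ 2) x) :=
    integral_mono (hφ.integrable_inner hF) ((hgη.const_mul _).sub (hgi'.const_mul _)) hpt
  rw [integral_sub (hgη.const_mul _) (hgi'.const_mul _), integral_const_mul, integral_const_mul,
    integral_indicator isClosed_closedBall.measurableSet] at h2
  have h3 : c / 2 * ∫ x in closedBall z r, g x ^ 2 ≤ K' := by linarith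
  calc ∫ x in closedBall z r, g x ^ 2 = 2 / c * (c / 2 * ∫ x in closedBall z r, g x ^ 2) := by
        field_simp
    _ ≤ 2 / c * K' := mul_le_mul_of_nonneg_left h3 (by positivity)

/-- A nonnegative supersolution vanishing on a ball vanishes identically. -/
lemma eq_zero_of_eq_zero_on_ball {z : Euc N} {R c C : ℝ} (hc : 0 < c)
    {w : Euc N → ℝ} {F : Euc N → Euc N} (hw : ContDiffOn ℝ 1 w (ball z R))
    (hF : ContinuousOn F (ball z R)) (hw0 : ∀ x ∈ ball z R, 0 ≤ w x)
    (hlow : ∀ x ∈ ball z R, c * ‖gradient w x‖ ^ 2 ≤ ⟪F x, gradient w x⟫)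
    (hup : ∀ x ∈ ball z R, ‖F x‖ ≤ C * ‖gradient w x‖)
    (H : WeakDivGe (ball z R) F (fun _ => 0)) {y : Euc N} (hy : y ∈ ball z R)
    (hwy : ∀ᶠ x in nhds y, w x = 0) {x : Euc N} (hx : x ∈ ball z R) : w x = 0 := by
  by_contra hne
  have hwx : 0 < w x := lt_of_le_of_ne (hw0 x hx) (Ne.symm hne)
  obtain ⟨r, hr0, hrR, hxr, hyr⟩ : ∃ r, 0 < r ∧ r < R ∧ dist x z < r ∧ dist y z < r := by
    obtain ⟨r, h1, h2⟩ := exists_between (max_lt (mem_ball.1 hx) (mem_ball.1 hy))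
    exact ⟨r, dist_nonneg.trans_lt ((le_max_left _ _).trans_lt h1), h2,
      (le_max_left _ _).trans_lt h1, (le_max_right _ _).trans_lt h1⟩
  have hcx : ContinuousAt w x := hw.continuousOn.continuousAt (isOpen_ball.mem_nhds hx)
  obtain ⟨δ, hδ, hδx, hδy⟩ : ∃ δ > 0, (∀ ξ ∈ closedBall x δ, w x / 2 ≤ w ξ ∧ ξ ∈ closedBall z r) ∧
      (∀ ξ ∈ closedBall y δ, w ξ = 0 ∧ ξ ∈ closedBall z r) := by
    have e1 : ∀ᶠ ξ in nhds x, w x / 2 ≤ w ξ ∧ ξ ∈ closedBall z r := by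
      filter_upwards [hcx.eventually_const_le (half_lt_self hwx),
        isOpen_ball.mem_nhds (mem_ball.2 hxr)] with ξ h1 h2 using ⟨h1, ball_subset_closedBall h2⟩
    have e2 : ∀ᶠ ξ in nhds y, w ξ = 0 ∧ ξ ∈ closedBall z r := by
      filter_upwards [hwy, isOpen_ball.mem_nhds (mem_ball.2 hyr)] with ξ h1 h2
        using ⟨h1, ball_subset_closedBall h2⟩
    obtain ⟨δ1, hδ1, h1⟩ := Metric.nhds_basis_closedBall.eventually_iff.1 e1
    obtain ⟨δ2, hδ2, h2⟩ := Metric.nhds_basis_closedBall.eventually_iff.1 e2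
    exact ⟨min δ1 δ2, lt_min hδ1 hδ2,
      fun ξ hξ => h1 (closedBall_subset_closedBall (min_le_left _ _) hξ),
      fun ξ hξ => h2 (closedBall_subset_closedBall (min_le_right _ _) hξ)⟩
  obtain ⟨K, hK⟩ := log_energy_le hr0 hrR hc hw hF hw0 hlow hup H
  set m := volume.real (closedBall (0 : Euc N) δ) with hm
  have hm0 : 0 < m := by
    refine ENNReal.toReal_pos ?_ (isCompact_closedBall _ _).measure_lt_top.ne
    exact (measure_closedBall_pos volume _ hδ).ne'
  set D := x - y with hD
  set K2 := ‖D‖ * (volume.real (closedBall z r) + K) with hK2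
  -- the logarithmic oscillation is bounded
  have key : ∀ ε > 0, m * Real.log (1 + w x / 2 / ε) ≤ K2 := by
    intro ε hε
    have hrB : closedBall z r ⊆ ball z R := closedBall_subset_ball hrR
    have hwε : ∀ x ∈ ball z R, 0 < w x + ε := fun x hx => by linarith [hw0 x hx]
    set g : Euc N → ℝ := fun x => ‖gradient w x‖ / (w x + ε) with hg
    have hgc : ContinuousOn g (ball z R) := (continuousOn_gradient isOpen_ball hw).norm.div
      (hw.continuousOn.add continuousOn_const) fun x hx => (hwε x hx).ne'
    set h : Euc N → ℝ := fun x => Real.log (w x + ε) with hh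
    have hhC : ContDiffOn ℝ 1 h (ball z R) :=
      (hw.add contDiffOn_const).log fun x hx => (hwε x hx).ne'
    have hgh : ∀ ξ ∈ ball z R, ‖gradient h ξ‖ ≤ g ξ := by
      intro ξ hξ
      have a2 : HasDerivAt (fun s : ℝ => Real.log (s + ε)) (1 / (w ξ + ε)) (w ξ) :=
        ((hasDerivAt_id (w ξ)).add_const ε).log (hwε ξ hξ).ne'
      have : gradient h ξ = (1 / (w ξ + ε)) • gradient w ξ :=
        gradient_comp a2 (differentiableAt_of_contDiffOn isOpen_ball hw hξ)
      rw [this, norm_smul, Real.norm_of_nonneg (one_div_nonneg.2 (hwε ξ hξ).le)]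
      simp only [hg]; exact (by ring : _ = _).le
    have hseg := integral_segments_le (hgc.mono hrB)
      (fun ξ hξ => div_nonneg (norm_nonneg _) (hwε ξ (hrB hξ)).le)
      (fun ξ hξ => (hδx ξ hξ).2) (fun ξ hξ => (hδy ξ hξ).2)
    have hgi := (hgc.mono hrB).integrableOn_compact (μ := volume) (isCompact_closedBall z r)
    have hone : ∀ (b : Euc N) (t d : ℝ), IntegrableOn (fun _ : Euc N => t) (closedBall b d) :=
      fun b t d => integrableOn_const (isCompact_closedBall _ _).measure_lt_top.ne
    have hg2i : IntegrableOn (fun ξ => g ξ ^ 2) (closedBall z r) :=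
      ((hgc.mono hrB).pow 2).integrableOn_compact (isCompact_closedBall _ _)
    have hg2 : ∫ ξ in closedBall z r, g ξ ≤ volume.real (closedBall z r) + K := by
      have h1 : IntegrableOn (fun ξ => 1 + g ξ ^ 2) (closedBall z r) := (hone z 1 r).add hg2i
      have h2 : ∫ ξ in closedBall z r, g ξ ≤ ∫ ξ in closedBall z r, (1 + g ξ ^ 2) :=
        integral_mono hgi h1 fun ξ => by nlinarith [sq_nonneg (g ξ - 1), sq_nonneg (g ξ)]
      rw [integral_add (hone z 1 r) hg2i, setIntegral_const, smul_eq_mul, mul_one] at h2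
      linarith [hK ε hε]
    have hmem : ∀ ξ ∈ closedBall (0 : Euc N) δ, ∀ t ∈ Icc (0 : ℝ) 1,
        y + ξ + t • D ∈ closedBall z r := by
      intro ξ hξ t ht
      have h1 : x + ξ ∈ closedBall z r := (hδx _ (by simpa [dist_eq_norm] using hξ)).2
      have h2 : y + ξ ∈ closedBall z r := (hδy _ (by simpa [dist_eq_norm] using hξ)).2
      have := (convex_closedBall z r) h2 h1 (sub_nonneg.2 ht.2) ht.1 (by ring)
      convert this using 1
      rw [hD]; module
    have hpt : ∀ ξ ∈ closedBall (0 : Euc N) δ, Real.log (1 + w x / 2 / ε) ≤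
        ‖D‖ * ∫ t in Icc (0 : ℝ) 1, g (y + ξ + t • D) := by
      intro ξ hξ
      have hxξ := hδx (x + ξ) (by simpa [dist_eq_norm] using hξ)
      have hyξ := hδy (y + ξ) (by simpa [dist_eq_norm] using hξ)
      refine le_trans ?_ (sub_le_integral_segment isOpen_ball hhC hgc hgh
        (x := x + ξ) (y := y + ξ) (by rw [hD]; abel) fun t ht => hrB (hmem ξ hξ t ht))
      simp only [hh]
      rw [hyξ.1, zero_add, ← Real.log_div (hwε _ (hrB hxξ.2)).ne' hε.ne']
      refine Real.log_le_log (by positivity) ?_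
      rw [add_div, div_self hε.ne', add_comm]
      have := div_le_div_of_nonneg_right hxξ.1 hε.le
      linarith
    have hcontI : IntegrableOn (fun ξ => ‖D‖ * ∫ t in Icc (0 : ℝ) 1, g (y + ξ + t • D))
        (closedBall (0 : Euc N) δ) := by
      have hcont : ContinuousOn (Function.uncurry fun ξ t => g (y + ξ + t • D))
          (closedBall (0 : Euc N) δ ×ˢ Icc (0 : ℝ) 1) := by
        refine hgc.comp (f := fun q : Euc N × ℝ => y + q.1 + q.2 • D) (by fun_prop) ?_
        rintro ⟨ξ, t⟩ ⟨hξ, ht⟩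
        exact hrB (hmem ξ hξ t ht)
      have hint := hcont.integrableOn_compact (μ := volume)
        ((isCompact_closedBall (0 : Euc N) δ).prod isCompact_Icc)
      rw [IntegrableOn, Measure.volume_eq_prod, ← Measure.prod_restrict] at hint
      exact hint.integral_prod_left.const_mul _
    have h5 := setIntegral_mono_on (hone 0 _ δ) hcontI
      isClosed_closedBall.measurableSet hpt
    rw [setIntegral_const, smul_eq_mul, integral_const_mul] at h5
    exact h5.trans (mul_le_mul_of_nonneg_left (hseg.trans hg2) (norm_nonneg _))
  have h6 := key (w x / 2 / Real.exp (K2 / m + 1)) (by positivity)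
  rw [div_div_cancel₀ (by positivity)] at h6
  have h7 : K2 / m + 1 ≤ Real.log (1 + Real.exp (K2 / m + 1)) := by
    rw [Real.le_log_iff_exp_le (by positivity)]; linarith
  have h8 := mul_le_mul_of_nonneg_left h7 hm0.le
  rw [mul_add, mul_div_cancel₀ _ hm0.ne'] at h8
  linarith

end LogLemma

section Layer
variable {N : ℕ}

lemma exists_bound_deriv_smoothTransition :
    ∃ C, 0 ≤ C ∧ ∀ t, |deriv Real.smoothTransition t| ≤ C := by
  have hT : ContDiff ℝ 1 Real.smoothTransition := Real.smoothTransition.contDiff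
  have hc : Continuous (deriv Real.smoothTransition) := hT.continuous_deriv le_rfl
  obtain ⟨C, hC⟩ := isCompact_Icc.exists_bound_of_continuousOn
    (s := Icc (0 : ℝ) 1) hc.continuousOn
  refine ⟨max C 0, le_max_right _ _, fun t => ?_⟩
  rcases lt_or_ge t 0 with ht | ht
  · have : Real.smoothTransition =ᶠ[nhds t] fun _ => 0 := by
      filter_upwards [Iio_mem_nhds ht] with y hy
        using Real.smoothTransition.zero_of_nonpos (mem_Iio.1 hy).le
    rw [this.deriv_eq]; simp
  rcases lt_or_ge 1 t with ht1 | ht1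
  · have : Real.smoothTransition =ᶠ[nhds t] fun _ => 1 := by
      filter_upwards [Ioi_mem_nhds ht1] with y hy
        using Real.smoothTransition.one_of_one_le (mem_Ioi.1 hy).le
    rw [this.deriv_eq]; simp
  · exact (hC t ⟨ht, ht1⟩).trans (le_max_left _ _)

/-- Smooth cutoff equal to `0` for `‖x - a‖ ≤ r + h` and to `1` for `r + 2 * h ≤ ‖x - a‖`. -/
def layerCutoff (a : Euc N) (r h : ℝ) (x : Euc N) : ℝ :=
  Real.smoothTransition ((‖x - a‖ ^ 2 - (r + h) ^ 2) / ((r + 2 * h) ^ 2 - (r + h) ^ 2))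

section
variable {a x : Euc N} {r h : ℝ}

lemma layer_den_pos (hh : 0 < h) : 2 * r * h < (r + 2 * h) ^ 2 - (r + h) ^ 2 := by
  nlinarith

lemma contDiff_layerCutoff : ContDiff ℝ 1 (layerCutoff a r h) := by
  have hT : ContDiff ℝ 1 Real.smoothTransition := Real.smoothTransition.contDiff
  refine hT.comp (ContDiff.div_const (ContDiff.sub ?_ contDiff_const) _)
  exact (contDiff_id.sub contDiff_const).norm_sq ℝ

lemma layerCutoff_of_le (hr : 0 < r) (hh : 0 < h) (hx : ‖x - a‖ ≤ r + h) :
    layerCutoff a r h x = 0 := by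
  refine Real.smoothTransition.zero_of_nonpos (div_nonpos_of_nonpos_of_nonneg ?_ ?_)
  · have := pow_le_pow_left₀ (norm_nonneg _) hx 2; linarith
  · have := layer_den_pos (r := r) hh; nlinarith [mul_pos hr hh]

lemma layerCutoff_of_ge (hr : 0 < r) (hh : 0 < h) (hx : r + 2 * h ≤ ‖x - a‖) :
    layerCutoff a r h x = 1 := by
  have := layer_den_pos (r := r) hh
  refine Real.smoothTransition.one_of_one_le ((one_le_div (by nlinarith [mul_pos hr hh])).2 ?_)
  have := pow_le_pow_left₀ (by linarith) hx 2; linarith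

lemma gradient_layerCutoff : gradient (layerCutoff a r h) x =
    (deriv Real.smoothTransition ((‖x - a‖ ^ 2 - (r + h) ^ 2) / ((r + 2 * h) ^ 2 - (r + h) ^ 2)) *
      (2 / ((r + 2 * h) ^ 2 - (r + h) ^ 2))) • (x - a) := by
  have hT : ContDiff ℝ 1 Real.smoothTransition := Real.smoothTransition.contDiff
  set D := (r + 2 * h) ^ 2 - (r + h) ^ 2
  have h1 : HasFDerivAt (fun y : Euc N => (‖y - a‖ ^ 2 - (r + h) ^ 2) / D)
      (innerSL ℝ ((2 / D) • (x - a))) x := by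
    have h0 := ((((hasFDerivAt_id x).sub_const a).norm_sq).sub_const ((r + h) ^ 2)).mul_const D⁻¹
    simp only [div_eq_mul_inv]
    refine h0.congr_fderiv ?_
    ext v
    simp
    ring
  have h2 := gradient_comp ((hT.differentiable one_ne_zero _).hasDerivAt
    (x := (‖x - a‖ ^ 2 - (r + h) ^ 2) / D)) h1.differentiableAt
  rw [gradient_of_hasFDerivAt h1, smul_smul] at h2
  exact h2

lemma gradient_layerCutoff_eq_zero (hr : 0 < r) (hh : 0 < h)
    (hx : ‖x - a‖ < r + h ∨ r + 2 * h < ‖x - a‖) : gradient (layerCutoff a r h) x = 0 := by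
  have hc : Continuous fun y : Euc N => ‖y - a‖ := by fun_prop
  rw [gradient_eq_zero_iff]
  rcases hx with hx | hx
  · have : layerCutoff a r h =ᶠ[nhds x] fun _ => 0 := by
      filter_upwards [hc.continuousAt.eventually_lt continuousAt_const hx] with y hy
        using layerCutoff_of_le hr hh hy.le
    rw [this.fderiv_eq]; simp
  · have : layerCutoff a r h =ᶠ[nhds x] fun _ => 1 := by
      filter_upwards [continuousAt_const.eventually_lt hc.continuousAt hx] with y hy
        using layerCutoff_of_ge hr hh hy.le
    rw [this.fderiv_eq]; simp

lemma norm_gradient_layerCutoff_le {C : ℝ} (hC : ∀ t, |deriv Real.smoothTransition t| ≤ C)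
    (hr : 0 < r) (hh : 0 < h) (hh1 : h ≤ 1) :
    ‖gradient (layerCutoff a r h) x‖ ≤ C * (r + 2) / (r * h) := by
  have hC0 : 0 ≤ C := (abs_nonneg _).trans (hC 0)
  by_cases hx : ‖x - a‖ < r + h ∨ r + 2 * h < ‖x - a‖
  · rw [gradient_layerCutoff_eq_zero hr hh hx, norm_zero]; positivity
  · push Not at hx
    have hD := layer_den_pos (r := r) hh
    have hrh := mul_pos hr hh
    rw [gradient_layerCutoff, norm_smul, Real.norm_eq_abs, abs_mul,
      abs_of_pos (a := 2 / _) (div_pos two_pos (by linarith))]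
    have h1 : 2 / ((r + 2 * h) ^ 2 - (r + h) ^ 2) ≤ 1 / (r * h) := by
      rw [div_le_div_iff₀ (by linarith) hrh]; linarith
    have h2 : ‖x - a‖ ≤ r + 2 := by linarith [hx.2]
    calc _ ≤ C * (1 / (r * h)) * (r + 2) := by
          have := hC ((‖x - a‖ ^ 2 - (r + h) ^ 2) / ((r + 2 * h) ^ 2 - (r + h) ^ 2))
          have h3 : 0 ≤ 2 / ((r + 2 * h) ^ 2 - (r + h) ^ 2) := div_nonneg two_pos.le (by linarith)
          gcongr
      _ = _ := by ring

lemma volume_layer_le (hr : 0 < r) (hh : 0 < h) (hh1 : h ≤ 1) :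
    volume.real (closedBall a (r + 2 * h) \ ball a (r + h)) ≤
      h * (N * (r + 2) ^ (N - 1) * volume.real (ball (0 : Euc N) 1)) := by
  have hfin : volume (ball a (r + h)) ≠ ⊤ := measure_ball_lt_top.ne
  have h0 : ∀ t, 0 ≤ t → volume.real (closedBall a t) = t ^ N * volume.real (ball (0 : Euc N) 1) := by
    intro t ht
    rw [Measure.real, Measure.addHaar_closedBall _ _ ht, ENNReal.toReal_mul,
      ENNReal.toReal_ofReal (by positivity), finrank_euclideanSpace_fin]; rfl
  have h1 : volume.real (ball a (r + h)) = (r + h) ^ N * volume.real (ball (0 : Euc N) 1) := by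
    rw [Measure.real, Measure.addHaar_ball_of_pos _ _ (by positivity), ENNReal.toReal_mul,
      ENNReal.toReal_ofReal (by positivity), finrank_euclideanSpace_fin]; rfl
  rw [measureReal_sdiff (ball_subset_closedBall.trans (closedBall_subset_closedBall (by linarith)))
    isOpen_ball.measurableSet measure_closedBall_lt_top.ne, h0 _ (by positivity), h1, ← sub_mul]
  have h2 := abs_pow_sub_pow_le (r + 2 * h) (r + h) N
  have h3 : (r + 2 * h) ^ N - (r + h) ^ N ≤ h * (N * (r + 2) ^ (N - 1)) := by
    refine (le_abs_self _).trans (h2.trans ?_)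
    rw [abs_of_pos (by linarith : 0 < r + 2 * h - (r + h)), abs_of_pos (by linarith : 0 < r + 2 * h),
      abs_of_pos (by linarith : 0 < r + h), max_eq_left (by linarith)]
    rw [show r + 2 * h - (r + h) = h by ring, mul_assoc]
    gcongr
    linarith
  calc _ ≤ h * (N * (r + 2) ^ (N - 1)) * volume.real (ball (0 : Euc N) 1) :=
        mul_le_mul_of_nonneg_right h3 measureReal_nonneg
    _ = _ := by ring

end

/-- A field vanishing inside a ball, which is a supersolution outside, is a supersolution. -/
lemma weakDivGe_of_eq_zero_inside {U : Set (Euc N)} {a : Euc N} {r : ℝ} (hr : 0 < r)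
    {F : Euc N → Euc N} (hF : ContinuousOn F U) (hF0 : ∀ x ∈ U, ‖x - a‖ ≤ r → F x = 0)
    (H : WeakDivGe (U ∩ {x | r < ‖x - a‖}) F (fun _ => 0)) : WeakDivGe U F (fun _ => 0) := by
  intro φ hφ hφ0
  simp only [zero_mul, integral_zero]
  obtain ⟨C, hC0, hC⟩ := exists_bound_deriv_smoothTransition
  have hK : IsCompact (tsupport φ) := hφ.hasCompactSupport
  have hKU := hφ.tsupport_subset
  obtain ⟨M, hM⟩ := hK.exists_bound_of_continuousOn hφ.contDiff.continuous.continuousOn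
  have hM0 : ∀ x, φ x ≤ max M 0 := by
    intro x
    by_cases hx : x ∈ tsupport φ
    · exact ((Real.norm_of_nonneg (hφ0 x)).symm.le.trans (hM x hx)).trans (le_max_left _ _)
    · rw [image_eq_zero_of_notMem_tsupport hx]; exact le_max_right _ _
  set M' := max M 0 with hM'
  have hM'0 : 0 ≤ M' := le_max_right _ _
  have hint := hφ.integrable_inner hF
  have hcF : ∀ h x, 0 ≤ layerCutoff a r h x := fun h x => Real.smoothTransition.nonneg _
  have htest : ∀ h, 0 < h → IsC1Test (U ∩ {x | r < ‖x - a‖}) fun x => φ x * layerCutoff a r h x := by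
    intro h hh
    refine ⟨hφ.contDiff.mul contDiff_layerCutoff, hφ.hasCompactSupport.mul_right, ?_⟩
    intro x hx
    refine ⟨hKU (tsupport_mul_subset_left hx), ?_⟩
    have hcl : IsClosed {x : Euc N | r + h ≤ ‖x - a‖} :=
      isClosed_le continuous_const (by fun_prop)
    have : tsupport (fun x => φ x * layerCutoff a r h x) ⊆ {x | r + h ≤ ‖x - a‖} := by
      refine closure_minimal (fun y hy => ?_) hcl
      by_contra hlt
      refine hy ?_
      have : ‖y - a‖ ≤ r + h := (not_le.1 hlt).le
      simp only
      rw [layerCutoff_of_le hr hh this, mul_zero]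
    have h2 : r + h ≤ ‖x - a‖ := this hx
    exact lt_of_lt_of_le (by linarith) h2
  have hgr : ∀ h x, gradient (fun x => φ x * layerCutoff a r h x) x =
      φ x • gradient (layerCutoff a r h) x + layerCutoff a r h x • gradient φ x := fun h x =>
    gradient_mul (hφ.contDiff.differentiable one_ne_zero x)
      (contDiff_layerCutoff.differentiable one_ne_zero x)
  -- the smallness of `F` near the sphere
  have hsmall : ∀ ε > 0, ∃ h0 > 0, ∀ x ∈ tsupport φ, ‖x - a‖ ≤ r + h0 → ‖F x‖ ≤ ε := by
    intro ε hε
    set K' := tsupport φ ∩ {x | ε ≤ ‖F x‖} with hK'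
    have hcl : IsClosed K' := by
      have := (hF.mono hKU).norm.preimage_isClosed_of_isClosed (isClosed_tsupport φ) isClosed_Ici
        (t := Ici ε)
      exact this
    have hK'c : IsCompact K' := hK.of_isClosed_subset hcl inter_subset_left
    have hc : Continuous fun x : Euc N => ‖x - a‖ - r := by fun_prop
    obtain ⟨h0, hh0, hb⟩ : ∃ h0 > 0, ∀ x ∈ K', h0 < ‖x - a‖ - r := by
      have hpos : ∀ x ∈ K', 0 < ‖x - a‖ - r := by
        intro x hx
        by_contra hlt
        have h1 : ‖x - a‖ ≤ r := by linarith [not_lt.1 hlt]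
        have h2 : ε ≤ ‖F x‖ := hx.2
        rw [hF0 x (hKU hx.1) h1, norm_zero] at h2
        linarith
      rcases K'.eq_empty_or_nonempty with he | hne
      · exact ⟨1, one_pos, by simp [he]⟩
      · obtain ⟨x0, hx0, hmin⟩ := hK'c.exists_isMinOn hne hc.continuousOn
        have := hpos x0 hx0
        exact ⟨(‖x0 - a‖ - r) / 2, by linarith, fun x hx => by
          have : ‖x0 - a‖ - r ≤ ‖x - a‖ - r := hmin hx
          linarith⟩
    refine ⟨h0, hh0, fun x hx hxr => ?_⟩
    by_contra hlt
    have := hb x ⟨hx, (not_le.1 hlt).le⟩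
    linarith
  set V := (N * (r + 2) ^ (N - 1) * volume.real (ball (0 : Euc N) 1)) with hV
  have hV0 : 0 ≤ V := by positivity
  have herr : ∀ ε > 0, ∃ h0 > 0, ∀ h, 0 < h → h ≤ h0 →
      -(ε * (M' * (C * (r + 2) / r) * V)) ≤ ∫ x, layerCutoff a r h x * ⟪F x, gradient φ x⟫ := by
    intro ε hε
    obtain ⟨h0, hh0, hb⟩ := hsmall ε hε
    refine ⟨min (h0 / 2) 1, by positivity, fun h hh hle => ?_⟩
    have hh1 : h ≤ 1 := hle.trans (min_le_right _ _)
    have hh2 : 2 * h ≤ h0 := by linarith [hle.trans (min_le_left _ _)]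
    have h1 := H _ (htest h hh) fun x => mul_nonneg (hφ0 x) (hcF h x)
    simp only [zero_mul, integral_zero, hgr, inner_add_right, inner_smul_right] at h1
    have i1 : Integrable fun x => φ x * ⟪F x, gradient (layerCutoff a r h) x⟫ := by
      refine integrable_of_continuousOn (U := U) ?_ hK hKU fun x hx => ?_
      · exact hφ.contDiff.continuous.continuousOn.mul
          (hF.inner (continuous_gradient contDiff_layerCutoff).continuousOn)
      · rw [image_eq_zero_of_notMem_tsupport hx, zero_mul]
    have i2 : Integrable fun x => layerCutoff a r h x * ⟪F x, gradient φ x⟫ := by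
      refine integrable_of_continuousOn (U := U) ?_ hK hKU fun x hx => ?_
      · exact contDiff_layerCutoff.continuous.continuousOn.mul
          (hF.inner (continuous_gradient hφ.contDiff).continuousOn)
      · rw [gradient_eq_zero_of_notMem_tsupport hx, inner_zero_right, mul_zero]
    rw [integral_add i1 i2] at h1
    set L := closedBall a (r + 2 * h) \ ball a (r + h) with hL
    have hLm : MeasurableSet L := isClosed_closedBall.measurableSet.diff isOpen_ball.measurableSet
    have hLfin : volume L ≠ ⊤ :=
      ((measure_mono sdiff_subset).trans_lt measure_closedBall_lt_top).ne
    set B := M' * (ε * (C * (r + 2) / (r * h))) with hB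
    have hB0 : 0 ≤ B := by positivity
    have hpt : ∀ x, φ x * ⟪F x, gradient (layerCutoff a r h) x⟫ ≤ L.indicator (fun _ => B) x := by
      intro x
      by_cases hx : ‖x - a‖ < r + h ∨ r + 2 * h < ‖x - a‖
      · rw [gradient_layerCutoff_eq_zero hr hh hx, inner_zero_right, mul_zero]
        exact indicator_nonneg (fun _ _ => hB0) x
      · push Not at hx
        have hxL : x ∈ L := ⟨by simpa [dist_eq_norm] using hx.2, by simpa [dist_eq_norm] using hx.1⟩
        rw [indicator_of_mem hxL]
        by_cases hxs : x ∈ tsupport φ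
        · have a1 := hb x hxs (by linarith [hx.2])
          have a2 := norm_gradient_layerCutoff_le (a := a) (x := x) hC hr hh hh1
          have a3 := (real_inner_le_norm (F x) (gradient (layerCutoff a r h) x)).trans
            (mul_le_mul a1 a2 (norm_nonneg _) hε.le)
          exact (mul_le_mul_of_nonneg_left a3 (hφ0 x)).trans
            (mul_le_mul_of_nonneg_right (hM0 x) (by positivity))
        · rw [image_eq_zero_of_notMem_tsupport hxs, zero_mul]; exact hB0
    have i3 : Integrable (L.indicator fun _ => B) :=
      (integrable_indicator_iff hLm).2 (integrableOn_const hLfin)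
    have h2 := integral_mono i1 i3 hpt
    rw [integral_indicator hLm, setIntegral_const, smul_eq_mul] at h2
    have h3 := mul_le_mul_of_nonneg_right (volume_layer_le (a := a) hr hh hh1) hB0
    have h4 : h * V * B = ε * (M' * (C * (r + 2) / r) * V) := by
      rw [hB]; field_simp
    linarith
  have hlim : Filter.Tendsto (fun n : ℕ => ∫ x, layerCutoff a r (1 / ((n : ℝ) + 1)) x *
      ⟪F x, gradient φ x⟫) Filter.atTop (nhds (∫ x, ⟪F x, gradient φ x⟫)) := by
    refine tendsto_integral_of_dominated_convergence (fun x => ‖⟪F x, gradient φ x⟫‖) ?_ hint.norm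
      ?_ ?_
    · exact fun n => contDiff_layerCutoff.continuous.aestronglyMeasurable.mul hint.1
    · refine fun n => .of_forall fun x => ?_
      rw [norm_mul, Real.norm_of_nonneg (hcF _ x)]
      exact mul_le_of_le_one_left (norm_nonneg _) (Real.smoothTransition.le_one _)
    · refine .of_forall fun x => ?_
      by_cases hx : r < ‖x - a‖
      · refine tendsto_const_nhds.congr' ?_
        have hev := (tendsto_one_div_add_atTop_nhds_zero_nat (𝕜 := ℝ)).eventually_lt_const
          (show 0 < (‖x - a‖ - r) / 2 by linarith)
        filter_upwards [hev] with n hn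
        rw [layerCutoff_of_ge hr (by positivity) (by linarith), one_mul]
      · have : ⟪F x, gradient φ x⟫ = 0 := by
          by_cases hxU : x ∈ U
          · rw [hF0 x hxU (not_lt.1 hx), inner_zero_left]
          · rw [gradient_eq_zero_of_notMem_tsupport fun h => hxU (hKU h), inner_zero_right]
        simp [this]
  by_contra hneg
  set I := ∫ x, ⟪F x, gradient φ x⟫ with hI
  have hneg' : I < 0 := not_le.1 hneg
  set Q := M' * (C * (r + 2) / r) * V with hQ
  have hQ0 : 0 ≤ Q := by positivity
  obtain ⟨h0, hh0, hb⟩ := herr (-I / 2 / (Q + 1)) (by apply div_pos <;> linarith)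
  have hev := (tendsto_one_div_add_atTop_nhds_zero_nat (𝕜 := ℝ)).eventually_le_const hh0
  have h1 : -(-I / 2 / (Q + 1) * Q) ≤ I := ge_of_tendsto hlim (by
    filter_upwards [hev] with n hn using hb _ (by positivity) hn)
  have h2 : -I / 2 / (Q + 1) * Q ≤ -I / 2 := by
    rw [div_mul_eq_mul_div, div_le_iff₀ (by linarith)]
    nlinarith
  linarith

end Layer

section LocalUniqueness
variable {N : ℕ}

lemma continuousOn_indicator_of_frontier {E : Type*} [NormedAddCommGroup E] {U S : Set (Euc N)}
    {f : Euc N → E} (hf : ContinuousOn f U) (h0 : ∀ x ∈ U, x ∈ frontier S → f x = 0) :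
    ContinuousOn (S.indicator f) U := by
  intro x hx
  by_cases hxf : x ∈ frontier S
  · have h1 := hf x hx
    rw [ContinuousWithinAt, h0 x hx hxf] at h1
    have h2 : S.indicator f x = 0 := by
      by_cases hxS : x ∈ S
      · rw [indicator_of_mem hxS, h0 x hx hxf]
      · exact indicator_of_notMem hxS f
    rw [ContinuousWithinAt, h2]
    refine squeeze_zero_norm (fun y => ?_) (tendsto_zero_iff_norm_tendsto_zero.1 h1)
    exact norm_indicator_le_norm_self f y
  · have hcases : x ∈ interior S ∨ x ∈ interior Sᶜ := by
      by_cases hxS : x ∈ closure S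
      · left; by_contra h; exact hxf ⟨hxS, h⟩
      · right; rwa [interior_compl]
    rcases hcases with h | h
    · refine (hf x hx).congr_of_eventuallyEq ?_ (indicator_of_mem (interior_subset h) f)
      filter_upwards [mem_nhdsWithin_of_mem_nhds (isOpen_interior.mem_nhds h)] with y hy
        using indicator_of_mem (interior_subset hy) f
    · refine continuousWithinAt_const (b := (0 : E)) |>.congr_of_eventuallyEq ?_
        (indicator_of_notMem (interior_subset h) f)
      filter_upwards [mem_nhdsWithin_of_mem_nhds (isOpen_interior.mem_nhds h)] with y hy
        using indicator_of_notMem (interior_subset hy) f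

lemma hasFDerivAt_indicator {U S : Set (Euc N)} (hU : IsOpen U)
    {f : Euc N → ℝ} (hf : ContDiffOn ℝ 1 f U)
    (h0 : ∀ x ∈ U, x ∈ frontier S → f x = 0 ∧ gradient f x = 0) {x : Euc N} (hx : x ∈ U) :
    HasFDerivAt (S.indicator f) (S.indicator (fderiv ℝ f) x) x := by
  have hd := (differentiableAt_of_contDiffOn hU hf hx).hasFDerivAt
  by_cases hxf : x ∈ frontier S
  · obtain ⟨h1, h2⟩ := h0 x hx hxf
    have h3 : fderiv ℝ f x = 0 := gradient_eq_zero_iff.1 h2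
    have h4 : S.indicator (fderiv ℝ f) x = 0 := by
      by_cases hxS : x ∈ S
      · rw [indicator_of_mem hxS, h3]
      · exact indicator_of_notMem hxS _
    have h5 : S.indicator f x = 0 := by
      by_cases hxS : x ∈ S
      · rw [indicator_of_mem hxS, h1]
      · exact indicator_of_notMem hxS _
    rw [h4]
    rw [h3] at hd
    refine .of_isLittleO (.trans_isBigO ?_ (Asymptotics.isBigO_refl _ _))
    have h6 := hd.isLittleO
    simp only [h1, h5, sub_zero, zero_apply] at h6 ⊢
    exact (Asymptotics.IsBigO.of_bound 1 (.of_forall fun y => by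
      rw [one_mul]; exact norm_indicator_le_norm_self f y)).trans_isLittleO h6
  · have hcases : x ∈ interior S ∨ x ∈ interior Sᶜ := by
      by_cases hxS : x ∈ closure S
      · left; by_contra h; exact hxf ⟨hxS, h⟩
      · right; rwa [interior_compl]
    rcases hcases with h | h
    · rw [indicator_of_mem (interior_subset h)]
      refine hd.congr_of_eventuallyEq ?_
      filter_upwards [isOpen_interior.mem_nhds h] with y hy
        using indicator_of_mem (interior_subset hy) f
    · rw [indicator_of_notMem (interior_subset h)]
      refine (hasFDerivAt_const (0 : ℝ) x).congr_of_eventuallyEq ?_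
      filter_upwards [isOpen_interior.mem_nhds h] with y hy
        using indicator_of_notMem (interior_subset hy) f

lemma contDiffOn_indicator {U S : Set (Euc N)} (hU : IsOpen U)
    {f : Euc N → ℝ} (hf : ContDiffOn ℝ 1 f U)
    (h0 : ∀ x ∈ U, x ∈ frontier S → f x = 0 ∧ gradient f x = 0) :
    ContDiffOn ℝ 1 (S.indicator f) U := by
  refine (contDiffOn_succ_iff_fderiv_of_isOpen (n := 0) hU).2 ⟨fun x hx =>
    (hasFDerivAt_indicator hU hf h0 hx).differentiableAt.differentiableWithinAt, by simp,
    contDiffOn_zero.2 ?_⟩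
  refine (continuousOn_indicator_of_frontier (S := S) (hf.continuousOn_fderiv_of_isOpen hU le_rfl)
    fun x hx hxf => gradient_eq_zero_iff.1 (h0 x hx hxf).2).congr fun x hx => ?_
  exact (hasFDerivAt_indicator hU hf h0 hx).fderiv

/-- Local strong comparison near a point where both gradients agree and do not vanish. -/
lemma exists_ball_eq_of_eq {p : ℝ} {S : Set (Euc N)} {u v : Euc N → ℝ}
    {z : Euc N} {R : ℝ} (hR : 0 < R)
    (hu : ContDiffOn ℝ 1 u (ball z R)) (hv : ContDiffOn ℝ 1 v (ball z R))
    (hle : ∀ x ∈ ball z R, x ∈ S → u x ≤ v x)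
    (hfr : ∀ x ∈ ball z R, x ∈ frontier S → u x = v x ∧ gradient u x = gradient v x)
    (hz : gradient u z = gradient v z) (hz0 : gradient u z ≠ 0)
    (H : WeakDivGe (ball z R)
      (S.indicator fun x => pFlux p (gradient v x) - pFlux p (gradient u x)) fun _ => 0)
    (hp : 1 < p) :
    ∃ r > 0, r ≤ R ∧ ∀ y ∈ ball z r, (∀ᶠ x in nhds y, x ∈ S → u x = v x) →
      ∀ x ∈ ball z r, x ∈ S → u x = v x := by
  obtain ⟨δ, hδ, c, hc, C, hC, hloc⟩ := pFlux_local_bounds hp hz0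
  have hgu := continuousOn_gradient isOpen_ball hu
  have hgv := continuousOn_gradient isOpen_ball hv
  have e1 : ∀ᶠ x in nhds z, gradient u x ∈ ball (gradient u z) δ :=
    (hgu.continuousAt (ball_mem_nhds z hR)).eventually (ball_mem_nhds _ hδ)
  have e2 : ∀ᶠ x in nhds z, gradient v x ∈ ball (gradient u z) δ := by
    rw [hz]
    exact (hgv.continuousAt (ball_mem_nhds z hR)).eventually (ball_mem_nhds _ hδ)
  obtain ⟨r1, hr1, hb⟩ := Metric.eventually_nhds_iff_ball.1 (e1.and e2)
  have hrR : ball z (min r1 R) ⊆ ball z R := ball_subset_ball (min_le_right _ _)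
  refine ⟨min r1 R, lt_min hr1 hR, min_le_right _ _, fun y hy hyS x hx hxS => ?_⟩
  set w := S.indicator fun x => v x - u x with hw
  have hwf : ∀ x ∈ ball z (min r1 R), x ∈ frontier S →
      v x - u x = 0 ∧ gradient (fun x => v x - u x) x = 0 := by
    intro x hx hxf
    obtain ⟨h1, h2⟩ := hfr x (hrR hx) hxf
    refine ⟨by rw [h1, sub_self], ?_⟩
    rw [gradient_sub (differentiableAt_of_contDiffOn isOpen_ball hv (hrR hx))
      (differentiableAt_of_contDiffOn isOpen_ball hu (hrR hx)), h2, sub_self]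
  have hsub : ContDiffOn ℝ 1 (fun x => v x - u x) (ball z (min r1 R)) :=
    (hv.mono hrR).sub (hu.mono hrR)
  have hwC : ContDiffOn ℝ 1 w (ball z (min r1 R)) := contDiffOn_indicator isOpen_ball hsub hwf
  have hgw : ∀ x ∈ ball z (min r1 R),
      gradient w x = S.indicator (fun x => gradient v x - gradient u x) x := by
    intro x hx
    have h1 := (hasFDerivAt_indicator (S := S) isOpen_ball hsub hwf hx).fderiv
    have h2 := gradient_sub (differentiableAt_of_contDiffOn isOpen_ball hv (hrR hx))
      (differentiableAt_of_contDiffOn isOpen_ball hu (hrR hx))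
    by_cases hxS : x ∈ S
    · rw [indicator_of_mem hxS] at h1 ⊢
      rw [← h2, gradient, gradient, ← h1]
    · rw [indicator_of_notMem hxS] at h1 ⊢
      exact gradient_eq_zero_iff.2 h1
  have hFc : ContinuousOn (S.indicator fun x => pFlux p (gradient v x) - pFlux p (gradient u x))
      (ball z (min r1 R)) := by
    refine continuousOn_indicator_of_frontier ?_ fun x hx hxf => ?_
    · exact ((continuous_pFlux hp).comp_continuousOn (hgv.mono hrR)).sub
        ((continuous_pFlux hp).comp_continuousOn (hgu.mono hrR))
    · rw [(hfr x (hrR hx) hxf).2, sub_self]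
  have hw0 : ∀ x ∈ ball z (min r1 R), 0 ≤ w x := by
    intro x hx
    by_cases hxS : x ∈ S
    · rw [hw, indicator_of_mem hxS]; exact sub_nonneg.2 (hle x (hrR hx) hxS)
    · rw [hw, indicator_of_notMem hxS]
  have hbr : ∀ x ∈ ball z (min r1 R), x ∈ ball z r1 := fun x hx =>
    ball_subset_ball (min_le_left _ _) hx
  have hres := eq_zero_of_eq_zero_on_ball (C := C) hc hwC hFc hw0 ?_ ?_ (H.mono hrR) hy ?_ hx
  · rw [hw, indicator_of_mem hxS] at hres
    linarith
  · intro x hx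
    obtain ⟨a1, a2⟩ := hb x (hbr x hx)
    rw [hgw x hx]
    by_cases hxS : x ∈ S
    · rw [indicator_of_mem hxS, indicator_of_mem hxS]; exact (hloc _ a2 _ a1).1
    · rw [indicator_of_notMem hxS, indicator_of_notMem hxS]; simp
  · intro x hx
    obtain ⟨a1, a2⟩ := hb x (hbr x hx)
    rw [hgw x hx]
    by_cases hxS : x ∈ S
    · rw [indicator_of_mem hxS, indicator_of_mem hxS]; exact (hloc _ a2 _ a1).2
    · rw [indicator_of_notMem hxS, indicator_of_notMem hxS]; simp
  · filter_upwards [hyS] with x hx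
    by_cases hxS : x ∈ S
    · rw [hw, indicator_of_mem hxS, hx hxS, sub_self]
    · rw [hw, indicator_of_notMem hxS]

end LocalUniqueness

section Rigidity
variable {N : ℕ}

lemma WeakDivGe.congr {U : Set (Euc N)} {F F' : Euc N → Euc N} {h : Euc N → ℝ}
    (H : WeakDivGe U F h) (hF : ∀ x ∈ U, F x = F' x) : WeakDivGe U F' h := by
  intro φ hφ hφ0
  convert H φ hφ hφ0 using 3 with x
  by_cases hx : x ∈ U
  · rw [hF x hx]
  · rw [gradient_eq_zero_of_notMem_tsupport fun h => hx (hφ.tsupport_subset h), inner_zero_right,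
      inner_zero_right]

lemma exists_unit_inner_eq (hN : 2 ≤ N) {e : Euc N} (he : ‖e‖ = 1) {q : ℝ} (hq : q ^ 2 ≤ 1) :
    ∃ d : Euc N, ‖d‖ = 1 ∧ ⟪e, d⟫ = q := by
  obtain ⟨f, hf0, hef, -⟩ := IsEigen.exists_orthogonal hN e 0
  have hf : 0 < ‖f‖ := norm_pos_iff.2 hf0
  set k := Real.sqrt (1 - q ^ 2) / ‖f‖ with hk
  refine ⟨q • e + k • f, ?_, ?_⟩
  · have h1 : ‖q • e + k • f‖ ^ 2 = 1 := by
      rw [norm_add_sq_real, norm_smul, norm_smul, he, inner_smul_left, inner_smul_right, hef,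
        mul_one, Real.norm_eq_abs, sq_abs, mul_pow, Real.norm_eq_abs, sq_abs, hk, div_pow,
        Real.sq_sqrt (by linarith)]
      field_simp
      ring
    exact (pow_eq_one_iff_of_nonneg (norm_nonneg _) two_ne_zero).1 h1
  · rw [inner_add_right, inner_smul_right, inner_smul_right, hef, real_inner_self_eq_norm_sq, he]
    ring

namespace IsEigen

variable {p lam r0 r1 : ℝ} {a : Euc N} {W : Set (Euc N)} {u : Euc N → ℝ}

lemma weakDivGe_sub (H : IsEigen p lam r0 r1 a W u) (hN : 2 ≤ N) {ν : Euc N} (hν : ‖ν‖ = 1)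
    {c : ℝ} (hc : 0 < c) (hca : c ≤ ⟪ν, a⟫) :
    WeakDivGe (eAnn r0 r1 a ∩ {y | c < ⟪ν, y⟫}) (fun x =>
      pFlux p (gradient (fun y => u (affRefl ν c y)) x) - pFlux p (gradient u x)) fun _ => 0 := by
  set G : Set (Euc N) := eAnn r0 r1 a ∩ {y | c < ⟪ν, y⟫} with hG
  set v : Euc N → ℝ := fun y => u (affRefl ν c y) with hv
  have hGo : IsOpen G := (isOpen_eAnn r0 r1 a).inter
    (isOpen_lt continuous_const (continuous_const.inner continuous_id))
  have hσG : ∀ y ∈ G, affRefl ν c y ∈ eAnn r0 r1 a := fun y hy =>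
    affRefl_mem' hν hc hca (mem_eAnn.1 hy.1).1.le (mem_eAnn.1 hy.1).2 hy.2
  have hv1 : ContDiffOn ℝ 1 v G := H.contDiffOn.comp
    (contDiff_affRefl ν c).contDiffOn fun y hy => H.subset (eAnn_subset _ _ _ (hσG y hy))
  have hu1 : ContDiffOn ℝ 1 u G := H.contDiffOn.mono fun y hy =>
    H.subset (eAnn_subset _ _ _ hy.1)
  have Hu := H.eq.mono (inter_subset_left : G ⊆ eAnn r0 r1 a)
  have Hv : WeakDivEq G (fun y => pFlux p (gradient v y)) (fun y => lam * v y ^ (p - 1)) :=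
    (H.eq.comp_isometry (isOpen_eAnn r0 r1 a)
      (H.contDiffOn.mono ((eAnn_subset r0 r1 a).trans H.subset)) (linRefl ν) ((2 * c) • ν)).mono hσG
  intro φ hφ hφ0
  have cu : ContinuousOn (fun x => pFlux p (gradient u x)) G :=
    (continuous_pFlux H.one_lt).comp_continuousOn (continuousOn_gradient hGo hu1)
  have cv : ContinuousOn (fun x => pFlux p (gradient v x)) G :=
    (continuous_pFlux H.one_lt).comp_continuousOn (continuousOn_gradient hGo hv1)
  have hp1 : 0 ≤ p - 1 := by linarith [H.one_lt]
  have du : ContinuousOn (fun x => lam * u x ^ (p - 1)) G :=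
    continuousOn_const.mul (hu1.continuousOn.rpow_const fun _ _ => Or.inr hp1)
  have dv : ContinuousOn (fun x => lam * v x ^ (p - 1)) G :=
    continuousOn_const.mul (hv1.continuousOn.rpow_const fun _ _ => Or.inr hp1)
  simp only [zero_mul, integral_zero, inner_sub_left]
  rw [integral_sub (hφ.integrable_inner cv) (hφ.integrable_inner cu), Hu φ hφ, Hv φ hφ,
    sub_nonneg]
  refine integral_mono (hφ.integrable_mul du) (hφ.integrable_mul dv) fun x => ?_
  by_cases hx : x ∈ G
  · refine mul_le_mul_of_nonneg_right (mul_le_mul_of_nonneg_left ?_ H.lam_nonneg) (hφ0 x)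
    exact Real.rpow_le_rpow (H.pos x hx.1).le
      (H.le_affRefl hN hν hc hca (eAnn_subset _ _ _ hx.1) (mem_ofPred.1 hx.2).le) hp1
  · simp [image_eq_zero_of_notMem_tsupport fun h => hx (hφ.tsupport_subset h)]

/-- Symmetry propagates along connected sets of noncritical points. -/
lemma eventually_eq_of_isPreconnected (H : IsEigen p lam r0 r1 a W u) (hN : 2 ≤ N) {ν : Euc N}
    (hν : ‖ν‖ = 1) {c : ℝ} (hc : 0 < c) (hca : c ≤ ⟪ν, a⟫) {P : Set (Euc N)} (hP : IsPreconnected P)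
    (hPG : P ⊆ eAnn r0 r1 a ∩ {y | c < ⟪ν, y⟫}) (hPu : ∀ x ∈ P, gradient u x ≠ 0)
    (hne : ∃ x ∈ P, ∀ᶠ y in nhds x, u y = u (affRefl ν c y)) :
    ∀ x ∈ P, ∀ᶠ y in nhds x, u y = u (affRefl ν c y) := by
  set G : Set (Euc N) := eAnn r0 r1 a ∩ {y | c < ⟪ν, y⟫} with hG
  set v : Euc N → ℝ := fun y => u (affRefl ν c y) with hv
  have hGo : IsOpen G := (isOpen_eAnn r0 r1 a).inter
    (isOpen_lt continuous_const (continuous_const.inner continuous_id))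
  have hσG : ∀ y ∈ G, affRefl ν c y ∈ eAnn r0 r1 a := fun y hy =>
    affRefl_mem' hν hc hca (mem_eAnn.1 hy.1).1.le (mem_eAnn.1 hy.1).2 hy.2
  have hv1 : ContDiffOn ℝ 1 v G := H.contDiffOn.comp
    (contDiff_affRefl ν c).contDiffOn fun y hy => H.subset (eAnn_subset _ _ _ (hσG y hy))
  have hu1 : ContDiffOn ℝ 1 u G := H.contDiffOn.mono fun y hy =>
    H.subset (eAnn_subset _ _ _ hy.1)
  set D : Set (Euc N) := {x | ∀ᶠ y in nhds x, u y = v y} with hD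
  have hDo : IsOpen D := isOpen_setOfPred_eventually_nhds
  refine hP.subset_of_closure_inter_subset hDo ?_ ?_
  · obtain ⟨x, hx, hxD⟩ := hne
    exact ⟨x, hx, hxD⟩
  rintro z ⟨hzD, hzP⟩
  have hzG := hPG hzP
  have hzgrad : gradient u z = gradient v z := by
    have hcont : ContinuousAt (fun x => gradient u x - gradient v x) z :=
      ((continuousOn_gradient hGo hu1).sub (continuousOn_gradient hGo hv1)).continuousAt
        (hGo.mem_nhds hzG)
    by_contra hne
    have h1 : ∀ᶠ x in nhds z, gradient u x - gradient v x ≠ 0 :=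
      hcont.eventually_ne (sub_ne_zero.2 hne)
    obtain ⟨x, hxD, hx⟩ := ((mem_closure_iff_frequently.1 hzD).and_eventually h1).exists
    refine hx ?_
    rw [gradient, gradient, Filter.EventuallyEq.fderiv_eq hxD, sub_self]
  obtain ⟨R, hR, hRG⟩ := Metric.isOpen_iff.1 hGo z hzG
  obtain ⟨r, hr, hrR, hloc⟩ := exists_ball_eq_of_eq (p := p) (S := univ) hR (hu1.mono hRG)
    (hv1.mono hRG) (fun x hx _ => H.le_affRefl hN hν hc hca (eAnn_subset _ _ _ (hRG hx).1)
      (mem_ofPred.1 (hRG hx).2).le) (by simp) hzgrad (hPu z hzP)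
    (by simpa only [indicator_univ] using (H.weakDivGe_sub hN hν hc hca).mono hRG) H.one_lt
  obtain ⟨y, hyr, hyD⟩ := Metric.mem_closure_iff.1 hzD r hr |>.imp fun y hy => hy.symm
  have hyD' : ∀ᶠ x in nhds y, u x = v x := hyD
  filter_upwards [ball_mem_nhds z hr] with x hx
  exact hloc y (by rwa [mem_ball, dist_comm]) (hyD'.mono fun x hx _ => hx) x hx (mem_univ x)

/-- Equality of the normal derivatives near a point of the inner sphere gives local symmetry. -/
lemma exists_ball_eq_of_inner_gradient_eq (H : IsEigen p lam r0 r1 a W u) (hN : 2 ≤ N) {ν : Euc N}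
    (hν : ‖ν‖ = 1) (hc : 0 < ⟪ν, a⟫) {z : Euc N} (hz : ‖z - a‖ = r0) (hzc : ⟪ν, a⟫ < ⟪ν, z⟫)
    (hG : ∀ᶠ y in nhds z, ‖y - a‖ = r0 →
      ⟪gradient u (affRefl ν ⟪ν, a⟫ y), affRefl ν ⟪ν, a⟫ y - a⟫ = ⟪gradient u y, y - a⟫) :
    ∃ r > 0, ∀ x ∈ ball z r, r0 < ‖x - a‖ → u x = u (affRefl ν ⟪ν, a⟫ x) := by
  set c := ⟪ν, a⟫ with hcdef
  set v : Euc N → ℝ := fun y => u (affRefl ν c y) with hv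
  have hgap : r0 < r1 - ‖a‖ := by linarith [H.lt]
  have hr0 := H.r0_pos
  have hσn : ∀ y, ‖affRefl ν c y - a‖ = ‖y - a‖ := by
    intro y
    have := norm_affRefl_sub_sq hν c y a
    rw [← hcdef, sub_self, mul_zero, add_zero] at this
    exact (pow_left_inj₀ (norm_nonneg _) (norm_nonneg _) two_ne_zero).1 this
  have hσL : ∀ y, affRefl ν c y - a = linRefl ν (y - a) := by
    intro y
    rw [affRefl_apply hν, linRefl_apply hν, inner_sub_right, ← hcdef]; abel
  have hLL : ∀ w, linRefl ν (linRefl ν w) = w := fun w => by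
    have := (linRefl ν).symm_apply_apply w
    rwa [linRefl_symm] at this
  have hcn : Continuous fun y : Euc N => ‖y - a‖ := by fun_prop
  have hzm := mem_eAnnC_of_dist hz.ge (hz.le.trans hgap.le)
  have hσzm : affRefl ν c z ∈ eAnnC r0 r1 a :=
    mem_eAnnC_of_dist ((hσn z).trans hz).ge (((hσn z).trans hz).le.trans hgap.le)
  obtain ⟨R, hR, hRb⟩ : ∃ R > 0, ∀ y ∈ ball z R, y ∈ W ∧ affRefl ν c y ∈ W ∧
      ‖y - a‖ < r1 - ‖a‖ ∧ c < ⟪ν, y⟫ ∧ (‖y - a‖ = r0 →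
      ⟪gradient u (affRefl ν c y), affRefl ν c y - a⟫ = ⟪gradient u y, y - a⟫) := by
    have hcν : Continuous fun y : Euc N => ⟪ν, y⟫ := by fun_prop
    have h1 : ∀ᶠ y in nhds z, y ∈ W := H.isOpen.mem_nhds (H.subset hzm)
    have h2 : ∀ᶠ y in nhds z, affRefl ν c y ∈ W :=
      (continuous_affRefl ν c).continuousAt.eventually (H.isOpen.mem_nhds (H.subset hσzm))
    have := h1.and (h2.and ((hcn.continuousAt.eventually_lt continuousAt_const (by rw [hz]; exact hgap)).and
      ((continuousAt_const.eventually_lt hcν.continuousAt hzc).and hG)))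
    exact Metric.eventually_nhds_iff_ball.1 this
  have hu1 : ContDiffOn ℝ 1 u (ball z R) := H.contDiffOn.mono fun y hy => (hRb y hy).1
  have hv1 : ContDiffOn ℝ 1 v (ball z R) := H.contDiffOn.comp
    (contDiff_affRefl ν c).contDiffOn fun y hy => (hRb y hy).2.1
  have hle : ∀ y ∈ ball z R, r0 ≤ ‖y - a‖ → u y ≤ v y := fun y hy hya =>
    H.le_affRefl hN hν hc le_rfl (mem_eAnnC_of_dist hya (hRb y hy).2.2.1.le) (hRb y hy).2.2.2.1.le
  set S : Set (Euc N) := {y | r0 < ‖y - a‖} with hS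
  have hfr : frontier S ⊆ {y | ‖y - a‖ = r0} := fun y hy =>
    (frontier_lt_subset_eq continuous_const hcn hy).symm
  have hsph : ∀ y ∈ ball z R, ‖y - a‖ = r0 → u y = v y ∧ gradient u y = gradient v y := by
    intro y hy hya
    obtain ⟨h1, h2, h3, h4, h5⟩ := hRb y hy
    have hu0 : u y = 0 := H.zero_inner y hya
    have hv0 : v y = 0 := H.zero_inner _ ((hσn y).trans hya)
    refine ⟨hu0.trans hv0.symm, ?_⟩
    have dσ := differentiableAt_of_contDiffOn H.isOpen H.contDiffOn h2
    have hn : ⟪gradient v y, y - a⟫ = ⟪gradient u y, y - a⟫ := by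
      rw [← h5 hya, hσL, hv, gradient_comp_affRefl ν c dσ,
        ← LinearIsometryEquiv.inner_map_map (linRefl ν) _ (y - a), hLL]
    set k := gradient v y - gradient u y with hk
    set d := (y - a) - k with hd
    have hkd : ⟪k, y - a⟫ = 0 := by rw [hk, inner_sub_left, hn, sub_self]
    have hder : HasDerivAt (fun t : ℝ => v (y + t • d) - u (y + t • d)) ⟪k, d⟫ 0 := by
      rw [hk, inner_sub_left]
      exact (hasDerivAt_along (differentiableAt_of_contDiffOn isOpen_ball hv1 hy)).sub
        (hasDerivAt_along (differentiableAt_of_contDiffOn isOpen_ball hu1 hy))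
    obtain ⟨δ, hδ, hδb⟩ : ∃ δ > 0, ∀ t ∈ ball (0 : ℝ) δ, y + t • d ∈ ball z R := by
      refine Metric.eventually_nhds_iff_ball.1 ?_
      have hγ : ContinuousAt (fun t : ℝ => y + t • d) 0 := by fun_prop
      refine hγ.eventually (isOpen_ball.mem_nhds ?_)
      simpa using hy
    have hnn := HasDerivAt.nonneg_of_right hder (by simp [hu0, hv0]) hδ fun t ht htδ => by
      have htb := hδb t (by simpa [abs_of_pos ht] using htδ)
      refine sub_nonneg.2 (hle _ htb ?_)
      have e1 : ‖y + t • d - a‖ ^ 2 = r0 ^ 2 + 2 * t * r0 ^ 2 + t ^ 2 * ‖d‖ ^ 2 := by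
        have e2 : ⟪y - a, d⟫ = r0 ^ 2 := by
          rw [hd, inner_sub_right, real_inner_self_eq_norm_sq, hya, real_inner_comm, hkd, sub_zero]
        rw [show y + t • d - a = (y - a) + t • d by abel, norm_add_sq_real, inner_smul_right, e2,
          norm_smul, Real.norm_of_nonneg ht.le, hya]
        ring
      refine (pow_le_pow_iff_left₀ hr0.le (norm_nonneg _) two_ne_zero).1 ?_
      rw [e1]
      nlinarith [mul_nonneg ht.le (sq_nonneg r0), mul_nonneg (sq_nonneg t) (sq_nonneg ‖d‖)]
    rw [hd, inner_sub_right, hkd, real_inner_self_eq_norm_sq] at hnn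
    have hk0 : ‖k‖ = 0 := by nlinarith [norm_nonneg k]
    exact (sub_eq_zero.1 (norm_eq_zero.1 hk0)).symm
  have hzR := mem_ball_self (x := z) hR
  have hz0 : gradient u z ≠ 0 := by
    intro h
    have := H.inner_gradient_pos hN hz
    rw [h, inner_zero_left] at this
    exact lt_irrefl _ this
  set F : Euc N → Euc N := fun x => pFlux p (gradient v x) - pFlux p (gradient u x) with hF
  have hFc : ContinuousOn (S.indicator F) (ball z R) := by
    refine continuousOn_indicator_of_frontier ?_ fun x hx hxf => ?_
    · exact ((continuous_pFlux H.one_lt).comp_continuousOn (continuousOn_gradient isOpen_ball hv1)).sub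
        ((continuous_pFlux H.one_lt).comp_continuousOn (continuousOn_gradient isOpen_ball hu1))
    · simp only [hF]; rw [(hsph x hx (hfr hxf)).2, sub_self]
  have hsub : ball z R ∩ S ⊆ eAnn r0 r1 a ∩ {y | c < ⟪ν, y⟫} := fun y hy =>
    ⟨mem_eAnn_of_dist hy.2 (hRb y hy.1).2.2.1, (hRb y hy.1).2.2.2.1⟩
  have hD : WeakDivGe (ball z R) (S.indicator F) fun _ => 0 := by
    refine weakDivGe_of_eq_zero_inside hr0 hFc
      (fun x _ hx => indicator_of_notMem (s := S) (fun h => (not_lt.2 hx) h) F) ?_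
    exact ((H.weakDivGe_sub hN hν hc le_rfl).mono hsub).congr fun x hx =>
      (indicator_of_mem hx.2 F).symm
  obtain ⟨r, hr, hrR, hloc⟩ := exists_ball_eq_of_eq (S := S) hR hu1 hv1
    (fun x hx hxS => hle x hx (mem_ofPred.1 hxS).le) (fun x hx hxf => hsph x hx (hfr hxf))
    (hsph z hzR hz).2 hz0 hD H.one_lt
  refine ⟨r, hr, fun x hx hxS => ?_⟩
  set t := min (1 / 2) (r / (2 * r0)) with ht
  have ht0 : 0 < t := by positivity
  have ht1 : t ≤ 1 / 2 := min_le_left _ _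
  have htr : t * r0 < r := by
    have := mul_le_mul_of_nonneg_right (min_le_right (1 / 2) (r / (2 * r0))) hr0.le
    have e : r / (2 * r0) * r0 = r / 2 := by field_simp
    rw [e] at this; linarith
  have hyn : ‖z - t • (z - a) - a‖ < r0 := by
    rw [show z - t • (z - a) - a = (1 - t) • (z - a) by module, norm_smul, hz,
      Real.norm_of_nonneg (by linarith)]
    nlinarith
  refine hloc (z - t • (z - a)) ?_ ?_ x hx hxS
  · rw [mem_ball, dist_eq_norm, show z - t • (z - a) - z = -(t • (z - a)) by abel, norm_neg,
      norm_smul, hz, Real.norm_of_nonneg ht0.le]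
    exact htr
  · filter_upwards [hcn.continuousAt.eventually_lt continuousAt_const hyn] with y hy hyS
    exact absurd hyS (not_lt.2 hy.le)

end IsEigen
end Rigidity

section Conclusion
variable {N : ℕ}

lemma HasDerivAt.eq_zero_of_right {f : ℝ → ℝ} {f' δ : ℝ} (hf : HasDerivAt f f' 0) (hδ : 0 < δ)
    (h : ∀ t, 0 < t → t < δ → f t = 0) : f 0 = 0 ∧ f' = 0 := by
  have h0 : f 0 = 0 := by
    have h1 : Filter.Tendsto f (nhdsWithin 0 (Ioi 0)) (nhds (f 0)) :=
      hf.continuousAt.continuousWithinAt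
    refine tendsto_nhds_unique h1 (tendsto_const_nhds.congr' ?_)
    filter_upwards [Ioo_mem_nhdsGT hδ] with t ht
    exact (h t ht.1 ht.2).symm
  refine ⟨h0, le_antisymm ?_ (hf.nonneg_of_right h0 hδ fun t h1 h2 => (h t h1 h2).ge)⟩
  have := hf.neg.nonneg_of_right (by simp [h0]) hδ fun t h1 h2 => by simp [h t h1 h2]
  linarith

/-- A spherical half-shell is connected. -/
lemma isPreconnected_halfShell (ν a : Euc N) {α β : ℝ} (hα : 0 ≤ α) :
    IsPreconnected {x | α < ‖x - a‖ ∧ ‖x - a‖ < β ∧ ⟪ν, a⟫ < ⟪ν, x⟫} := by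
  have hconv : Convex ℝ ({x : Euc N | 0 < ⟪ν, x⟫} ×ˢ Ioo α β) :=
    (convex_halfSpace_gt (innerₛₗ ℝ ν).isLinear 0).prod (convex_Ioo α β)
  have h0 : ∀ x : Euc N, 0 < ⟪ν, x⟫ → 0 < ‖x‖ := fun x hx =>
    norm_pos_iff.2 fun h => by simp [h] at hx
  have hcont : ContinuousOn (fun y : Euc N × ℝ => a + (y.2 / ‖y.1‖) • y.1)
      ({x : Euc N | 0 < ⟪ν, x⟫} ×ˢ Ioo α β) := by
    have h1 : ContinuousOn (fun y : Euc N × ℝ => y.2 / ‖y.1‖)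
        ({x : Euc N | 0 < ⟪ν, x⟫} ×ˢ Ioo α β) :=
      continuousOn_snd.div continuousOn_fst.norm fun y hy => (h0 _ hy.1).ne'
    exact continuousOn_const.add (h1.smul continuousOn_fst)
  convert hconv.isPreconnected.image _ hcont using 1
  ext x
  constructor
  · rintro ⟨h1, h2, h3⟩
    have h4 : 0 < ⟪ν, x - a⟫ := by rw [inner_sub_right]; linarith
    refine ⟨(x - a, ‖x - a‖), ⟨h4, h1, h2⟩, ?_⟩
    simp [div_self (h0 _ h4).ne']
  · rintro ⟨⟨y, t⟩, ⟨hy, ht⟩, rfl⟩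
    have hy0 := h0 y hy
    have ht0 : 0 < t := hα.trans_lt ht.1
    have h5 : ‖a + (t / ‖y‖) • y - a‖ = t := by
      rw [add_sub_cancel_left, norm_smul, Real.norm_of_nonneg (by positivity)]
      field_simp
    refine ⟨?_, ?_, ?_⟩
    · simpa only [h5] using ht.1
    · simpa only [h5] using ht.2
    · simp only [inner_add_right, inner_smul_right]
      have : 0 < t / ‖y‖ * ⟪ν, y⟫ := mul_pos (by positivity) hy
      linarith

namespace IsEigen

variable {p lam r0 r1 : ℝ} {a : Euc N} {W : Set (Euc N)} {u : Euc N → ℝ}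

lemma lam_pos (H : IsEigen p lam r0 r1 a W u) {d : Euc N} (hd : ‖d‖ = 1) : 0 < lam := by
  refine H.lam_nonneg.lt_of_ne fun h0 => ?_
  have hgap : r0 < r1 - ‖a‖ := by linarith [H.lt]
  have hr0 := H.r0_pos
  have hx : a + ((r0 + (r1 - ‖a‖)) / 2) • d ∈ eAnn r0 r1 a := by
    have hn : ‖a + ((r0 + (r1 - ‖a‖)) / 2) • d - a‖ = (r0 + (r1 - ‖a‖)) / 2 := by
      rw [add_sub_cancel_left, norm_smul, hd, mul_one, Real.norm_of_nonneg (by linarith)]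
    exact mem_eAnn_of_dist (by rw [hn]; linarith) (by rw [hn]; linarith)
  have hcl : closure (eAnn r0 r1 a) ⊆ eAnnC r0 r1 a :=
    closure_minimal (eAnn_subset r0 r1 a) (isClosed_eAnnC r0 r1 a)
  have := comparison (b := u) (q := fun _ => 0) H.one_lt (isOpen_eAnn r0 r1 a)
    (isBounded_ball.subset sdiff_subset) ⟨a, fun h => by
      have := (mem_eAnn.1 h).2; simp at this; linarith⟩
    (H.contDiffOn.mono ((eAnn_subset r0 r1 a).trans H.subset)) contDiffOn_const
    (H.continuousOn.mono (hcl.trans H.subset)) continuousOn_const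
    (fun φ hφ _ => by
      rw [H.eq φ hφ, ← h0]
      simp [pFlux_zero]) (fun x hx => ?_) hx
  · exact (H.pos _ hx).not_ge this
  · have h1 := mem_eAnnC.1 (hcl hx.1)
    rw [(isOpen_eAnn r0 r1 a).frontier_eq, mem_sdiff, mem_eAnn, not_and_or, not_lt, not_lt] at hx
    rcases hx.2 with h2 | h2
    · exact (H.zero_outer x (le_antisymm h1.1 h2)).le
    · exact (H.zero_inner x (le_antisymm h2 h1.2)).le

lemma exists_shell_gradient_ne_zero (H : IsEigen p lam r0 r1 a W u) (hN : 2 ≤ N) :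
    ∃ ε > 0, r0 + ε ≤ r1 - ‖a‖ ∧ ∀ x, r0 ≤ ‖x - a‖ → ‖x - a‖ < r0 + ε → gradient u x ≠ 0 := by
  have hgap : 0 < r1 - ‖a‖ - r0 := by linarith [H.lt]
  have hr0 := H.r0_pos
  have hU : IsOpen (W ∩ gradient u ⁻¹' {0}ᶜ) :=
    (continuousOn_gradient H.isOpen H.contDiffOn).isOpen_inter_preimage H.isOpen
      isOpen_compl_singleton
  have hK : sphere a r0 ⊆ W ∩ gradient u ⁻¹' {0}ᶜ := fun x hx => by
    rw [mem_sphere, dist_eq_norm] at hx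
    refine ⟨H.subset (mem_eAnnC_of_dist hx.ge (by linarith)), fun h => ?_⟩
    have := H.inner_gradient_pos hN hx
    rw [mem_singleton_iff.1 h, inner_zero_left] at this
    exact lt_irrefl _ this
  obtain ⟨δ, hδ, hδs⟩ := (isCompact_sphere a r0).exists_thickening_subset_open hU hK
  refine ⟨min δ (r1 - ‖a‖ - r0), lt_min hδ hgap, ?_, fun x h1 h2 => ?_⟩
  · linarith [min_le_right δ (r1 - ‖a‖ - r0)]
  have hxa : 0 < ‖x - a‖ := hr0.trans_le h1
  refine (hδs (mem_thickening_iff.2 ⟨a + (r0 / ‖x - a‖) • (x - a), ?_, ?_⟩)).2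
  · rw [mem_sphere, dist_eq_norm, add_sub_cancel_left, norm_smul,
      Real.norm_of_nonneg (by positivity)]
    field_simp
  · rw [dist_eq_norm, show x - (a + (r0 / ‖x - a‖) • (x - a)) = (1 - r0 / ‖x - a‖) • (x - a) by
      module, norm_smul, Real.norm_of_nonneg (sub_nonneg.2 ((div_le_one hxa).2 h1)), sub_mul,
      div_mul_cancel₀ _ hxa.ne', one_mul]
    linarith [min_le_left δ (r1 - ‖a‖ - r0)]

lemma norm_ray' {a d : Euc N} (hd : ‖d‖ = 1) {t : ℝ} (ht : 0 ≤ t) : ‖a + t • d - a‖ = t := by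
  rw [add_sub_cancel_left, norm_smul, hd, mul_one, Real.norm_of_nonneg ht]

variable {s : ℝ} {e : Euc N}

lemma le_ray (H : IsEigen p lam r0 r1 (s • e) W u) (hN : 2 ≤ N) (hs : 0 < s)
    {t : ℝ} (ht0 : r0 ≤ t) (ht1 : t ≤ r1 - ‖s • e‖) {d d' : Euc N} (hd : ‖d‖ = 1) (hd' : ‖d'‖ = 1)
    (h : ⟪e, d'⟫ < ⟪e, d⟫) : u (s • e + t • d) ≤ u (s • e + t • d') := by
  have ht : 0 < t := H.r0_pos.trans_le ht0
  refine H.le_of_norm_eq hN (mem_eAnnC_of_dist ?_ ?_) ?_ ?_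
  · rwa [norm_ray' hd ht.le]
  · rwa [norm_ray' hd ht.le]
  · rw [norm_ray' hd ht.le, norm_ray' hd' ht.le]
  · rw [show s • e + t • d - (s • e + t • d') = t • (d - d') by module, real_inner_smul_left,
      real_inner_smul_right, inner_sub_left, real_inner_comm, real_inner_comm e d']
    exact mul_pos ht (mul_pos hs (by linarith))

/-- Equality at opposite points forces the eigenfunction to be constant on the sphere. -/
lemma ray_eq (H : IsEigen p lam r0 r1 (s • e) W u) (hN : 2 ≤ N) (hs : 0 < s) (he : ‖e‖ = 1)
    {t : ℝ} (ht0 : r0 ≤ t) (ht1 : t ≤ r1 - ‖s • e‖) (heq : u (s • e + t • e) = u (s • e - t • e))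
    {d : Euc N} (hd : ‖d‖ = 1) : u (s • e + t • d) = u (s • e + t • e) := by
  have hee : ⟪e, e⟫ = 1 := by rw [real_inner_self_eq_norm_sq, he, one_pow]
  have hle := abs_le.1 (abs_real_inner_le_norm e d)
  rw [he, hd, mul_one] at hle
  have hopp : s • e - t • e = s • e + t • (-e) := by module
  refine le_antisymm ?_ ?_
  · rcases hle.1.lt_or_eq with h | h
    · rw [heq, hopp]
      exact H.le_ray hN hs ht0 ht1 hd (by rwa [norm_neg]) (by rwa [inner_neg_right, hee])
    · have : e = -d := (inner_eq_one_iff_of_norm_eq_one (𝕜 := ℝ) he (by rwa [norm_neg])).1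
        (by rw [inner_neg_right]; linarith)
      rw [heq, hopp, this, neg_neg]
  · rcases hle.2.lt_or_eq with h | h
    · exact H.le_ray hN hs ht0 ht1 he hd (by rwa [hee])
    · rw [(inner_eq_one_iff_of_norm_eq_one (𝕜 := ℝ) he hd).1 h]

/-- The eigenfunction and its gradient cannot both be trivial along a sphere about the center of
the hole. -/
lemma not_const_on_sphere (H : IsEigen p lam r0 r1 (s • e) W u) (hN : 2 ≤ N) (hs : 0 < s)
    (he : ‖e‖ = 1) {ρ M : ℝ} (hρ0 : r0 < ρ) (hρ1 : ρ < r1 - s)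
    (hM : ∀ x, ‖x - s • e‖ = ρ → u x = M)
    (hg : ∀ d : Euc N, ‖d‖ = 1 → ⟪gradient u (s • e + ρ • d), d⟫ = 0) : False := by
  have hρ : 0 < ρ := H.r0_pos.trans hρ0
  have hns : ‖s • e‖ = s := by rw [norm_smul, he, mul_one, Real.norm_of_nonneg hs.le]
  have hee : ⟪e, e⟫ = 1 := by rw [real_inner_self_eq_norm_sq, he, one_pow]
  have hea : ⟪e, s • e⟫ = s := by rw [real_inner_smul_right, hee, mul_one]
  have hlam := H.lam_pos he
  set q := min (s / (2 * ρ)) (1 / 2) with hq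
  have hq0 : 0 < q := lt_min (by positivity) (by norm_num)
  have hq1 : q ≤ 1 / 2 := min_le_right _ _
  have hq2 : ρ * q ≤ s / 2 := by
    calc ρ * q ≤ ρ * (s / (2 * ρ)) := by gcongr; exact min_le_left _ _
      _ = s / 2 := by field_simp
  obtain ⟨d, hd, hed⟩ := exists_unit_inner_eq hN he (q := -q) (by nlinarith)
  set a := s • e with ha
  set z := a + ρ • d with hz
  have hza : ‖z - a‖ = ρ := norm_ray' hd hρ.le
  set g : Euc N → Euc N := fun x => x - a + (s - ⟪e, x⟫) • e with hgdef
  set V : Set (Euc N) := {x | 0 < ⟪e, x⟫} ∩ {x | ⟪e, x⟫ < s} ∩ {x | ‖g x‖ < ρ} ∩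
    {x | ‖x - a‖ < r1 - s} with hV
  have hVo : IsOpen V := by
    refine (((isOpen_lt ?_ ?_).inter (isOpen_lt ?_ ?_)).inter (isOpen_lt ?_ ?_)).inter
      (isOpen_lt ?_ ?_) <;> fun_prop
  have hez : ⟪e, z⟫ = s - ρ * q := by
    rw [hz, inner_add_right, hea, real_inner_smul_right, hed]; ring
  have hzV : z ∈ V := by
    refine ⟨⟨⟨?_, ?_⟩, ?_⟩, ?_⟩
    · rw [mem_ofPred, hez]; linarith
    · rw [mem_ofPred, hez]; linarith [mul_pos hρ hq0]
    · rw [mem_ofPred, hgdef]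
      have h1 : ‖z - a + (s - ⟪e, z⟫) • e‖ ^ 2 = ρ ^ 2 - (ρ * q) ^ 2 := by
        rw [norm_add_sq_real, hza, hez, norm_smul, he, inner_smul_right, real_inner_comm,
          inner_sub_right, hez, hea, Real.norm_eq_abs, mul_one, sq_abs]
        ring
      have h2 : 0 < ρ * q := mul_pos hρ hq0
      exact lt_of_pow_lt_pow_left₀ 2 hρ.le (by rw [h1]; nlinarith)
    · rw [mem_ofPred, hza]; exact hρ1
  obtain ⟨η, hη, hηV⟩ := Metric.isOpen_iff.1 hVo z hzV
  set R := η / 3 with hR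
  have hR0 : 0 < R := by positivity
  set b := a + (ρ + R) • d with hb
  have hbz : ‖z - b‖ = R := by
    rw [hz, hb, show a + ρ • d - (a + (ρ + R) • d) = -(R • d) by module, norm_neg, norm_smul, hd,
      mul_one, Real.norm_of_nonneg hR0.le]
  have hba : ‖b - a‖ = ρ + R := norm_ray' hd (by positivity)
  have hsub : closedBall b R ⊆ V := fun x hx => hηV (by
    rw [mem_closedBall, dist_eq_norm] at hx
    rw [mem_ball, dist_eq_norm]
    have := norm_sub_le (x - b) (z - b)
    rw [sub_sub_sub_cancel_right] at this
    linarith)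
  have hlow : ∀ x ∈ closedBall b R, ρ ≤ ‖x - a‖ := fun x hx => by
    rw [mem_closedBall, dist_eq_norm] at hx
    have := norm_sub_le (x - a) (x - b)
    rw [sub_sub_sub_cancel_left, hba] at this
    linarith
  have hM0 : 0 < M := by
    rw [← hM z hza]
    exact H.pos z (mem_eAnn_of_dist (by rw [hza]; exact hρ0) (by rw [hza, hns]; exact hρ1))
  have hMle : ∀ x ∈ closedBall b R, M ≤ u x := by
    intro x hx
    obtain ⟨⟨⟨h1, h2⟩, h3⟩, h4⟩ := hsub hx
    rw [mem_ofPred] at h1 h2 h3 h4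
    have hc : ContinuousOn (fun τ : ℝ => ‖x + τ • e - a‖) (Icc 0 (s - ⟪e, x⟫)) := by fun_prop
    obtain ⟨τ, hτ, hτρ⟩ := intermediate_value_Icc' (by linarith) hc
      (show ρ ∈ Icc _ _ from ⟨by
        have : x + (s - ⟪e, x⟫) • e - a = g x := by rw [hgdef]; module
        simpa only [this] using h3.le, by simpa using hlow x hx⟩)
    have hey : ⟪e, x + τ • e⟫ = ⟪e, x⟫ + τ := by
      rw [inner_add_right, real_inner_smul_right, hee, mul_one]
    replace hτρ : ‖x + τ • e - a‖ = ρ := hτρ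
    have := H.le_affRefl hN he (c := ⟪e, x⟫ + τ / 2) (x := x + τ • e) (by linarith [hτ.1])
      (by rw [hea]; linarith [hτ.1, hτ.2])
      (mem_eAnnC_of_dist (by rw [hτρ]; exact hρ0.le) (by rw [hτρ, hns]; exact hρ1.le))
      (by rw [hey]; linarith [hτ.1])
    rw [hM _ hτρ, affRefl_apply he, hey] at this
    convert this using 2
    module
  have hbs : closedBall b R ⊆ eAnn r0 r1 a := fun x hx =>
    mem_eAnn_of_dist (hρ0.trans_le (hlow x hx)) (by rw [hns]; exact (hsub hx).2)
  have hp1 : 0 ≤ p - 1 := by linarith [H.one_lt]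
  have hW : WeakDivGe (ball b R) (fun x => pFlux p (gradient u x))
      fun _ => lam * M ^ (p - 1) := by
    intro φ hφ hφ0
    rw [H.eq φ (hφ.mono (ball_subset_closedBall.trans hbs))]
    refine integral_mono (hφ.integrable_mul continuousOn_const) (hφ.integrable_mul ?_) fun x => ?_
    · have : ContinuousOn u (ball b R) := H.continuousOn.mono
        ((ball_subset_closedBall.trans hbs).trans ((eAnn_subset r0 r1 a).trans H.subset))
      exact continuousOn_const.mul (this.rpow_const fun _ _ => Or.inr hp1)
    · by_cases hx : x ∈ ball b R
      · refine mul_le_mul_of_nonneg_right ?_ (hφ0 x)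
        exact mul_le_mul_of_nonneg_left
          (Real.rpow_le_rpow hM0.le (hMle x (ball_subset_closedBall hx)) hp1) hlam.le
      · simp [image_eq_zero_of_notMem_tsupport fun h => hx (hφ.tsupport_subset h)]
  have := hopf_strict H.one_lt (by omega) hR0 (mul_pos hlam (Real.rpow_pos_of_pos hM0 _)) hbz
    H.isOpen (hbs.trans ((eAnn_subset r0 r1 a).trans H.subset)) H.contDiffOn hMle (hM z hza) hW
  rw [hb, hz, show a + (ρ + R) • d - (a + ρ • d) = R • d by module, inner_smul_right, ← hz, hz,
    hg d hd, mul_zero] at this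
  exact lt_irrefl _ this

end IsEigen
end Conclusion

section Strictness
variable {N : ℕ}

namespace IsEigen

variable {p lam r0 r1 s : ℝ} {e : Euc N} {W : Set (Euc N)} {u : Euc N → ℝ}

/-- Two rays along which the eigenfunction agrees also agree at the endpoint, to first order. -/
lemma eq_of_eq_on_rays (H : IsEigen p lam r0 r1 (s • e) W u) {ρ : ℝ} {d d' : Euc N}
    (hd : s • e + ρ • d ∈ eAnnC r0 r1 (s • e)) (hd' : s • e + ρ • d' ∈ eAnnC r0 r1 (s • e))
    (hρ : r0 < ρ) (h : ∀ t ∈ Ioo r0 ρ, u (s • e + t • d) = u (s • e + t • d')) :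
    u (s • e + ρ • d) = u (s • e + ρ • d') ∧
      ⟪gradient u (s • e + ρ • d), d⟫ = ⟪gradient u (s • e + ρ • d'), d'⟫ := by
  have h1 := (hasDerivAt_along (d := -d) (H.differentiableAt hd)).sub
    (hasDerivAt_along (d := -d') (H.differentiableAt hd'))
  obtain ⟨h2, h3⟩ := h1.eq_zero_of_right (sub_pos.2 hρ) fun t ht ht' => by
    have := h (ρ - t) ⟨by linarith, by linarith⟩
    refine sub_eq_zero.2 ?_
    convert this using 2 <;> module
  simp only [Pi.sub_apply, zero_smul, add_zero, inner_neg_right] at h2 h3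
  exact ⟨by linarith, by linarith⟩

/-- Symmetry along the axis is incompatible with a critical point on it. -/
lemma gradient_ne_zero_of_symm (H : IsEigen p lam r0 r1 (s • e) W u) (hN : 2 ≤ N) (hs : 0 < s)
    (he : ‖e‖ = 1) {ρ : ℝ} (hρ0 : r0 < ρ) (hρ1 : ρ < r1 - s)
    (hsymm : ∀ t ∈ Ioo r0 ρ, u (s • e + t • e) = u (s • e - t • e)) :
    gradient u (s • e + ρ • e) ≠ 0 := by
  intro hg
  have hns : ‖s • e‖ = s := by rw [norm_smul, he, mul_one, Real.norm_of_nonneg hs.le]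
  have hρ : 0 < ρ := H.r0_pos.trans hρ0
  have hmem : ∀ d : Euc N, ‖d‖ = 1 → s • e + ρ • d ∈ eAnnC r0 r1 (s • e) := fun d hd =>
    mem_eAnnC_of_dist (by rw [norm_ray' hd hρ.le]; exact hρ0.le)
      (by rw [norm_ray' hd hρ.le, hns]; exact hρ1.le)
  have hall : ∀ d : Euc N, ‖d‖ = 1 → u (s • e + ρ • d) = u (s • e + ρ • e) ∧
      ⟪gradient u (s • e + ρ • d), d⟫ = ⟪gradient u (s • e + ρ • e), e⟫ := fun d hd =>
    H.eq_of_eq_on_rays (hmem d hd) (hmem e he) hρ0 fun t ht =>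
      H.ray_eq hN hs he ht.1.le (by rw [hns]; linarith [ht.2]) (hsymm t ht) hd
  refine H.not_const_on_sphere hN hs he hρ0 hρ1 (M := u (s • e + ρ • e)) (fun x hx => ?_)
    fun d hd => by rw [(hall d hd).2, hg, inner_zero_left]
  have hd : ‖ρ⁻¹ • (x - s • e)‖ = 1 := by
    rw [norm_smul, hx, Real.norm_of_nonneg (inv_nonneg.2 hρ.le), inv_mul_cancel₀ hρ.ne']
  have := (hall _ hd).1
  rwa [smul_smul, mul_inv_cancel₀ hρ.ne', one_smul, add_sub_cancel] at this

/-- The eigenfunction is not symmetric along the whole axis. -/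
lemma not_symm_on_axis (H : IsEigen p lam r0 r1 (s • e) W u) (hs : 0 < s) (he : ‖e‖ = 1)
    (hsymm : ∀ t ∈ Ioo r0 (r1 - s), u (s • e + t • e) = u (s • e - t • e)) : False := by
  have hns : ‖s • e‖ = s := by rw [norm_smul, he, mul_one, Real.norm_of_nonneg hs.le]
  have hlt := H.lt
  have hr0 := H.r0_pos
  rw [hns] at hlt
  have hne : ‖-e‖ = 1 := by rwa [norm_neg]
  have hT : r0 < r1 - s := by linarith
  have hT0 : 0 ≤ r1 - s := by linarith
  have hmem : ∀ d : Euc N, ‖d‖ = 1 → s • e + (r1 - s) • d ∈ eAnnC r0 r1 (s • e) := fun d hd =>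
    mem_eAnnC_of_dist (by rw [norm_ray' hd hT0]; exact hT.le) (by rw [norm_ray' hd hT0, hns])
  obtain ⟨h1, -⟩ := H.eq_of_eq_on_rays (hmem e he) (hmem _ hne) hT fun t ht => by
    rw [hsymm t ht, smul_neg, sub_eq_add_neg]
  have h2 : u (s • e + (r1 - s) • e) = 0 := H.zero_outer _ (by
    rw [← add_smul, norm_smul, he, mul_one, add_sub_cancel, Real.norm_of_nonneg (by linarith)])
  refine (H.pos (s • e + (r1 - s) • -e) (mem_eAnn.2 ⟨?_, ?_⟩)).ne' (h1.symm.trans h2)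
  · rw [show s • e + (r1 - s) • -e = (2 * s - r1) • e by module, norm_smul, he, mul_one,
      Real.norm_eq_abs, abs_lt]
    constructor <;> linarith
  · rw [norm_ray' hne hT0]; exact hT

/-- Equality of normal derivatives at a reflected pair forces symmetry near the inner sphere. -/
lemma exists_shell_symm (H : IsEigen p lam r0 r1 (s • e) W u) (hN : 2 ≤ N) (hs : 0 < s)
    (he : ‖e‖ = 1) {ε : ℝ} (hε : 0 < ε) (hεr : r0 + ε ≤ r1 - ‖s • e‖)
    (hg : ∀ x, r0 ≤ ‖x - s • e‖ → ‖x - s • e‖ < r0 + ε → gradient u x ≠ 0) {x : Euc N}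
    (hx : ‖x - s • e‖ = r0) (hxs : s < ⟪e, x⟫)
    (heq : ⟪gradient u (affRefl e s x), affRefl e s x - s • e⟫ = ⟪gradient u x, x - s • e⟫) :
    ∀ y, r0 < ‖y - s • e‖ → ‖y - s • e‖ < r0 + ε → s < ⟪e, y⟫ →
      ∀ᶠ w in nhds y, u w = u (affRefl e s w) := by
  have hr0 := H.r0_pos
  have hee : ⟪e, e⟫ = 1 := by rw [real_inner_self_eq_norm_sq, he, one_pow]
  have hea : ⟪e, s • e⟫ = s := by rw [real_inner_smul_right, hee, mul_one]
  have hσn : ∀ y, ‖affRefl e s y - s • e‖ = ‖y - s • e‖ := fun y => by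
    have := norm_affRefl_sub_sq he s y (s • e)
    rw [hea, sub_self, mul_zero, add_zero] at this
    exact (pow_left_inj₀ (norm_nonneg _) (norm_nonneg _) two_ne_zero).1 this
  have hσi : ∀ y, ⟪e, affRefl e s y⟫ = 2 * s - ⟪e, y⟫ := fun y => by
    rw [affRefl_apply he, inner_sub_right, real_inner_smul_right, hee]; ring
  have hcmp : ∀ y w : Euc N, ⟪e, w⟫ < ⟪e, y⟫ → 0 < ⟪y - w, s • e⟫ := fun y w h => by
    rw [real_inner_smul_right, real_inner_comm, inner_sub_right]
    exact mul_pos hs (by linarith)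
  have hex : ⟪e, x - s • e⟫ ≤ r0 := by
    simpa [he, hx] using real_inner_le_norm e (x - s • e)
  have hex0 : 0 < ⟪e, x - s • e⟫ := by rw [inner_sub_right, hea]; linarith
  set q := ⟪e, x - s • e⟫ / (2 * r0) with hq
  have hq0 : 0 < q := by positivity
  have hq1 : q ≤ 1 := by rw [hq, div_le_one (by positivity)]; linarith
  obtain ⟨d, hd, hed⟩ := exists_unit_inner_eq hN he (q := q) (by nlinarith)
  have hray : ∀ t, ⟪e, s • e + t • d⟫ = s + t * q := fun t => by
    rw [inner_add_right, hea, real_inner_smul_right, hed]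
  have hz1 : s < ⟪e, s • e + r0 • d⟫ := by rw [hray]; linarith [mul_pos hr0 hq0]
  have hz2 : ⟪e, s • e + r0 • d⟫ < ⟪e, x⟫ := by
    have h1 : r0 * q = ⟪e, x - s • e⟫ / 2 := by rw [hq]; field_simp
    rw [inner_sub_right, hea] at h1
    rw [hray, h1]; linarith
  have hce : Continuous fun y : Euc N => ⟪e, y⟫ := continuous_const.inner continuous_id
  obtain ⟨r, hr, hball⟩ := H.exists_ball_eq_of_inner_gradient_eq hN he (by rwa [hea])
    (norm_ray' hd hr0.le) (by rwa [hea]) (by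
      rw [hea]
      filter_upwards [hce.continuousAt.eventually_const_lt hz1,
        hce.continuousAt.eventually_lt_const hz2] with y h1 h2 hy
      refine le_antisymm ?_ ?_
      · calc _ ≤ _ := H.inner_gradient_le hN ((hσn y).trans hy) ((hσn x).trans hx)
              (hcmp _ _ (by rw [hσi, hσi]; linarith))
          _ = _ := heq
          _ ≤ _ := H.inner_gradient_le hN hx hy (hcmp _ _ h2)
      · exact H.inner_gradient_le hN hy ((hσn y).trans hy)
          (hcmp _ _ (by rw [hσi]; linarith)))
  rw [hea] at hball
  have hP := isPreconnected_halfShell e (s • e) (β := r0 + ε) hr0.le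
  rw [hea] at hP
  have := H.eventually_eq_of_isPreconnected hN he hs hea.ge hP
    (fun y hy => ⟨mem_eAnn_of_dist hy.1 (hy.2.1.trans_le hεr), hy.2.2⟩)
    (fun y hy => hg y hy.1.le hy.2.1) ?_
  · exact fun y h1 h2 h3 => this y ⟨h1, h2, h3⟩
  set t := min r ε / 2 with ht
  have hm : 0 < min r ε := lt_min hr hε
  have ht0 : 0 < t := by positivity
  have htr : t < r := by linarith [min_le_left r ε]
  have htε : t < ε := by linarith [min_le_right r ε]
  have hn : ‖s • e + (r0 + t) • d - s • e‖ = r0 + t := norm_ray' hd (by positivity)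
  refine ⟨s • e + (r0 + t) • d, ⟨by rw [hn]; linarith, by rw [hn]; linarith, ?_⟩, ?_⟩
  · rw [hray]; linarith [mul_pos (by positivity : 0 < r0 + t) hq0]
  · have hin : s • e + (r0 + t) • d ∈ ball (s • e + r0 • d) r := by
      rw [mem_ball, dist_eq_norm, show s • e + (r0 + t) • d - (s • e + r0 • d) = t • d by module,
        norm_smul, hd, mul_one, Real.norm_of_nonneg ht0.le]
      exact htr
    have hcn : Continuous fun y : Euc N => ‖y - s • e‖ := by fun_prop
    filter_upwards [isOpen_ball.mem_nhds hin, hcn.continuousAt.eventually_const_lt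
      (show r0 < ‖s • e + (r0 + t) • d - s • e‖ by rw [hn]; linarith)] with y hy hy'
    exact hball y hy hy'

/-- The normal derivatives at a reflected pair of points of the inner sphere differ. -/
lemma inner_gradient_affRefl_ne (H : IsEigen p lam r0 r1 (s • e) W u) (hN : 2 ≤ N) (hs : 0 < s)
    (he : ‖e‖ = 1) {x : Euc N} (hx : ‖x - s • e‖ = r0) (hxs : s < ⟪e, x⟫) :
    ⟪gradient u (affRefl e s x), affRefl e s x - s • e⟫ ≠ ⟪gradient u x, x - s • e⟫ := by
  intro heq
  have hr0 := H.r0_pos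
  have hns : ‖s • e‖ = s := by rw [norm_smul, he, mul_one, Real.norm_of_nonneg hs.le]
  have hee : ⟪e, e⟫ = 1 := by rw [real_inner_self_eq_norm_sq, he, one_pow]
  have hea : ⟪e, s • e⟫ = s := by rw [real_inner_smul_right, hee, mul_one]
  have hray : ∀ t, ⟪e, s • e + t • e⟫ = s + t := fun t => by
    rw [inner_add_right, hea, real_inner_smul_right, hee, mul_one]
  have hσ : ∀ t : ℝ, affRefl e s (s • e + t • e) = s • e - t • e := fun t => by
    rw [affRefl_apply he, hray]; module
  obtain ⟨ε, hε, hεr, hg⟩ := H.exists_shell_gradient_ne_zero hN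
  have hshell := H.exists_shell_symm hN hs he hε hεr hg hx hxs heq
  have hseg : ∀ T, r0 < T → T ≤ r1 - s → (∀ t ∈ Ioo r0 T, gradient u (s • e + t • e) ≠ 0) →
      ∀ t ∈ Ioo r0 T, u (s • e + t • e) = u (s • e - t • e) := by
    intro T hT0 hT1 hgT t ht
    have hc : Continuous fun t : ℝ => s • e + t • e := by fun_prop
    have h := H.eventually_eq_of_isPreconnected hN he hs hea.ge
      (isPreconnected_Ioo.image (fun t : ℝ => s • e + t • e) (hc.continuousOn (s := Ioo r0 T)))
      (by
        rintro _ ⟨τ, hτ, rfl⟩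
        have hτ0 : 0 < τ := hr0.trans hτ.1
        refine ⟨mem_eAnn_of_dist ?_ ?_, ?_⟩
        · rw [norm_ray' he hτ0.le]; exact hτ.1
        · rw [norm_ray' he hτ0.le, hns]; exact hτ.2.trans_le hT1
        · rw [mem_ofPred, hray]; linarith)
      (by rintro _ ⟨τ, hτ, rfl⟩; exact hgT τ hτ) ?_ _ ⟨t, ht, rfl⟩
    · rw [← hσ]; exact h.self_of_nhds
    · set τ := r0 + min ε (T - r0) / 2 with hτ
      have hm : 0 < min ε (T - r0) := lt_min hε (by linarith)
      have h1 := min_le_left ε (T - r0)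
      have h2 := min_le_right ε (T - r0)
      refine ⟨_, ⟨τ, ⟨by linarith, by linarith⟩, rfl⟩, hshell _ ?_ ?_ ?_⟩
      · rw [norm_ray' he (by positivity)]; linarith
      · rw [norm_ray' he (by positivity)]; linarith
      · rw [hray]; linarith
  by_cases hcrit : ∃ t ∈ Ioo r0 (r1 - s), gradient u (s • e + t • e) = 0
  · obtain ⟨t, ht, hgt⟩ := hcrit
    have hgε : ∀ τ, r0 < τ → τ < r0 + ε → gradient u (s • e + τ • e) ≠ 0 := fun τ h1 h2 =>
      hg _ (by rw [norm_ray' he (hr0.trans h1).le]; exact h1.le)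
        (by rw [norm_ray' he (hr0.trans h1).le]; exact h2)
    have htε : r0 + ε ≤ t := not_lt.1 fun h => hgε t ht.1 h hgt
    have hcont : ContinuousOn (fun τ : ℝ => gradient u (s • e + τ • e)) (Icc (r0 + ε / 2) t) := by
      refine (continuousOn_gradient H.isOpen H.contDiffOn).comp (by fun_prop) fun τ hτ => ?_
      have hτ0 : 0 ≤ τ := by linarith [hτ.1]
      refine H.subset (mem_eAnnC_of_dist ?_ ?_)
      · rw [norm_ray' he hτ0]; linarith [hτ.1]
      · rw [norm_ray' he hτ0, hns]; linarith [hτ.2, ht.2]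
    have hK := isCompact_Icc.of_isClosed_subset
      (hcont.preimage_isClosed_of_isClosed isClosed_Icc (isClosed_singleton (x := 0)))
      inter_subset_left
    obtain ⟨ρ, ⟨hρ, hρ0⟩, hρm⟩ := hK.exists_isLeast ⟨t, ⟨by linarith, le_rfl⟩, hgt⟩
    have hρ1 : ρ < r1 - s := hρ.2.trans_lt ht.2
    have hρr : r0 < ρ := by linarith [hρ.1]
    refine H.gradient_ne_zero_of_symm hN hs he hρr hρ1 (hseg ρ hρr hρ1.le fun τ hτ h => ?_) hρ0
    rcases lt_or_ge τ (r0 + ε) with h1 | h1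
    · exact hgε τ hτ.1 h1 h
    · exact hτ.2.not_ge (hρm ⟨⟨by linarith, hτ.2.le.trans hρ.2⟩, h⟩)
  · push Not at hcrit
    refine H.not_symm_on_axis hs he (hseg (r1 - s) ?_ le_rfl hcrit)
    have := H.lt
    rw [hns] at this
    linarith

/-- Strict monotonicity of the normal derivative under reflection. -/
lemma inner_gradient_lt_affRefl (H : IsEigen p lam r0 r1 (s • e) W u) (hN : 2 ≤ N) (hs : 0 < s)
    (he : ‖e‖ = 1) {x : Euc N} (hx : ‖x - s • e‖ = r0) (hxs : s < ⟪e, x⟫) :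
    ⟪gradient u x, x - s • e⟫ < ⟪gradient u (affRefl e s x), affRefl e s x - s • e⟫ := by
  refine (H.inner_gradient_le hN hx ?_ ?_).lt_of_ne
    (H.inner_gradient_affRefl_ne hN hs he hx hxs).symm
  · have := norm_affRefl_sub_sq he s x (s • e)
    rw [real_inner_smul_right, real_inner_self_eq_norm_sq, he, one_pow, mul_one, sub_self, mul_zero,
      add_zero, hx] at this
    exact (pow_left_inj₀ (norm_nonneg _) H.r0_pos.le two_ne_zero).1 this
  · rw [affRefl_apply he, sub_sub_cancel, real_inner_smul_left, real_inner_smul_right,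
      real_inner_self_eq_norm_sq, he, one_pow, mul_one]
    exact mul_pos (by linarith) hs

end IsEigen
end Strictness

section Assembly
variable {N : ℕ}

lemma annulus_eq_eAnn (hN : 2 ≤ N) {r0 : ℝ} (r1 s : ℝ) (hr0 : r0 ≠ 0) :
    annulus hN r0 r1 s = eAnn r0 r1 (s • e1v hN) := by
  rw [annulus, eAnn, closure_ball _ hr0]

lemma pLambda1_nonneg (p : ℝ) (U : Set (Euc N)) : 0 ≤ pLambda1 p U := by
  refine Real.sInf_nonneg ?_
  rintro _ ⟨φ, -, -, rfl⟩
  exact div_nonneg (integral_nonneg fun _ => by positivity) (integral_nonneg fun _ => by positivity)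

lemma norm_e1v (hN : 2 ≤ N) : ‖e1v hN‖ = 1 := by
  simp [e1v]

lemma inner_e1v (hN : 2 ≤ N) (x : Euc N) : ⟪e1v hN, x⟫ = x (firstIdx N hN) := by
  simp [e1v, EuclideanSpace.inner_single_left]

lemma reflectH_eq_affRefl (hN : 2 ≤ N) (s : ℝ) (x : Euc N) :
    reflectH hN s x = affRefl (e1v hN) s x := by
  rw [reflectH, affRefl_apply (norm_e1v hN), inner_e1v]
  module

lemma IsFirstEigenfun.exists_isEigen {p r0 r1 s : ℝ} (hN : 2 ≤ N) (hp : 1 < p) (hr0 : 0 < r0)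
    (hs : s ∈ Ioo 0 (r1 - r0)) {u : Euc N → ℝ} (hu : IsFirstEigenfun p (annulus hN r0 r1 s) u) :
    ∃ W, IsEigen p (pLambda1 p (annulus hN r0 r1 s)) r0 r1 (s • e1v hN) W u := by
  have hlt : ‖s • e1v hN‖ + r0 < r1 := by
    rw [norm_smul, norm_e1v, mul_one, Real.norm_of_nonneg hs.1.le]
    linarith [hs.2]
  rw [annulus_eq_eAnn hN r1 s hr0.ne'] at hu ⊢
  obtain ⟨⟨W, hW, hWs, hWu⟩, hpos, hbd, -, hweak⟩ := hu
  have hcl := eAnnC_subset_closure hr0 hlt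
  have hfr : ∀ x, x ∈ eAnnC r0 r1 (s • e1v hN) → x ∉ eAnn r0 r1 (s • e1v hN) → u x = 0 :=
    fun x h1 h2 => hbd x ⟨hcl h1, by rwa [(isOpen_eAnn r0 r1 _).interior_eq]⟩
  have hcont : ContinuousOn u (eAnn r0 r1 (s • e1v hN)) :=
    hWu.continuousOn.mono (subset_closure.trans hWs)
  refine ⟨W, hp, pLambda1_nonneg _ _, hr0, hlt, hW, hcl.trans hWs, hWu, hpos, fun x hx => hfr x ?_ ?_,
    fun x hx => hfr x ?_ ?_, ?_⟩
  · refine mem_eAnnC.2 ⟨hx.le, ?_⟩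
    have := norm_sub_norm_le x (s • e1v hN)
    linarith
  · exact fun h => (mem_eAnn.1 h).1.ne hx
  · refine mem_eAnnC.2 ⟨?_, hx.ge⟩
    have := norm_sub_norm_le x (s • e1v hN)
    linarith
  · exact fun h => (mem_eAnn.1 h).2.ne' hx
  · exact hweak.weakDivEq hp (isOpen_eAnn r0 r1 _) (hWu.mono (subset_closure.trans hWs))
      (continuousOn_const.mul (hcont.rpow_const fun _ _ => Or.inr (by linarith)))

end Assembly

/-- Strict boundary derivative inequality for the first eigenfunction: for
`s ∈ (0, r1-r0)` and `x ∈ ∂B(s e₁, r0)` with `x₁ > s`, assuming existence and uniqueness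
of nonnegative solutions of the associated boundary value problems on the half-domain
`O = {x ∈ Ω(s) : x₁ > s}`, one has
`⟨∇y_{1,s}(x'), n(x')⟩ < ⟨∇y_{1,s}(x), n(x)⟩ < 0`, where `x'` is the reflection of `x`
across `{x₁ = s}` and `n(z) = (s e₁ - z)/r0`. -/
theorem strict_boundary_inequality_eigenfunction
    (N : ℕ) (hN : 2 ≤ N) (p : ℝ) (hp : 1 < p) (r0 r1 : ℝ)
    (hr0 : 0 < r0) (hr01 : r0 < r1)
    (s : ℝ) (hs : s ∈ Set.Ioo 0 (r1 - r0))
    (y1 : EuclideanSpace ℝ (Fin N) → ℝ)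
    (hy1 : IsFirstEigenfun p (annulus hN r0 r1 s) y1)
    (O : Set (EuclideanSpace ℝ (Fin N)))
    (hO : O = {x ∈ annulus hN r0 r1 s | s < x (firstIdx N hN)})
    (hexuniq : ∀ h' : EuclideanSpace ℝ (Fin N) → ℝ,
      ContinuousOn h' (frontier O) → (∀ x ∈ frontier O, 0 ≤ h' x) →
      ∃ w, SolClass p O
          (fun _ t => pLambda1 p (annulus hN r0 r1 s) * (|t| ^ (p - 2) * t)) h' w ∧
        ∀ w', SolClass p O
            (fun _ t => pLambda1 p (annulus hN r0 r1 s) * (|t| ^ (p - 2) * t)) h' w' →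
          ∀ x ∈ closure O, w' x = w x) :
    ∀ x ∈ Metric.sphere (s • e1v hN) r0, s < x (firstIdx N hN) →
      ⟪gradient y1 (reflectH hN s x), r0⁻¹ • (s • e1v hN - reflectH hN s x)⟫ <
        ⟪gradient y1 x, r0⁻¹ • (s • e1v hN - x)⟫ ∧
      ⟪gradient y1 x, r0⁻¹ • (s • e1v hN - x)⟫ < 0 := by
  intro x hx hxs
  obtain ⟨W, H⟩ := hy1.exists_isEigen hN hp hr0 hs
  rw [mem_sphere, dist_eq_norm] at hx
  have hn : ∀ y : Euc N, ⟪gradient y1 y, r0⁻¹ • (s • e1v hN - y)⟫ =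
      -(r0⁻¹ * ⟪gradient y1 y, y - s • e1v hN⟫) := fun y => by
    rw [← neg_sub y, smul_neg, inner_neg_right, real_inner_smul_right]
  have hr : 0 < r0⁻¹ := inv_pos.2 hr0
  rw [hn, hn, reflectH_eq_affRefl]
  refine ⟨neg_lt_neg (mul_lt_mul_of_pos_left ?_ hr), neg_neg_of_pos (mul_pos hr ?_)⟩
  · exact H.inner_gradient_lt_affRefl hN hs.1 (norm_e1v hN) hx (by rwa [inner_e1v])
  · exact H.inner_gradient_pos hN hx

end
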